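/- Let (ρ, u, B) be a strong solution on Ω×(0,T] of the isentropic compressible MHD system with Navier-slip boundary conditions satisfying the a priori hypotheses sup_{Ω×[0,T]} ρ ≤ 2ρ̂ and (2μ+λ)^{−2}∫₀^T‖P−P̄‖⁴_{L⁴}dt ≤ 2. Then there exists a constant D₂ > 0 depending only on Ω, ρ̂, a, γ, ν and μ such that, provided λ ≥ exp{(2+M)^{exp(D(1+C₀)³)}} with D ≥ D₂, one has sup_{0≤t≤T} ∫_Ω [(2μ+λ)(div u)² + μ(curl u)² + ν(curl B)²] dx + ∫₀^T (‖√ρ u̇‖²_{L²} + ‖∇curl B‖²_{L²} + ‖B_t‖²_{L²}) dt ≤ (2+M)^{exp(2D₂(1+C₀)³)}. -/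

import Mathlib

noncomputable section

open MeasureTheory Real Set Filter Topology Bornology

/-- Points of the plane (with an equivalent norm to the Euclidean one). -/
abbrev V2 := Fin 2 → ℝ

namespace MHD

/-- `i`-th partial derivative of a scalar field. -/
def pd (i : Fin 2) (f : V2 → ℝ) (x : V2) : ℝ :=
  fderiv ℝ f x (Pi.single i 1)

/-- Gradient of a scalar field. -/
def grad (f : V2 → ℝ) (x : V2) : V2 := fun i => pd i f x

/-- Divergence of a planar vector field. -/
def div2 (u : V2 → V2) (x : V2) : ℝ := ∑ i, pd i (fun y => u y i) x

/-- (Scalar) curl of a planar vector field. -/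
def curl2 (u : V2 → V2) (x : V2) : ℝ :=
  pd 0 (fun y => u y 1) x - pd 1 (fun y => u y 0) x

/-- Laplacian of a scalar field. -/
def lap (f : V2 → ℝ) (x : V2) : ℝ := ∑ j, pd j (pd j f) x

/-- Euclidean inner product on the plane. -/
def dot (a b : V2) : ℝ := ∑ i, a i * b i

/-- Squared Euclidean norm on the plane. -/
def nsq (a : V2) : ℝ := ∑ i, (a i) ^ 2

/-- Rotation by -90 degrees : `perp (n¹,n²) = (n²,−n¹)`. -/
def perp (v : V2) : V2 := ![v 1, -(v 0)]

/-- Squared Frobenius norm of the spatial gradient of a vector field. -/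
def gnsq (u : V2 → V2) (x : V2) : ℝ := ∑ i, ∑ j, (pd j (fun y => u y i) x) ^ 2

/-- Squared Frobenius norm of the second spatial gradient of a vector field. -/
def g2nsq (u : V2 → V2) (x : V2) : ℝ :=
  ∑ i, ∑ j, ∑ k, (pd k (fun y => pd j (fun z => u z i) y) x) ^ 2

/-- `Lᵖ(Ω)` norm of a scalar field. -/
def LpS (p : ℝ) (Ω : Set V2) (f : V2 → ℝ) : ℝ :=
  (∫ x in Ω, |f x| ^ p) ^ (1 / p)

/-- `Lᵖ(Ω)` norm of a vector field (Euclidean norm pointwise). -/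
def LpV (p : ℝ) (Ω : Set V2) (u : V2 → V2) : ℝ :=
  (∫ x in Ω, (nsq (u x)) ^ (p / 2)) ^ (1 / p)

/-- `Lᵖ(Ω)` norm of the gradient of a vector field. -/
def LpG (p : ℝ) (Ω : Set V2) (u : V2 → V2) : ℝ :=
  (∫ x in Ω, (gnsq u x) ^ (p / 2)) ^ (1 / p)

/-- `Lᵖ(Ω)` norm of the second gradient of a vector field. -/
def LpG2 (p : ℝ) (Ω : Set V2) (u : V2 → V2) : ℝ :=
  (∫ x in Ω, (g2nsq u x) ^ (p / 2)) ^ (1 / p)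

/-- Average of a scalar field over `Ω`. -/
def avg (Ω : Set V2) (f : V2 → ℝ) : ℝ := (∫ x in Ω, f x) / (volume Ω).toReal

/-- Time derivative of a time dependent scalar field. -/
def dt (f : ℝ → V2 → ℝ) (t : ℝ) (x : V2) : ℝ := deriv (fun s => f s x) t

/-- Time derivative of a time dependent vector field. -/
def dtV (u : ℝ → V2 → V2) (t : ℝ) (x : V2) : V2 := fun i => dt (fun s y => u s y i) t x

/-- Material derivative `u̇ = u_t + (u·∇)u` of the velocity field itself. -/
def matD (u : ℝ → V2 → V2) (t : ℝ) (x : V2) : V2 := fun i =>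
  dt (fun s y => u s y i) t x + dot (u t x) (grad (fun y => u t y i) x)

/-- The material derivative `(div u)· = (div u)_t + u·∇ div u`. -/
def divdot (u : ℝ → V2 → V2) (t : ℝ) (x : V2) : ℝ :=
  deriv (fun s => div2 (u s) x) t + dot (u t x) (grad (fun y => div2 (u t) y) x)

/-- Average pressure `P̄` at time `t`. -/
def Pbar (Ω : Set V2) (a γ : ℝ) (ρ : ℝ → V2 → ℝ) (t : ℝ) : ℝ :=
  avg Ω (fun x => a * ρ t x ^ γ)

/-- Effective viscous flux `F = (2μ+λ) div u − (P − P̄) − |B|²/2`. -/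
def Fflux (Ω : Set V2) (a γ μ lam : ℝ) (ρ : ℝ → V2 → ℝ) (u B : ℝ → V2 → V2)
    (t : ℝ) (x : V2) : ℝ :=
  (2 * μ + lam) * div2 (u t) x - (a * ρ t x ^ γ - Pbar Ω a γ ρ t) - nsq (B t x) / 2

/-- Potential energy density `G(ρ)`. -/
def Gpot (a γ ρb : ℝ) (r : ℝ) : ℝ :=
  r * ∫ ξ in ρb..r, (a * ξ ^ γ - a * ρb ^ γ) / ξ ^ 2

/-- Initial total energy `C₀`. -/
def C0 (Ω : Set V2) (a γ : ℝ) (ρ₀ : V2 → ℝ) (u₀ B₀ : V2 → V2) : ℝ :=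
  ∫ x in Ω, (ρ₀ x * nsq (u₀ x) / 2 + nsq (B₀ x) / 2 + Gpot a γ (avg Ω ρ₀) (ρ₀ x))

/-- The time weight `σ(t) = min{1,t}`. -/
def tw (t : ℝ) : ℝ := min 1 t

/-- Smoothness (in time and space) of a time dependent scalar field. -/
def Smooth2 (f : ℝ → V2 → ℝ) : Prop := ContDiff ℝ (⊤ : ℕ∞) (fun p : ℝ × V2 => f p.1 p.2)

/-- Smoothness (in time and space) of a time dependent vector field. -/
def Smooth2V (u : ℝ → V2 → V2) : Prop := ∀ i, Smooth2 (fun t x => u t x i)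

/-- A bounded domain with smooth boundary, given by a smooth defining function `φ`,
with outward unit normal `n` on the boundary. -/
structure SmoothDomain (Ω : Set V2) (n : V2 → V2) : Prop where
  nonempty : Ω.Nonempty
  bounded : IsBounded Ω
  defining : ∃ φ : V2 → ℝ, ContDiff ℝ (⊤ : ℕ∞) φ ∧ Ω = {x | φ x < 0} ∧
      frontier Ω = {x | φ x = 0} ∧
      (∀ x ∈ frontier Ω, grad φ x ≠ 0) ∧
      (∀ x ∈ frontier Ω, n x = (Real.sqrt (nsq (grad φ x)))⁻¹ • grad φ x)

/-- Outward unit normal on the boundary of a convex domain, characterized by the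
supporting hyperplane property. -/
def ConvexOuterNormal (Ω : Set V2) (n : V2 → V2) : Prop :=
  ∀ x ∈ frontier Ω, nsq (n x) = 1 ∧ ∀ y ∈ closure Ω, dot (n x) (y - x) ≤ 0

/-- Membership in `H¹(Ω)` for (a smooth representative of) a vector field. -/
def InH1V (Ω : Set V2) (f : V2 → V2) : Prop :=
  (∀ i, Differentiable ℝ fun x => f x i) ∧
  IntegrableOn (fun x => nsq (f x)) Ω volume ∧ IntegrableOn (fun x => gnsq f x) Ω volume

/-- Classical (pointwise) solution of the isentropic compressible MHD system with
Navier-slip boundary conditions, for times in the set `I`. -/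
structure IsMHDSol (Ω : Set V2) (n : V2 → V2) (a γ μ lam ν : ℝ) (I : Set ℝ)
    (ρ : ℝ → V2 → ℝ) (u B : ℝ → V2 → V2) : Prop where
  mass : ∀ t ∈ I, ∀ x ∈ Ω,
    dt ρ t x + div2 (fun y j => ρ t y * u t y j) x = 0
  momentum : ∀ t ∈ I, ∀ x ∈ Ω, ∀ i,
    dt (fun s y => ρ s y * u s y i) t x
      + (∑ j, pd j (fun y => ρ t y * u t y i * u t y j) x)
      + pd i (fun y => a * ρ t y ^ γ) x
    = μ * lap (fun y => u t y i) x
      + (μ + lam) * pd i (fun y => div2 (u t) y) x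
      + dot (B t x) (grad (fun y => B t y i) x)
      - pd i (fun y => nsq (B t y)) x / 2
  magnetic : ∀ t ∈ I, ∀ x ∈ Ω, ∀ i,
    dt (fun s y => B s y i) t x + dot (u t x) (grad (fun y => B t y i) x)
      - dot (B t x) (grad (fun y => u t y i) x) + B t x i * div2 (u t) x
    = ν * lap (fun y => B t y i) x
  divB : ∀ t ∈ I, ∀ x ∈ Ω, div2 (B t) x = 0
  slipU : ∀ t ∈ I, ∀ x ∈ frontier Ω, dot (u t x) (n x) = 0 ∧ curl2 (u t) x = 0
  slipB : ∀ t ∈ I, ∀ x ∈ frontier Ω, dot (B t x) (n x) = 0 ∧ curl2 (B t) x = 0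


/-- Hypotheses of the global existence theorem on the strong solution `(ρ,u,B)` and
its initial data, with constants `ρ̂` and `M` (conditions (1.8)–(1.9) of the paper). -/
def DataHyps (Ω : Set V2) (n : V2 → V2) (a γ μ lam ν ρhat M T : ℝ)
    (ρ : ℝ → V2 → ℝ) (u B : ℝ → V2 → V2) : Prop :=
  0 ≤ μ + lam ∧ 0 < T ∧
  Smooth2 ρ ∧ Smooth2V u ∧ Smooth2V B ∧
  IsMHDSol Ω n a γ μ lam ν (Ioc 0 T) ρ u B ∧
  (∀ t ∈ Icc 0 T, ∀ x ∈ Ω, 0 ≤ ρ t x) ∧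
  (∀ x ∈ Ω, ρ 0 x ≤ ρhat) ∧
  (∀ x ∈ frontier Ω, dot (u 0 x) (n x) = 0 ∧ curl2 (u 0) x = 0 ∧
      dot (B 0 x) (n x) = 0 ∧ curl2 (B 0) x = 0) ∧
  (∀ x ∈ Ω, div2 (B 0) x = 0) ∧
  (C0 Ω a γ (ρ 0) (u 0) (B 0)
      + (2 * μ + lam) * (LpS 2 Ω (div2 (u 0))) ^ 2
      + μ * (LpS 2 Ω (curl2 (u 0))) ^ 2
      + ν * (LpS 2 Ω (curl2 (B 0))) ^ 2 ≤ M)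

/-- The a priori hypotheses (3.1): `sup ρ ≤ 2ρ̂` and
`(2μ+λ)⁻² ∫₀^T ‖P−P̄‖⁴_{L⁴} dt ≤ 2`. -/
def APriori (Ω : Set V2) (a γ μ lam ρhat T : ℝ) (ρ : ℝ → V2 → ℝ) : Prop :=
  (∀ t ∈ Icc 0 T, ∀ x ∈ Ω, ρ t x ≤ 2 * ρhat) ∧
  ((2 * μ + lam) ^ 2)⁻¹ * (∫ t in (0:ℝ)..T,
      (LpS 4 Ω (fun x => a * ρ t x ^ γ - Pbar Ω a γ ρ t)) ^ 4) ≤ 2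

section
lemma pd_add (i : Fin 2) {f g : V2 → ℝ} {x : V2} (hf : DifferentiableAt ℝ f x)
    (hg : DifferentiableAt ℝ g x) : pd i (fun y => f y + g y) x = pd i f x + pd i g x := by
  unfold pd; rw [fderiv_fun_add hf hg]; rfl

lemma pd_sub (i : Fin 2) {f g : V2 → ℝ} {x : V2} (hf : DifferentiableAt ℝ f x)
    (hg : DifferentiableAt ℝ g x) : pd i (fun y => f y - g y) x = pd i f x - pd i g x := by
  unfold pd; rw [fderiv_fun_sub hf hg]; rfl

lemma pd_neg (i : Fin 2) {f : V2 → ℝ} {x : V2} :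
    pd i (fun y => - f y) x = - pd i f x := by
  unfold pd; rw [fderiv_fun_neg]; rfl

lemma pd_mul (i : Fin 2) {f g : V2 → ℝ} {x : V2} (hf : DifferentiableAt ℝ f x)
    (hg : DifferentiableAt ℝ g x) :
    pd i (fun y => f y * g y) x = f x * pd i g x + pd i f x * g x := by
  unfold pd; rw [fderiv_fun_mul hf hg]; simp; ring

lemma pd_const (i : Fin 2) (c : ℝ) (x : V2) : pd i (fun _ => c) x = 0 := by
  unfold pd; simp

lemma pd_const_mul (i : Fin 2) (c : ℝ) {f : V2 → ℝ} {x : V2} (hf : DifferentiableAt ℝ f x) :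
    pd i (fun y => c * f y) x = c * pd i f x := by
  rw [pd_mul i (by fun_prop) hf, pd_const]; ring

lemma pd_coord (i j : Fin 2) (x : V2) : pd i (fun y => y j) x = if i = j then 1 else 0 := by
  unfold pd
  have : HasFDerivAt (fun y : V2 => y j) (ContinuousLinearMap.proj (R := ℝ) (φ := fun _ : Fin 2 => ℝ) j) x :=
    (ContinuousLinearMap.proj (R := ℝ) (φ := fun _ : Fin 2 => ℝ) j).hasFDerivAt
  rw [this.fderiv]; simp [Pi.single_apply, eq_comm]

lemma pd_congr (i : Fin 2) {f g : V2 → ℝ} {x : V2} (h : f =ᶠ[𝓝 x] g) : pd i f x = pd i g x := by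
  unfold pd; rw [h.fderiv_eq]

lemma pd_congr_open (i : Fin 2) {f g : V2 → ℝ} {U : Set V2} (hU : IsOpen U) {x : V2} (hx : x ∈ U)
    (h : ∀ y ∈ U, f y = g y) : pd i f x = pd i g x :=
  pd_congr i (Filter.eventuallyEq_of_mem (hU.mem_nhds hx) h)

lemma fderiv_eq_pd {f : V2 → ℝ} (x v : V2) :
    fderiv ℝ f x v = v 0 * pd 0 f x + v 1 * pd 1 f x := by
  have : v = v 0 • (Pi.single 0 1 : V2) + v 1 • (Pi.single 1 1 : V2) := by
    ext i; fin_cases i <;> simp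
  conv_lhs => rw [this]
  rw [map_add, map_smul, map_smul]; simp [pd]

/-- smooth -/
abbrev Sm (f : V2 → ℝ) : Prop := ContDiff ℝ (⊤ : ℕ∞) f
/-- continuously differentiable -/
abbrev C1 (f : V2 → ℝ) : Prop := ContDiff ℝ 1 f

lemma Sm.pd {f : V2 → ℝ} (hf : Sm f) (i : Fin 2) : Sm (MHD.pd i f) := by
  unfold MHD.pd
  have h : ContDiff ℝ (⊤ : ℕ∞) (fderiv ℝ f) := hf.fderiv_right (by norm_cast)
  exact h.clm_apply contDiff_const

lemma Sm.add {f g : V2 → ℝ} (hf : Sm f) (hg : Sm g) : Sm (fun x => f x + g x) := ContDiff.add hf hg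
lemma Sm.sub {f g : V2 → ℝ} (hf : Sm f) (hg : Sm g) : Sm (fun x => f x - g x) := ContDiff.sub hf hg
lemma Sm.mul {f g : V2 → ℝ} (hf : Sm f) (hg : Sm g) : Sm (fun x => f x * g x) := ContDiff.mul hf hg
lemma Sm.neg {f : V2 → ℝ} (hf : Sm f) : Sm (fun x => - f x) := ContDiff.neg hf
lemma Sm.pow {f : V2 → ℝ} (hf : Sm f) (n : ℕ) : Sm (fun x => f x ^ n) := ContDiff.pow hf n
lemma Sm.cmul {f : V2 → ℝ} (hf : Sm f) (c : ℝ) : Sm (fun x => c * f x) := ContDiff.mul contDiff_const hf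
lemma Sm.cont {f : V2 → ℝ} (hf : Sm f) : Continuous f := ContDiff.continuous hf
lemma C1.add {f g : V2 → ℝ} (hf : C1 f) (hg : C1 g) : C1 (fun x => f x + g x) := ContDiff.add hf hg
lemma C1.sub {f g : V2 → ℝ} (hf : C1 f) (hg : C1 g) : C1 (fun x => f x - g x) := ContDiff.sub hf hg
lemma C1.mul {f g : V2 → ℝ} (hf : C1 f) (hg : C1 g) : C1 (fun x => f x * g x) := ContDiff.mul hf hg
lemma C1.neg {f : V2 → ℝ} (hf : C1 f) : C1 (fun x => - f x) := ContDiff.neg hf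
lemma C1.pow {f : V2 → ℝ} (hf : C1 f) (n : ℕ) : C1 (fun x => f x ^ n) := ContDiff.pow hf n
lemma C1.cmul {f : V2 → ℝ} (hf : C1 f) (c : ℝ) : C1 (fun x => c * f x) := ContDiff.mul contDiff_const hf
lemma C1.cont {f : V2 → ℝ} (hf : C1 f) : Continuous f := ContDiff.continuous hf

lemma Sm.c1 {f : V2 → ℝ} (hf : Sm f) : C1 f := hf.of_le (by norm_cast)

lemma C1.cpd {f : V2 → ℝ} (hf : C1 f) (i : Fin 2) : Continuous (MHD.pd i f) := by
  unfold MHD.pd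
  exact (hf.continuous_fderiv (by norm_num)).clm_apply continuous_const

lemma C1.d {f : V2 → ℝ} (hf : C1 f) (x : V2) : DifferentiableAt ℝ f x :=
  (hf.differentiable (by norm_num)) x

lemma Sm.d {f : V2 → ℝ} (hf : Sm f) (x : V2) : DifferentiableAt ℝ f x := hf.c1.d x

lemma Sm.cpd {f : V2 → ℝ} (hf : Sm f) (i : Fin 2) : Continuous (MHD.pd i f) := hf.c1.cpd i

lemma pd_comm {f : V2 → ℝ} (hf : Sm f) (i j : Fin 2) (x : V2) :
    pd i (pd j f) x = pd j (pd i f) x := by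
  have hs : IsSymmSndFDerivAt ℝ f x := by
    apply ContDiffAt.isSymmSndFDerivAt hf.contDiffAt
    simp; norm_cast
  have hd : DifferentiableAt ℝ (fderiv ℝ f) x := by
    have h : ContDiff ℝ 1 (fderiv ℝ f) := hf.fderiv_right (by norm_cast)
    exact (h.differentiable (by norm_num)) x
  have key : ∀ v w : V2, fderiv ℝ (fun y => fderiv ℝ f y w) x v = fderiv ℝ (fderiv ℝ f) x v w := by
    intro v w
    have := (hd.hasFDerivAt.clm_apply (hasFDerivAt_const w x)).fderiv
    rw [this]; simp
  unfold pd
  rw [key, key]; exact hs _ _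
end

section
/-- Bundled description of a bounded smooth convex domain. -/
structure Dom (Ω : Set V2) (φ : V2 → ℝ) : Prop where
  sm : Sm φ
  eq : Ω = {x | φ x < 0}
  fr : frontier Ω = {x | φ x = 0}
  gr : ∀ x, φ x = 0 → 0 < (pd 0 φ x) ^ 2 + (pd 1 φ x) ^ 2
  bd : IsBounded Ω
  cv : Convex ℝ Ω
  ne : Ω.Nonempty

section
variable {Ω : Set V2} {φ : V2 → ℝ}

lemma Dom.isOpen (h : Dom Ω φ) : IsOpen Ω := by
  rw [h.eq]; exact isOpen_lt h.sm.continuous continuous_const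

lemma Dom.meas (h : Dom Ω φ) : MeasurableSet Ω := h.isOpen.measurableSet

lemma Dom.closure_eq (h : Dom Ω φ) : closure Ω = {x | φ x ≤ 0} := by
  rw [closure_eq_self_union_frontier, h.fr]
  nth_rewrite 1 [h.eq]
  ext x; simp [le_iff_lt_or_eq]

lemma Dom.compact (h : Dom Ω φ) : IsCompact (closure Ω) := h.bd.isCompact_closure

lemma Dom.int (h : Dom Ω φ) {f : V2 → ℝ} (hf : Continuous f) : IntegrableOn f Ω volume :=
  (hf.continuousOn.integrableOn_compact h.compact).mono_set subset_closure

lemma fderiv_along {f : V2 → ℝ} (hf : C1 f) (x v : V2) (s : ℝ) :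
    HasDerivAt (fun s : ℝ => f (x + s • v)) (fderiv ℝ f (x + s • v) v) s := by
  have h1 : HasDerivAt (fun s : ℝ => x + s • v) v s := by
    simpa using ((hasDerivAt_id s).smul_const v).const_add x
  exact (hf.d _).hasFDerivAt.comp_hasDerivAt s h1

lemma Dom.lip_local (h : Dom Ω φ) {g : V2 → ℝ} (hg : C1 g) (hb : ∀ x, φ x = 0 → 0 ≤ g x)
    (x₀ : V2) (hx₀ : φ x₀ = 0) :
    ∃ C, 0 ≤ C ∧ ∀ᶠ x in 𝓝 x₀, x ∈ Ω → C * φ x ≤ g x := by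
  set v : V2 := ![pd 0 φ x₀, pd 1 φ x₀] with hv
  set c : ℝ := (pd 0 φ x₀) ^ 2 + (pd 1 φ x₀) ^ 2 with hc
  have hc0 : 0 < c := h.gr x₀ hx₀
  have hcv : fderiv ℝ φ x₀ v = c := by
    rw [fderiv_eq_pd]; simp [hv, hc]; ring
  set K : ℝ := |fderiv ℝ g x₀ v| + 1 with hK
  have hφc : Continuous (fun x => fderiv ℝ φ x v) :=
    (h.sm.c1.continuous_fderiv (by norm_num)).clm_apply continuous_const
  have hgc : Continuous (fun x => |fderiv ℝ g x v|) :=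
    ((hg.continuous_fderiv (by norm_num)).clm_apply continuous_const).abs
  have e1 : ∀ᶠ x in 𝓝 x₀, c / 2 < fderiv ℝ φ x v :=
    hφc.continuousAt.eventually_const_lt (by beta_reduce; rw [hcv]; linarith)
  have e2 : ∀ᶠ x in 𝓝 x₀, |fderiv ℝ g x v| < K :=
    hgc.continuousAt.eventually_lt_const (by beta_reduce; rw [hK]; linarith)
  obtain ⟨r, hr, hball⟩ := Metric.eventually_nhds_iff_ball.mp (e1.and e2)
  have hK0 : 0 < K := by rw [hK]; positivity
  refine ⟨2 * K / c, by positivity, ?_⟩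
  have e3 : ∀ᶠ x in 𝓝 x₀, dist x x₀ + (-2 * φ x / c) * ‖v‖ < r := by
    have hcont : Continuous (fun x => dist x x₀ + (-2 * φ x / c) * ‖v‖) := by
      have := h.sm.continuous
      fun_prop
    exact hcont.continuousAt.eventually_lt_const (by simp [hx₀, hr])
  filter_upwards [e3] with x hx hxΩ
  have hφx : φ x < 0 := by rw [h.eq] at hxΩ; exact hxΩ
  set s₁ : ℝ := -2 * φ x / c with hs₁
  have hs₁0 : 0 < s₁ := by rw [hs₁]; apply div_pos _ hc0; linarith
  have hin : ∀ s ∈ Icc 0 s₁, x + s • v ∈ Metric.ball x₀ r := by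
    intro s hs
    rw [Metric.mem_ball]
    calc dist (x + s • v) x₀ ≤ dist (x + s • v) x + dist x x₀ := dist_triangle _ _ _
      _ = s * ‖v‖ + dist x x₀ := by rw [dist_eq_norm]; simp [norm_smul, abs_of_nonneg hs.1]
      _ ≤ s₁ * ‖v‖ + dist x x₀ := by gcongr; exact hs.2
      _ < r := by linarith
  have hmc : Continuous (fun s : ℝ => φ (x + s • v)) := by
    have := h.sm.continuous
    fun_prop
  have hm1 : 0 ≤ φ (x + s₁ • v) := by
    have := Convex.mul_sub_le_image_sub_of_le_deriv (convex_Icc 0 s₁) (f := fun s : ℝ => φ (x + s • v))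
      hmc.continuousOn (fun s _ => (fderiv_along h.sm.c1 x v s).differentiableAt.differentiableWithinAt)
      (C := c / 2) (fun s hs => by
        rw [(fderiv_along h.sm.c1 x v s).deriv]
        exact (hball _ (hin s (interior_subset hs))).1.le) 0 (by simp [hs₁0.le]) s₁ (by simp [hs₁0.le]) hs₁0.le
    simp only [zero_smul, add_zero, sub_zero] at this
    have h2 : c / 2 * s₁ = - φ x := by rw [hs₁]; field_simp
    linarith
  obtain ⟨s, hs, hs0⟩ : ∃ s ∈ Icc 0 s₁, φ (x + s • v) = 0 := by
    have := intermediate_value_Icc hs₁0.le hmc.continuousOn (show (0:ℝ) ∈ _ from ⟨by simpa using hφx.le, hm1⟩)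
    obtain ⟨s, hs, h'⟩ := this
    exact ⟨s, hs, h'⟩
  have hgy := hb _ hs0
  have hmg : Continuous (fun s : ℝ => g (x + s • v)) := by
    have := hg.continuous
    fun_prop
  have := Convex.image_sub_le_mul_sub_of_deriv_le (convex_Icc 0 s₁) (f := fun s : ℝ => g (x + s • v))
      hmg.continuousOn (fun s _ => (fderiv_along hg x v s).differentiableAt.differentiableWithinAt)
      (C := K) (fun s hs => by
        rw [(fderiv_along hg x v s).deriv]
        exact (le_abs_self _).trans (hball _ (hin s (interior_subset hs))).2.le) 0 (by simp [hs₁0.le]) s hs hs.1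
  simp only [zero_smul, add_zero, sub_zero] at this
  have h3 : K * s ≤ K * s₁ := by gcongr; exact hs.2
  have h4 : K * s₁ = - (2 * K / c * φ x) := by rw [hs₁]; field_simp
  linarith

lemma Dom.lip (h : Dom Ω φ) {g : V2 → ℝ} (hg : C1 g) (hb : ∀ x, φ x = 0 → 0 ≤ g x) :
    ∃ C, 0 ≤ C ∧ ∀ x ∈ Ω, C * φ x ≤ g x := by
  have hmain : ∃ C, 0 ≤ C ∧ ∀ x ∈ closure Ω, x ∈ Ω → C * φ x ≤ g x := by
    refine h.compact.induction_on (p := fun s => ∃ C, 0 ≤ C ∧ ∀ x ∈ s, x ∈ Ω → C * φ x ≤ g x)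
      ⟨0, le_rfl, by simp⟩ ?_ ?_ ?_
    · rintro s t hst ⟨C, hC, H⟩
      exact ⟨C, hC, fun x hx => H x (hst hx)⟩
    · rintro s t ⟨C, hC, H⟩ ⟨C', hC', H'⟩
      refine ⟨C + C', by positivity, ?_⟩
      rintro x (hx | hx) hxΩ
      · have := H x hx hxΩ
        have hφx : φ x < 0 := by rw [h.eq] at hxΩ; exact hxΩ
        nlinarith
      · have := H' x hx hxΩ
        have hφx : φ x < 0 := by rw [h.eq] at hxΩ; exact hxΩ
        nlinarith
    · intro x₀ hx₀
      rw [h.closure_eq] at hx₀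
      rcases (le_iff_lt_or_eq.mp hx₀ : φ x₀ < 0 ∨ φ x₀ = 0) with h0 | h0
      · refine ⟨{x | φ x < φ x₀ / 2 ∧ g x₀ - 1 < g x}, ?_, (|g x₀| + 1) / (-(φ x₀ / 2)), ?_, ?_⟩
        · apply mem_nhdsWithin_of_mem_nhds
          exact (h.sm.continuous.continuousAt.eventually_lt_const (by linarith)).and
            (hg.continuous.continuousAt.eventually_const_lt (by linarith))
        · apply div_nonneg (by positivity); linarith
        · rintro x ⟨hx1, hx2⟩ _
          have : (|g x₀| + 1) / (-(φ x₀ / 2)) * φ x ≤ (|g x₀| + 1) / (-(φ x₀ / 2)) * (φ x₀ / 2) := by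
            have : 0 ≤ (|g x₀| + 1) / (-(φ x₀ / 2)) := by
              apply div_nonneg (by positivity); linarith
            gcongr
          have e : (|g x₀| + 1) / (-(φ x₀ / 2)) * (φ x₀ / 2) = -(|g x₀| + 1) := by
            have : φ x₀ ≠ 0 := h0.ne
            field_simp
          have := neg_abs_le (g x₀)
          linarith
      · obtain ⟨C, hC, H⟩ := h.lip_local hg hb x₀ h0
        exact ⟨_, mem_nhdsWithin_of_mem_nhds H, C, hC, fun x hx => hx⟩
  obtain ⟨C, hC, H⟩ := hmain
  exact ⟨C, hC, fun x hx => H x (subset_closure hx) hx⟩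

/-- cutoff profile -/
def cutH (ε s : ℝ) : ℝ := (max 0 (-s)) ^ 2 / ((max 0 (-s)) ^ 2 + ε ^ 2)
def cutH' (ε s : ℝ) : ℝ := -(2 * max 0 (-s) * ε ^ 2) / ((max 0 (-s)) ^ 2 + ε ^ 2) ^ 2

lemma hasDerivAt_maxsq (s : ℝ) : HasDerivAt (fun s : ℝ => (max 0 (-s)) ^ 2) (-(2 * max 0 (-s))) s := by
  rcases lt_trichotomy s 0 with hs | hs | hs
  · have h1 : HasDerivAt (fun s : ℝ => (-s) ^ 2) (2 * (-s) * (-1)) s := by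
      refine ((hasDerivAt_neg s).fun_pow 2).congr_deriv ?_
      simp
    rw [max_eq_right (by linarith)]
    have := h1.congr_of_eventuallyEq (f₁ := fun s : ℝ => (max 0 (-s)) ^ 2) (by
      filter_upwards [eventually_lt_nhds hs] with y hy
      rw [max_eq_right (by linarith)])
    refine this.congr_deriv ?_; ring
  · subst hs
    simp only [neg_zero, max_self, mul_zero]
    rw [hasDerivAt_iff_isLittleO]
    simp only [neg_zero, max_self, sub_zero, smul_zero, ne_eq, OfNat.ofNat_ne_zero, not_false_eq_true, zero_pow]
    have : (fun x : ℝ => (max 0 (-x)) ^ 2) =O[𝓝 0] fun x : ℝ => x ^ 2 := by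
      apply Asymptotics.isBigO_of_le
      intro x
      rw [norm_pow, norm_pow]
      gcongr
      rw [Real.norm_eq_abs, Real.norm_eq_abs]
      rcases le_total 0 (-x) with h | h
      · rw [max_eq_right h, abs_neg]
      · rw [max_eq_left h]; simp
    exact this.trans_isLittleO (by simpa using Asymptotics.isLittleO_pow_id (𝕜 := ℝ) (n := 2) (by norm_num))
  · rw [max_eq_left (by linarith)]
    have := (hasDerivAt_const s (0:ℝ)).congr_of_eventuallyEq (f₁ := fun s : ℝ => (max 0 (-s)) ^ 2) (by
      filter_upwards [eventually_gt_nhds hs] with y hy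
      rw [max_eq_left (by linarith)]; simp)
    simpa using this

lemma hasDerivAt_cutH {ε : ℝ} (hε : 0 < ε) (s : ℝ) : HasDerivAt (cutH ε) (cutH' ε s) s := by
  have hd : (max 0 (-s)) ^ 2 + ε ^ 2 ≠ 0 := by positivity
  have := (hasDerivAt_maxsq s).div ((hasDerivAt_maxsq s).add_const (ε ^ 2)) hd
  refine this.congr_deriv ?_
  unfold cutH'
  congr 1
  ring

lemma continuous_cutH' {ε : ℝ} (hε : 0 < ε) : Continuous (cutH' ε) := by
  unfold cutH'
  apply Continuous.div (by fun_prop) (by fun_prop)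
  intro s; positivity

lemma continuous_cutH {ε : ℝ} (hε : 0 < ε) : Continuous (cutH ε) := by
  unfold cutH
  apply Continuous.div (by fun_prop) (by fun_prop)
  intro s; positivity

lemma cutH_of_nonneg (ε : ℝ) {s : ℝ} (hs : 0 ≤ s) : cutH ε s = 0 := by
  unfold cutH; rw [max_eq_left (by linarith)]; simp
lemma cutH'_of_nonneg (ε : ℝ) {s : ℝ} (hs : 0 ≤ s) : cutH' ε s = 0 := by
  unfold cutH'; rw [max_eq_left (by linarith)]; simp

lemma Dom.compactSupp (h : Dom Ω φ) {H : ℝ → ℝ} (hH : ∀ s, 0 ≤ s → H s = 0) (f : V2 → ℝ) :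
    HasCompactSupport (fun x => H (φ x) * f x) := by
  apply HasCompactSupport.intro h.compact
  intro x hx
  rw [h.closure_eq] at hx
  simp only [mem_ofPred_eq, not_le] at hx
  rw [hH _ hx.le, zero_mul]

lemma Dom.cut_ibp (h : Dom Ω φ) {ε : ℝ} (hε : 0 < ε) {w : V2 → ℝ} (hw : C1 w) (i : Fin 2) :
    ∫ x in Ω, cutH ε (φ x) * pd i w x = - ∫ x in Ω, cutH' ε (φ x) * pd i φ x * w x := by
  have hχ : ∀ x, HasFDerivAt (fun x => cutH ε (φ x)) (cutH' ε (φ x) • fderiv ℝ φ x) x :=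
    fun x => (hasDerivAt_cutH hε (φ x)).comp_hasFDerivAt x (h.sm.d x).hasFDerivAt
  have hpd : ∀ x, fderiv ℝ (fun x => cutH ε (φ x)) x (Pi.single i 1) = cutH' ε (φ x) * pd i φ x := by
    intro x; rw [(hχ x).fderiv]; simp [pd]
  have c1 := (continuous_cutH hε).comp h.sm.continuous
  have c2 := (continuous_cutH' hε).comp h.sm.continuous
  have c3 := h.sm.cpd i
  have c4 := hw.cpd i
  have c5 := hw.continuous
  have key := integral_mul_fderiv_eq_neg_fderiv_mul_of_integrable (μ := (volume : Measure V2))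
    (f := fun x => cutH ε (φ x)) (g := w) (v := Pi.single i 1) (by
      simp only [hpd]
      have e : (fun x => cutH' ε (φ x) * pd i φ x * w x) = fun x => cutH' ε (φ x) * (pd i φ x * w x) := by
        ext x; ring
      rw [e]
      exact (c2.mul (c3.mul c5)).integrable_of_hasCompactSupport
        (h.compactSupp (fun s => cutH'_of_nonneg ε) _)) (by
      exact (c1.mul c4).integrable_of_hasCompactSupport
        (h.compactSupp (fun s => cutH_of_nonneg ε) _)) (by
      exact (c1.mul c5).integrable_of_hasCompactSupport
        (h.compactSupp (fun s => cutH_of_nonneg ε) _))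
      (fun x _ => (hχ x).differentiableAt) (fun x _ => hw.d x)
  simp only [hpd] at key
  have hout : ∀ x, x ∉ Ω → 0 ≤ φ x := by
    intro x hx; rw [h.eq] at hx; simpa using hx
  rw [setIntegral_eq_integral_of_forall_compl_eq_zero, setIntegral_eq_integral_of_forall_compl_eq_zero]
  · exact key
  · intro x hx; rw [cutH'_of_nonneg ε (hout x hx)]; simp
  · intro x hx; rw [cutH_of_nonneg ε (hout x hx)]; simp

/-- Divergence inequality. -/
lemma Dom.div_nonneg (h : Dom Ω φ) {w1 w2 : V2 → ℝ} (h1 : C1 w1) (h2 : C1 w2)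
    (hb : ∀ x, φ x = 0 → 0 ≤ w1 x * pd 0 φ x + w2 x * pd 1 φ x) :
    0 ≤ ∫ x in Ω, (pd 0 w1 x + pd 1 w2 x) := by
  have p0 := (h.sm.pd 0).c1
  have p1 := (h.sm.pd 1).c1
  obtain ⟨C, hC, HC⟩ := h.lip (g := fun x => w1 x * pd 0 φ x + w2 x * pd 1 φ x)
    ((h1.mul p0).add (h2.mul p1)) hb
  have c1 := h1.cpd 0
  have c2 := h2.cpd 1
  have cφ := h.sm.continuous
  let ε : ℕ → ℝ := fun k => 1 / ((k:ℝ) + 1)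
  have hε : ∀ k, 0 < ε k := fun k => by positivity
  have hε0 : Tendsto ε atTop (𝓝 0) := tendsto_one_div_add_atTop_nhds_zero_nat
  have hφneg : ∀ x ∈ Ω, φ x < 0 := by intro x hx; rw [h.eq] at hx; exact hx
  -- inequality for each k
  have ineq : ∀ k, - ∫ x in Ω, C * (cutH' (ε k) (φ x) * φ x) ≤
      ∫ x in Ω, cutH (ε k) (φ x) * (pd 0 w1 x + pd 1 w2 x) := by
    intro k
    have ch := (continuous_cutH (hε k)).comp cφ
    have ch' := (continuous_cutH' (hε k)).comp cφ
    have e1 : ∫ x in Ω, cutH (ε k) (φ x) * (pd 0 w1 x + pd 1 w2 x) =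
        - ∫ x in Ω, (cutH' (ε k) (φ x) * pd 0 φ x * w1 x + cutH' (ε k) (φ x) * pd 1 φ x * w2 x) := by
      rw [integral_add, neg_add, ← h.cut_ibp (hε k) h1 0, ← h.cut_ibp (hε k) h2 1, ← integral_add]
      · simp only [mul_add]
      · exact h.int (ch.mul c1)
      · exact h.int (ch.mul c2)
      · exact h.int ((ch'.mul (h.sm.cpd 0)).mul h1.continuous)
      · exact h.int ((ch'.mul (h.sm.cpd 1)).mul h2.continuous)
    rw [e1]
    apply neg_le_neg
    apply setIntegral_mono_on _ _ h.meas
    · intro x hx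
      have := HC x hx
      have hn : cutH' (ε k) (φ x) ≤ 0 := by
        unfold cutH'
        rw [neg_div]
        have : 0 ≤ 2 * max 0 (-φ x) * (ε k) ^ 2 / ((max 0 (-φ x)) ^ 2 + (ε k) ^ 2) ^ 2 := by
          have := le_max_left 0 (-φ x); positivity
        linarith
      nlinarith
    · exact h.int (((ch'.mul (h.sm.cpd 0)).mul h1.continuous).add ((ch'.mul (h.sm.cpd 1)).mul h2.continuous))
    · exact h.int (continuous_const.mul (ch'.mul cφ))
  have fin : volume Ω < ⊤ := h.bd.measure_lt_top
  have : IsFiniteMeasure (volume.restrict Ω) := ⟨by simpa using fin⟩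
  have lim1 : Tendsto (fun k => ∫ x in Ω, cutH (ε k) (φ x) * (pd 0 w1 x + pd 1 w2 x)) atTop
      (𝓝 (∫ x in Ω, (pd 0 w1 x + pd 1 w2 x))) := by
    apply tendsto_integral_of_dominated_convergence (fun x => |pd 0 w1 x + pd 1 w2 x|)
    · intro k
      exact (((continuous_cutH (hε k)).comp cφ).mul (c1.add c2)).aestronglyMeasurable
    · exact h.int (c1.add c2).abs
    · intro k
      refine Eventually.of_forall fun x => ?_
      rw [norm_mul]
      have : ‖cutH (ε k) (φ x)‖ ≤ 1 := by
        unfold cutH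
        have hp := hε k
        rw [Real.norm_of_nonneg (by positivity), div_le_one (by positivity)]
        nlinarith
      calc _ ≤ 1 * ‖pd 0 w1 x + pd 1 w2 x‖ := by gcongr
        _ = _ := by rw [one_mul, Real.norm_eq_abs]
    · filter_upwards [ae_restrict_mem h.meas] with x hx
      have hm : 0 < max 0 (-φ x) := by have := hφneg x hx; rw [max_eq_right] <;> linarith
      have : Tendsto (fun k => cutH (ε k) (φ x)) atTop (𝓝 1) := by
        unfold cutH
        have : Tendsto (fun k => (max 0 (-φ x)) ^ 2 / ((max 0 (-φ x)) ^ 2 + (ε k) ^ 2)) atTop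
          (𝓝 ((max 0 (-φ x)) ^ 2 / ((max 0 (-φ x)) ^ 2 + 0 ^ 2))) :=
          tendsto_const_nhds.div (tendsto_const_nhds.add (hε0.pow 2)) (by positivity)
        convert this using 2
        rw [eq_div_iff (by positivity)]; ring
      simpa using this.mul_const (pd 0 w1 x + pd 1 w2 x)
  have lim2 : Tendsto (fun k => - ∫ x in Ω, C * (cutH' (ε k) (φ x) * φ x)) atTop
      (𝓝 (- ∫ x in Ω, (0:ℝ))) := by
    apply Tendsto.neg
    apply tendsto_integral_of_dominated_convergence (fun x => C)
    · intro k
      exact (continuous_const.mul (((continuous_cutH' (hε k)).comp cφ).mul cφ)).aestronglyMeasurable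
    · exact integrable_const _
    · intro k
      filter_upwards [ae_restrict_mem h.meas] with x hx
      have hx' := hφneg x hx
      rw [norm_mul, Real.norm_of_nonneg hC]
      have : ‖cutH' (ε k) (φ x) * φ x‖ ≤ 1 := by
        unfold cutH'
        rw [max_eq_right (by linarith)]
        have hp := hε k
        have e : -(2 * -φ x * ε k ^ 2) / ((-φ x) ^ 2 + ε k ^ 2) ^ 2 * φ x =
          (2 * (φ x) ^ 2 * ε k ^ 2) / ((-φ x) ^ 2 + ε k ^ 2) ^ 2 := by ring
        rw [e, Real.norm_of_nonneg (by positivity), div_le_one (by positivity)]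
        nlinarith [sq_nonneg ((φ x)^2), sq_nonneg ((ε k)^2)]
      nlinarith
    · filter_upwards [ae_restrict_mem h.meas] with x hx
      have hm : 0 < max 0 (-φ x) := by have := hφneg x hx; rw [max_eq_right] <;> linarith
      have : Tendsto (fun k => cutH' (ε k) (φ x)) atTop (𝓝 0) := by
        unfold cutH'
        have : Tendsto (fun k => -(2 * max 0 (-φ x) * ε k ^ 2) / ((max 0 (-φ x)) ^ 2 + (ε k) ^ 2) ^ 2) atTop
          (𝓝 (-(2 * max 0 (-φ x) * 0 ^ 2) / ((max 0 (-φ x)) ^ 2 + 0 ^ 2) ^ 2)) :=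
          ((tendsto_const_nhds.mul (hε0.pow 2)).neg).div ((tendsto_const_nhds.add (hε0.pow 2)).pow 2) (by positivity)
        simpa using this
      simpa using (this.mul_const (φ x)).const_mul C
  have := le_of_tendsto_of_tendsto' lim2 lim1 ineq
  simpa using this

lemma Dom.div_zero (h : Dom Ω φ) {w1 w2 : V2 → ℝ} (h1 : C1 w1) (h2 : C1 w2)
    (hb : ∀ x, φ x = 0 → w1 x * pd 0 φ x + w2 x * pd 1 φ x = 0) :
    ∫ x in Ω, (pd 0 w1 x + pd 1 w2 x) = 0 := by
  apply le_antisymm _ (h.div_nonneg h1 h2 (fun x hx => (hb x hx).ge))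
  have := h.div_nonneg h1.neg h2.neg (fun x hx => by have := hb x hx; nlinarith)
  have e : ∀ x, pd 0 (-w1) x + pd 1 (-w2) x = -(pd 0 w1 x + pd 1 w2 x) := by
    intro x
    have a1 : pd 0 (-w1) x = - pd 0 w1 x := pd_neg 0
    have a2 : pd 1 (-w2) x = - pd 1 w2 x := pd_neg 1
    rw [a1, a2]; ring
  have e' : (fun x => pd 0 (fun y => -w1 y) x + pd 1 (fun y => -w2 y) x) = fun x => -(pd 0 w1 x + pd 1 w2 x) := by
    ext x; rw [pd_neg, pd_neg]; ring
  rw [e', integral_neg] at this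
  linarith

/-- integration by parts -/
lemma Dom.ibp (h : Dom Ω φ) {f w1 w2 : V2 → ℝ} (hf : C1 f) (h1 : C1 w1) (h2 : C1 w2)
    (hb : ∀ x, φ x = 0 → f x * (w1 x * pd 0 φ x + w2 x * pd 1 φ x) = 0) :
    ∫ x in Ω, f x * (pd 0 w1 x + pd 1 w2 x) = - ∫ x in Ω, (w1 x * pd 0 f x + w2 x * pd 1 f x) := by
  have := h.div_zero (hf.mul h1) (hf.mul h2) (fun x hx => by
    have := hb x hx; nlinarith)
  have e : (fun x => pd 0 (fun y => f y * w1 y) x + pd 1 (fun y => f y * w2 y) x) = fun x =>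
      f x * (pd 0 w1 x + pd 1 w2 x) + (w1 x * pd 0 f x + w2 x * pd 1 f x) := by
    ext x; rw [pd_mul 0 (hf.d x) (h1.d x), pd_mul 1 (hf.d x) (h2.d x)]; ring
  rw [e, integral_add] at this
  · linarith
  · exact h.int (hf.continuous.mul ((h1.cpd 0).add (h2.cpd 1)))
  · exact h.int ((h1.continuous.mul (hf.cpd 0)).add (h2.continuous.mul (hf.cpd 1)))

/-- integral over the domain -/
def II (Ω : Set V2) (f : V2 → ℝ) : ℝ := ∫ x in Ω, f x

lemma Dom.mono (h : Dom Ω φ) {f g : V2 → ℝ} (hf : Continuous f) (hg : Continuous g)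
    (hle : ∀ x ∈ Ω, f x ≤ g x) : II Ω f ≤ II Ω g :=
  setIntegral_mono_on (h.int hf) (h.int hg) h.meas hle

lemma Dom.congr (h : Dom Ω φ) {f g : V2 → ℝ}
    (hle : ∀ x ∈ Ω, f x = g x) : II Ω f = II Ω g :=
  setIntegral_congr_fun h.meas hle

lemma Dom.lin1 (_ : Dom Ω φ) (f : V2 → ℝ) (a : ℝ) : II Ω (fun x => a * f x) = a * II Ω f :=
  integral_const_mul a f

lemma Dom.iadd (h : Dom Ω φ) {f g : V2 → ℝ} (hf : Continuous f) (hg : Continuous g) :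
    II Ω (fun x => f x + g x) = II Ω f + II Ω g := integral_add (h.int hf) (h.int hg)

lemma Dom.isub (h : Dom Ω φ) {f g : V2 → ℝ} (hf : Continuous f) (hg : Continuous g) :
    II Ω (fun x => f x - g x) = II Ω f - II Ω g := integral_sub (h.int hf) (h.int hg)

lemma Dom.lin2 (h : Dom Ω φ) {f g : V2 → ℝ} (hf : Continuous f) (hg : Continuous g) (a b : ℝ) :
    II Ω (fun x => a * f x + b * g x) = a * II Ω f + b * II Ω g := by
  rw [h.iadd (by fun_prop) (by fun_prop), h.lin1, h.lin1]

lemma Dom.lin3 (h : Dom Ω φ) {f g k : V2 → ℝ} (hf : Continuous f) (hg : Continuous g)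
    (hk : Continuous k) (a b c : ℝ) :
    II Ω (fun x => a * f x + b * g x + c * k x) = a * II Ω f + b * II Ω g + c * II Ω k := by
  rw [h.iadd (by fun_prop) (by fun_prop), h.lin1, h.lin2 hf hg]

lemma Dom.lin4 (h : Dom Ω φ) {f g k l : V2 → ℝ} (hf : Continuous f) (hg : Continuous g)
    (hk : Continuous k) (hl : Continuous l) (a b c d : ℝ) :
    II Ω (fun x => a * f x + b * g x + c * k x + d * l x) =
      a * II Ω f + b * II Ω g + c * II Ω k + d * II Ω l := by
  rw [h.iadd (by fun_prop) (by fun_prop), h.lin1, h.lin3 hf hg hk]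

lemma Dom.lin5 (h : Dom Ω φ) {f g k l m : V2 → ℝ} (hf : Continuous f) (hg : Continuous g)
    (hk : Continuous k) (hl : Continuous l) (hm : Continuous m) (a b c d e : ℝ) :
    II Ω (fun x => a * f x + b * g x + c * k x + d * l x + e * m x) =
      a * II Ω f + b * II Ω g + c * II Ω k + d * II Ω l + e * II Ω m := by
  rw [h.iadd (by fun_prop) (by fun_prop), h.lin1, h.lin4 hf hg hk hl]

lemma Dom.le1 (h : Dom Ω φ) {e f : V2 → ℝ} (he : Continuous e) (hf : Continuous f)
    (a : ℝ) (hle : ∀ x ∈ Ω, e x ≤ a * f x) : II Ω e ≤ a * II Ω f := by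
  rw [← h.lin1]; exact h.mono he (by fun_prop) hle

lemma Dom.le2 (h : Dom Ω φ) {e f g : V2 → ℝ} (he : Continuous e) (hf : Continuous f)
    (hg : Continuous g) (a b : ℝ) (hle : ∀ x ∈ Ω, e x ≤ a * f x + b * g x) :
    II Ω e ≤ a * II Ω f + b * II Ω g := by
  rw [← h.lin2 hf hg]; exact h.mono he (by fun_prop) hle

lemma Dom.le3 (h : Dom Ω φ) {e f g k : V2 → ℝ} (he : Continuous e) (hf : Continuous f)
    (hg : Continuous g) (hk : Continuous k) (a b c : ℝ)
    (hle : ∀ x ∈ Ω, e x ≤ a * f x + b * g x + c * k x) :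
    II Ω e ≤ a * II Ω f + b * II Ω g + c * II Ω k := by
  rw [← h.lin3 hf hg hk]; exact h.mono he (by fun_prop) hle

lemma Dom.le4 (h : Dom Ω φ) {e f g k l : V2 → ℝ} (he : Continuous e) (hf : Continuous f)
    (hg : Continuous g) (hk : Continuous k) (hl : Continuous l) (a b c d : ℝ)
    (hle : ∀ x ∈ Ω, e x ≤ a * f x + b * g x + c * k x + d * l x) :
    II Ω e ≤ a * II Ω f + b * II Ω g + c * II Ω k + d * II Ω l := by
  rw [← h.lin4 hf hg hk hl]; exact h.mono he (by fun_prop) hle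

lemma Dom.le5 (h : Dom Ω φ) {e f g k l m : V2 → ℝ} (he : Continuous e) (hf : Continuous f)
    (hg : Continuous g) (hk : Continuous k) (hl : Continuous l) (hm : Continuous m) (a b c d p : ℝ)
    (hle : ∀ x ∈ Ω, e x ≤ a * f x + b * g x + c * k x + d * l x + p * m x) :
    II Ω e ≤ a * II Ω f + b * II Ω g + c * II Ω k + d * II Ω l + p * II Ω m := by
  rw [← h.lin5 hf hg hk hl hm]; exact h.mono he (by fun_prop) hle

lemma Dom.nn (h : Dom Ω φ) {f : V2 → ℝ} (hle : ∀ x ∈ Ω, 0 ≤ f x) : 0 ≤ II Ω f :=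
  setIntegral_nonneg h.meas hle

lemma Dom.cs (h : Dom Ω φ) {f g : V2 → ℝ} (hf : Continuous f) (hg : Continuous g) :
    (II Ω fun x => f x * g x) ^ 2 ≤ (II Ω fun x => f x ^ 2) * (II Ω fun x => g x ^ 2) := by
  have key : ∀ t : ℝ, 0 ≤ (II Ω fun x => g x ^ 2) * (t * t) + (2 * II Ω fun x => f x * g x) * t
      + II Ω fun x => f x ^ 2 := by
    intro t
    have : 0 ≤ II Ω fun x => (f x + t * g x) ^ 2 := h.nn fun x _ => sq_nonneg _
    have e : (fun x => (f x + t * g x) ^ 2) = fun x => 1 * f x ^ 2 + (2 * t) * (f x * g x) + t ^ 2 * g x ^ 2 := by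
      ext x; ring
    rw [e, h.lin3 (by fun_prop) (by fun_prop) (by fun_prop)] at this
    nlinarith
  have := discrim_le_zero key
  unfold discrim at this
  nlinarith

lemma Dom.div_nonneg' (h : Dom Ω φ) {w1 w2 : V2 → ℝ} (h1 : C1 w1) (h2 : C1 w2)
    (hb : ∀ x, φ x = 0 → 0 ≤ w1 x * pd 0 φ x + w2 x * pd 1 φ x) :
    0 ≤ II Ω fun x => (pd 0 w1 x + pd 1 w2 x) := h.div_nonneg h1 h2 hb

lemma Dom.div_zero' (h : Dom Ω φ) {w1 w2 : V2 → ℝ} (h1 : C1 w1) (h2 : C1 w2)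
    (hb : ∀ x, φ x = 0 → w1 x * pd 0 φ x + w2 x * pd 1 φ x = 0) :
    (II Ω fun x => (pd 0 w1 x + pd 1 w2 x)) = 0 := h.div_zero h1 h2 hb

lemma Dom.ibp' (h : Dom Ω φ) {f w1 w2 : V2 → ℝ} (hf : C1 f) (h1 : C1 w1) (h2 : C1 w2)
    (hb : ∀ x, φ x = 0 → f x * (w1 x * pd 0 φ x + w2 x * pd 1 φ x) = 0) :
    (II Ω fun x => f x * (pd 0 w1 x + pd 1 w2 x)) = - II Ω fun x => (w1 x * pd 0 f x + w2 x * pd 1 f x) :=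
  h.ibp hf h1 h2 hb

end
end

section
section
variable {Ω : Set V2} {φ : V2 → ℝ}

/-- tangential derivative -/
def td (φ g : V2 → ℝ) (x : V2) : ℝ := pd 0 φ x * pd 1 g x - pd 1 φ x * pd 0 g x

lemma Dom.td_zero (h : Dom Ω φ) {g : V2 → ℝ} (hg : C1 g) (hb : ∀ x, φ x = 0 → g x = 0)
    (x : V2) (hx : φ x = 0) : td φ g x = 0 := by
  have hext : IsLocalExtrOn g {y | φ y = φ x} x := by
    left
    filter_upwards [self_mem_nhdsWithin] with y hy
    have hy' : φ y = φ x := hy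
    rw [hb x hx, hb y (hy'.trans hx)]
  obtain ⟨a, b, hab, e⟩ := hext.exists_multipliers_of_hasStrictFDerivAt_1d
    (h.sm.contDiffAt.hasStrictFDerivAt (by simp)) (hg.contDiffAt.hasStrictFDerivAt (by simp))
  have e0 : a * pd 0 φ x + b * pd 0 g x = 0 := by
    have := congrArg (fun L => L (Pi.single 0 1)) e
    simpa [pd] using this
  have e1 : a * pd 1 φ x + b * pd 1 g x = 0 := by
    have := congrArg (fun L => L (Pi.single 1 1)) e
    simpa [pd] using this
  have hgr := h.gr x hx
  have hb0 : b ≠ 0 := by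
    intro hb0
    subst hb0
    simp only [zero_mul, add_zero, mul_eq_zero] at e0 e1
    have ha : a ≠ 0 := by rintro rfl; exact hab rfl
    have e0' := e0.resolve_left ha
    have e1' := e1.resolve_left ha
    rw [e0', e1'] at hgr; simp at hgr
  unfold td
  apply mul_left_cancel₀ hb0
  linear_combination (pd 0 φ x) * e1 - (pd 1 φ x) * e0

lemma Dom.pos_out (h : Dom Ω φ) (x : V2) (hx : φ x = 0) :
    ∀ᶠ s in 𝓝[>] (0:ℝ), 0 < φ (x + s • ![pd 0 φ x, pd 1 φ x]) := by
  have hd := fderiv_along h.sm.c1 x ![pd 0 φ x, pd 1 φ x] 0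
  have hgr := h.gr x hx
  rw [hasDerivAt_iff_tendsto_slope] at hd
  have hp : 0 < fderiv ℝ φ (x + (0:ℝ) • ![pd 0 φ x, pd 1 φ x]) ![pd 0 φ x, pd 1 φ x] := by
    rw [zero_smul, add_zero, fderiv_eq_pd]; simp; nlinarith
  have := hd.eventually_const_lt hp
  have h2 := this.filter_mono (nhdsWithin_mono (0:ℝ) (show Ioi (0:ℝ) ⊆ {0}ᶜ by
    intro y hy; simp at hy ⊢; exact hy.ne'))
  filter_upwards [h2, self_mem_nhdsWithin] with s hs hs0
  rw [slope_def_field] at hs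
  simp only [zero_smul, add_zero, hx, sub_zero] at hs
  have hs0' : (0:ℝ) < s := hs0
  exact (div_pos_iff_of_pos_right hs0').mp hs

/-- second fundamental form is nonnegative -/
lemma Dom.second (h : Dom Ω φ) (x : V2) (hx : φ x = 0) :
    0 ≤ pd 0 φ x * td φ (pd 1 φ) x - pd 1 φ x * td φ (pd 0 φ) x := by
  by_contra hneg
  push Not at hneg
  set p := pd 0 φ x with hp
  set q := pd 1 φ x with hq
  have hgr : 0 < p ^ 2 + q ^ 2 := h.gr x hx
  set S := p * td φ (pd 1 φ) x - q * td φ (pd 0 φ) x with hS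
  set k : ℝ := -S / (4 * (p ^ 2 + q ^ 2)) with hk
  have hk0 : 0 < k := div_pos (by linarith) (by positivity)
  let c : ℝ → V2 := fun s => x + ![-s * q + k * s ^ 2 * p, s * p + k * s ^ 2 * q]
  let c' : ℝ → V2 := fun s => ![-q + 2 * k * s * p, p + 2 * k * s * q]
  have hc : ∀ s, HasDerivAt c (c' s) s := by
    intro s
    apply HasDerivAt.const_add
    rw [hasDerivAt_pi]
    intro i
    have hs := hasDerivAt_id s
    fin_cases i
    · refine (((hs.neg.mul_const q)).add (((hs.pow 2).const_mul k).mul_const p)).congr_deriv ?_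
      simp [c']
      try ring_nf
      try simp
    · refine (((hs.mul_const p)).add (((hs.pow 2).const_mul k).mul_const q)).congr_deriv ?_
      simp [c']
      try ring_nf
      try simp
  have hcomp : ∀ {g : V2 → ℝ}, C1 g → ∀ s, HasDerivAt (fun s => g (c s))
      (c' s 0 * pd 0 g (c s) + c' s 1 * pd 1 g (c s)) s := by
    intro g hg s
    rw [← fderiv_eq_pd]
    exact (hg.d _).hasFDerivAt.comp_hasDerivAt s (hc s)
  have hder : deriv (fun s => φ (c s)) = fun s => c' s 0 * pd 0 φ (c s) + c' s 1 * pd 1 φ (c s) := by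
    ext s; exact (hcomp h.sm.c1 s).deriv
  have hc0 : c 0 = x := by
    simp only [c]; ext i; fin_cases i <;> simp
  have hc'0 : HasDerivAt (fun s => c' s 0) (2 * k * p) 0 := by
    have := ((((hasDerivAt_id (0:ℝ)).const_mul (2 * k)).mul_const p).const_add (-q))
    simpa [c'] using this
  have hc'1 : HasDerivAt (fun s => c' s 1) (2 * k * q) 0 := by
    have := ((((hasDerivAt_id (0:ℝ)).const_mul (2 * k)).mul_const q).const_add p)
    simpa [c'] using this
  have hsec : deriv (deriv (fun s => φ (c s))) 0 = S + 2 * k * (p ^ 2 + q ^ 2) := by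
    rw [hder]
    have := ((hc'0.mul (hcomp (h.sm.pd 0).c1 0)).add (hc'1.mul (hcomp (h.sm.pd 1).c1 0))).deriv
    refine Eq.trans this ?_
    simp only [hc0, c', hS, td, pd_comm h.sm 1 0]
    simp [← hp, ← hq]
    ring
  have hmax : IsLocalMax (fun s => φ (c s)) 0 := by
    apply isLocalMax_of_deriv_deriv_neg
    · rw [hsec]
      have : k * (4 * (p ^ 2 + q ^ 2)) = -S := by rw [hk]; field_simp
      nlinarith
    · rw [hder]; simp only [hc0, c']; simp [← hp, ← hq]; ring
    · exact (hcomp h.sm.c1 0).continuousAt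
  have hmax' : ∀ᶠ s in 𝓝 (0:ℝ), φ (c s) ≤ 0 := by
    have : ∀ᶠ s in 𝓝 (0:ℝ), φ (c s) ≤ φ (c 0) := hmax
    rwa [hc0, hx] at this
  have hmaxn : ∀ᶠ s in 𝓝 (0:ℝ), φ (c (-s)) ≤ 0 := by
    have : Tendsto (fun s : ℝ => -s) (𝓝 0) (𝓝 0) := by simpa using (continuous_neg (G := ℝ)).tendsto 0
    exact this.eventually hmax'
  have hout : ∀ᶠ s in 𝓝[>] (0:ℝ), 0 < φ (x + (k * s ^ 2) • ![p, q]) := by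
    have ht : Tendsto (fun s : ℝ => k * s ^ 2) (𝓝[>] 0) (𝓝[>] 0) := by
      rw [tendsto_nhdsWithin_iff]
      constructor
      · have : Continuous (fun s : ℝ => k * s ^ 2) := by fun_prop
        simpa using (this.tendsto 0).mono_left nhdsWithin_le_nhds
      · filter_upwards [self_mem_nhdsWithin] with s hs
        have : (0:ℝ) < s := hs
        show (0:ℝ) < k * s ^ 2
        positivity
    exact ht.eventually (h.pos_out x hx)
  obtain ⟨s, h1, h2, h3⟩ := ((hmax'.filter_mono nhdsWithin_le_nhds).and
    ((hmaxn.filter_mono nhdsWithin_le_nhds).and hout)).exists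
  have m1 : c s ∈ closure Ω := by rw [h.closure_eq]; exact h1
  have m2 : c (-s) ∈ closure Ω := by rw [h.closure_eq]; exact h2
  have m3 := h.cv.closure m1 m2 (a := 1/2) (b := 1/2) (by norm_num) (by norm_num) (by norm_num)
  rw [h.closure_eq] at m3
  have e : (1/2:ℝ) • c s + (1/2:ℝ) • c (-s) = x + (k * s ^ 2) • ![p, q] := by
    ext i; fin_cases i
    · show (1/2:ℝ) * (x 0 + (-s * q + k * s ^ 2 * p)) + (1/2) * (x 0 + (- -s * q + k * (-s) ^ 2 * p)) =
        x 0 + (k * s ^ 2) * p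
      ring
    · show (1/2:ℝ) * (x 1 + (s * p + k * s ^ 2 * q)) + (1/2) * (x 1 + (-s * p + k * (-s) ^ 2 * q)) =
        x 1 + (k * s ^ 2) * q
      ring
  rw [e] at m3
  exact absurd h3 (not_lt.mpr m3)

/-- tangential field -/
def Tan (φ u1 u2 : V2 → ℝ) : Prop := ∀ x, φ x = 0 → u1 x * pd 0 φ x + u2 x * pd 1 φ x = 0

lemma Dom.tan_form (h : Dom Ω φ) {u1 u2 : V2 → ℝ} (h1 : Sm u1) (h2 : Sm u2) (ht : Tan φ u1 u2)
    (x : V2) (hx : φ x = 0) : 0 ≤ u1 x * td φ u2 x - u2 x * td φ u1 x := by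
  have hz := h.td_zero (g := fun x => u1 x * pd 0 φ x + u2 x * pd 1 φ x)
    ((h1.c1.mul (h.sm.pd 0).c1).add (h2.c1.mul (h.sm.pd 1).c1)) ht x hx
  have hs := h.second x hx
  have hgr := h.gr x hx
  have htx := ht x hx
  unfold td at hz hs ⊢
  have d1 : ∀ i, pd i (fun x => u1 x * pd 0 φ x + u2 x * pd 1 φ x) x =
      (u1 x * pd i (pd 0 φ) x + pd i u1 x * pd 0 φ x) + (u2 x * pd i (pd 1 φ) x + pd i u2 x * pd 1 φ x) := by
    intro i
    rw [pd_add i ((h1.mul (h.sm.pd 0)).d x) ((h2.mul (h.sm.pd 1)).d x), pd_mul i (h1.d x) ((h.sm.pd 0).d x),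
      pd_mul i (h2.d x) ((h.sm.pd 1).d x)]
  rw [d1, d1] at hz
  generalize pd 0 φ x = p at *
  generalize pd 1 φ x = q at *
  generalize pd 0 (pd 0 φ) x = f00 at *
  generalize pd 0 (pd 1 φ) x = f01 at *
  generalize pd 1 (pd 0 φ) x = f10 at *
  generalize pd 1 (pd 1 φ) x = f11 at *
  generalize pd 0 u1 x = a0 at *
  generalize pd 1 u1 x = a1 at *
  generalize pd 0 u2 x = b0 at *
  generalize pd 1 u2 x = b1 at *
  generalize u1 x = v at *
  generalize u2 x = w at *
  set m := p ^ 2 + q ^ 2 with hm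
  set c := (-v * q + w * p) / m with hc
  have hv : v = - c * q := by
    rw [hc]; field_simp; rw [hm]; linear_combination p * htx
  have hw : w = c * p := by
    rw [hc]; field_simp; rw [hm]; linear_combination q * htx
  have e : v * (p * b1 - q * b0) - w * (p * a1 - q * a0) =
      c ^ 2 * (p * (p * f11 - q * f01) - q * (p * f10 - q * f00)) := by
    rw [hv, hw] at hz ⊢
    linear_combination (-c) * hz
  rw [e]
  positivity

lemma Dom.lemK (h : Dom Ω φ) {w1 w2 : V2 → ℝ} (h1 : Sm w1) (h2 : Sm w2)
    (hb : ∀ x, φ x = 0 → 0 ≤ w1 x * td φ w2 x - w2 x * td φ w1 x) :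
    0 ≤ II Ω fun x => (pd 0 w1 x * pd 1 w2 x - pd 1 w1 x * pd 0 w2 x) := by
  have key := h.div_nonneg' (w1 := fun x => w1 x * pd 1 w2 x - w2 x * pd 1 w1 x)
    (w2 := fun x => w2 x * pd 0 w1 x - w1 x * pd 0 w2 x)
    ((h1.mul (h2.pd 1)).sub (h2.mul (h1.pd 1))).c1
    ((h2.mul (h1.pd 0)).sub (h1.mul (h2.pd 0))).c1 (fun x hx => by
      have := hb x hx; unfold td at this; nlinarith)
  have e : (fun x => pd 0 (fun x => w1 x * pd 1 w2 x - w2 x * pd 1 w1 x) x +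
      pd 1 (fun x => w2 x * pd 0 w1 x - w1 x * pd 0 w2 x) x) =
      fun x => 2 * (pd 0 w1 x * pd 1 w2 x - pd 1 w1 x * pd 0 w2 x) := by
    ext x
    rw [pd_sub 0 ((h1.mul (h2.pd 1)).d x) ((h2.mul (h1.pd 1)).d x),
      pd_sub 1 ((h2.mul (h1.pd 0)).d x) ((h1.mul (h2.pd 0)).d x),
      pd_mul 0 (h1.d x) ((h2.pd 1).d x), pd_mul 0 (h2.d x) ((h1.pd 1).d x),
      pd_mul 1 (h2.d x) ((h1.pd 0).d x), pd_mul 1 (h1.d x) ((h2.pd 0).d x),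
      pd_comm h1 1 0, pd_comm h2 1 0]
    ring
  rw [e, h.lin1] at key
  linarith

/-- squared gradient of a scalar function -/
def gs (f : V2 → ℝ) (x : V2) : ℝ := (pd 0 f x) ^ 2 + (pd 1 f x) ^ 2
def dv (u1 u2 : V2 → ℝ) (x : V2) : ℝ := pd 0 u1 x + pd 1 u2 x
def cl (u1 u2 : V2 → ℝ) (x : V2) : ℝ := pd 0 u2 x - pd 1 u1 x

lemma gs_nonneg (f : V2 → ℝ) (x : V2) : 0 ≤ gs f x := by unfold gs; positivity

lemma C1.cgs {f : V2 → ℝ} (hf : C1 f) : Continuous (gs f) := by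
  have h0 := hf.cpd 0
  have h1 := hf.cpd 1
  unfold gs; fun_prop
lemma Sm.sgs {f : V2 → ℝ} (hf : Sm f) : Sm (gs f) := ((hf.pd 0).pow 2).add ((hf.pd 1).pow 2)
lemma Sm.dv {u1 u2 : V2 → ℝ} (h1 : Sm u1) (h2 : Sm u2) : Sm (dv u1 u2) := (h1.pd 0).add (h2.pd 1)
lemma Sm.cl {u1 u2 : V2 → ℝ} (h1 : Sm u1) (h2 : Sm u2) : Sm (cl u1 u2) := (h2.pd 0).sub (h1.pd 1)

lemma Dom.grad_bound (h : Dom Ω φ) {u1 u2 : V2 → ℝ} (h1 : Sm u1) (h2 : Sm u2) (ht : Tan φ u1 u2) :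
    (II Ω fun x => gs u1 x + gs u2 x) ≤ II Ω fun x => (dv u1 u2 x) ^ 2 + (cl u1 u2 x) ^ 2 := by
  have k := h.lemK h1 h2 (h.tan_form h1 h2 ht)
  have c1 := h1.cpd 0
  have c2 := h1.cpd 1
  have c3 := h2.cpd 0
  have c4 := h2.cpd 1
  have e : (fun x => (dv u1 u2 x) ^ 2 + (cl u1 u2 x) ^ 2) = fun x => (gs u1 x + gs u2 x) +
      2 * (pd 0 u1 x * pd 1 u2 x - pd 1 u1 x * pd 0 u2 x) := by
    ext x; unfold dv cl gs; ring
  have cg1 := h1.c1.cgs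
  have cg2 := h2.c1.cgs
  rw [e, h.iadd (by fun_prop) (by fun_prop), h.iadd (by fun_prop) (by fun_prop), h.iadd (by fun_prop) (by fun_prop), h.lin1]
  linarith

lemma Dom.hess_bound (h : Dom Ω φ) {f : V2 → ℝ} (hf : Sm f) (hb : ∀ x, φ x = 0 → f x = 0) :
    (II Ω fun x => gs (pd 0 f) x + gs (pd 1 f) x) ≤ II Ω fun x => (pd 0 (pd 0 f) x + pd 1 (pd 1 f) x) ^ 2 := by
  have := h.grad_bound (u1 := fun x => - pd 1 f x) (u2 := pd 0 f) (hf.pd 1).neg (hf.pd 0) (by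
    intro x hx
    have := h.td_zero hf.c1 hb x hx
    unfold td at this
    linarith)
  have e1 : ∀ x, gs (fun x => - pd 1 f x) x + gs (pd 0 f) x = gs (pd 0 f) x + gs (pd 1 f) x := by
    intro x; unfold gs; simp only [pd_neg]; ring
  have e2 : ∀ x, dv (fun x => - pd 1 f x) (pd 0 f) x ^ 2 + cl (fun x => - pd 1 f x) (pd 0 f) x ^ 2 =
      (pd 0 (pd 0 f) x + pd 1 (pd 1 f) x) ^ 2 := by
    intro x; unfold dv cl; simp only [pd_neg, pd_comm hf 1 0]; ring
  simpa only [e1, e2] using this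

lemma cprod_ineq (u1 u2 b1 b2 a0 a1 c0 c1 d0 d1 e0 e1 : ℝ) :
    (b1 ^ 2 + b2 ^ 2) * (a0 ^ 2 + a1 ^ 2 + (c0 ^ 2 + c1 ^ 2)) ≤
    3 * ((b1 ^ 2 + b2 ^ 2) * ((a0 + c1) ^ 2 + (c0 - a1) ^ 2)) +
    4 * ((u1 ^ 2 + u2 ^ 2) * (d0 ^ 2 + d1 ^ 2 + (e0 ^ 2 + e1 ^ 2))) -
    4 * ((u1 * d0 + a0 * b1 - (u2 * e0 + c0 * b2)) * (u1 * e1 + a1 * b2 + (u2 * d1 + c1 * b1)) -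
      (u1 * d1 + a1 * b1 - (u2 * e1 + c1 * b2)) * (u1 * e0 + a0 * b2 + (u2 * d0 + c0 * b1))) := by
  -- complex derivatives
  have s1 := sq_nonneg ((u1 * (d0 + e1) - u2 * (e0 - d1)) - (b1 * (a0 + c1) - b2 * (c0 - a1)))
  have s2 := sq_nonneg ((u2 * (d0 + e1) + u1 * (e0 - d1)) - (b2 * (a0 + c1) + b1 * (c0 - a1)))
  have s3 := sq_nonneg (2 * (u1 * (d0 - e1) - u2 * (e0 + d1)) + (b1 * (a0 - c1) - b2 * (c0 + a1)))
  have s4 := sq_nonneg (2 * (u2 * (d0 - e1) + u1 * (e0 + d1)) + (b2 * (a0 - c1) + b1 * (c0 + a1)))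
  have t1 : 0 ≤ (b1 ^ 2 + b2 ^ 2) * ((a0 + c1) ^ 2 + (c0 - a1) ^ 2) := by positivity
  have t2 : 0 ≤ (u1 ^ 2 + u2 ^ 2) * ((d0 + e1) ^ 2 + (e0 - d1) ^ 2) := by positivity
  have t3 : 0 ≤ (u1 ^ 2 + u2 ^ 2) * ((d0 - e1) ^ 2 + (e0 + d1) ^ 2) := by positivity
  nlinarith

lemma Dom.cprod_det (h : Dom Ω φ) {u1 u2 b1 b2 : V2 → ℝ} (h1 : Sm u1) (h2 : Sm u2) (g1 : Sm b1) (g2 : Sm b2)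
    (htu : Tan φ u1 u2) (htb : Tan φ b1 b2) :
    0 ≤ II Ω fun x => ((u1 x * pd 0 b1 x + pd 0 u1 x * b1 x - (u2 x * pd 0 b2 x + pd 0 u2 x * b2 x)) *
      (u1 x * pd 1 b2 x + pd 1 u1 x * b2 x + (u2 x * pd 1 b1 x + pd 1 u2 x * b1 x)) -
      (u1 x * pd 1 b1 x + pd 1 u1 x * b1 x - (u2 x * pd 1 b2 x + pd 1 u2 x * b2 x)) *
      (u1 x * pd 0 b2 x + pd 0 u1 x * b2 x + (u2 x * pd 0 b1 x + pd 0 u2 x * b1 x))) := by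
  have d1 : ∀ i x, pd i (fun x => u1 x * b1 x - u2 x * b2 x) x =
      u1 x * pd i b1 x + pd i u1 x * b1 x - (u2 x * pd i b2 x + pd i u2 x * b2 x) := by
    intro i x
    rw [pd_sub i ((h1.mul g1).d x) ((h2.mul g2).d x), pd_mul i (h1.d x) (g1.d x), pd_mul i (h2.d x) (g2.d x)]
  have d2 : ∀ i x, pd i (fun x => u1 x * b2 x + u2 x * b1 x) x =
      u1 x * pd i b2 x + pd i u1 x * b2 x + (u2 x * pd i b1 x + pd i u2 x * b1 x) := by
    intro i x
    rw [pd_add i ((h1.mul g2).d x) ((h2.mul g1).d x), pd_mul i (h1.d x) (g2.d x), pd_mul i (h2.d x) (g1.d x)]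
  have k := h.lemK (w1 := fun x => u1 x * b1 x - u2 x * b2 x) (w2 := fun x => u1 x * b2 x + u2 x * b1 x)
    ((h1.mul g1).sub (h2.mul g2)) ((h1.mul g2).add (h2.mul g1)) (by
      intro x hx
      have s1 := h.tan_form h1 h2 htu x hx
      have s2 := h.tan_form g1 g2 htb x hx
      have m1 : 0 ≤ (b1 x ^ 2 + b2 x ^ 2) * (u1 x * td φ u2 x - u2 x * td φ u1 x) := by positivity
      have m2 : 0 ≤ (u1 x ^ 2 + u2 x ^ 2) * (b1 x * td φ b2 x - b2 x * td φ b1 x) := by positivity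
      have := add_nonneg m1 m2
      unfold td at this ⊢
      rw [d1, d1, d2, d2]
      refine this.trans (le_of_eq ?_)
      ring)
  simpa only [d1, d2] using k

lemma Dom.cprod (h : Dom Ω φ) {u1 u2 b1 b2 : V2 → ℝ} (h1 : Sm u1) (h2 : Sm u2) (g1 : Sm b1) (g2 : Sm b2)
    (htu : Tan φ u1 u2) (htb : Tan φ b1 b2) :
    (II Ω fun x => (b1 x ^ 2 + b2 x ^ 2) * (gs u1 x + gs u2 x)) ≤
    3 * (II Ω fun x => (b1 x ^ 2 + b2 x ^ 2) * ((dv u1 u2 x) ^ 2 + (cl u1 u2 x) ^ 2)) +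
    4 * (II Ω fun x => (u1 x ^ 2 + u2 x ^ 2) * (gs b1 x + gs b2 x)) := by
  have k := h.cprod_det h1 h2 g1 g2 htu htb
  have a1 := h1.cpd 0
  have a2 := h1.cpd 1
  have a3 := h2.cpd 0
  have a4 := h2.cpd 1
  have a5 := g1.cpd 0
  have a6 := g1.cpd 1
  have a7 := g2.cpd 0
  have a8 := g2.cpd 1
  have q1 := h1.cont
  have q2 := h2.cont
  have q3 := g1.cont
  have q4 := g2.cont
  have := h.le3 (e := fun x => (b1 x ^ 2 + b2 x ^ 2) * (gs u1 x + gs u2 x))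
    (f := fun x => (b1 x ^ 2 + b2 x ^ 2) * ((dv u1 u2 x) ^ 2 + (cl u1 u2 x) ^ 2))
    (g := fun x => (u1 x ^ 2 + u2 x ^ 2) * (gs b1 x + gs b2 x))
    (k := fun x => ((u1 x * pd 0 b1 x + pd 0 u1 x * b1 x - (u2 x * pd 0 b2 x + pd 0 u2 x * b2 x)) *
      (u1 x * pd 1 b2 x + pd 1 u1 x * b2 x + (u2 x * pd 1 b1 x + pd 1 u2 x * b1 x)) -
      (u1 x * pd 1 b1 x + pd 1 u1 x * b1 x - (u2 x * pd 1 b2 x + pd 1 u2 x * b2 x)) *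
      (u1 x * pd 0 b2 x + pd 0 u1 x * b2 x + (u2 x * pd 0 b1 x + pd 0 u2 x * b1 x))))
    (by unfold gs; fun_prop) (by unfold dv cl; fun_prop) (by unfold gs; fun_prop) (by fun_prop) 3 4 (-4)
    (fun x _ => by
      have := cprod_ineq (u1 x) (u2 x) (b1 x) (b2 x) (pd 0 u1 x) (pd 1 u1 x) (pd 0 u2 x) (pd 1 u2 x)
        (pd 0 b1 x) (pd 1 b1 x) (pd 0 b2 x) (pd 1 b2 x)
      unfold gs dv cl
      linarith)
  linarith

lemma Dom.csq (h : Dom Ω φ) {u1 u2 : V2 → ℝ} (h1 : Sm u1) (h2 : Sm u2)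
    (htu : Tan φ u1 u2) :
    (II Ω fun x => (u1 x ^ 2 + u2 x ^ 2) * (gs u1 x + gs u2 x)) ≤
    (II Ω fun x => (u1 x ^ 2 + u2 x ^ 2) * ((dv u1 u2 x) ^ 2 + (cl u1 u2 x) ^ 2)) := by
  have k := h.cprod_det h1 h2 h1 h2 htu htu
  have a1 := h1.cpd 0
  have a2 := h1.cpd 1
  have a3 := h2.cpd 0
  have a4 := h2.cpd 1
  have q1 := h1.cont
  have q2 := h2.cont
  have := h.le2 (e := fun x => (u1 x ^ 2 + u2 x ^ 2) * (gs u1 x + gs u2 x))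
    (f := fun x => (u1 x ^ 2 + u2 x ^ 2) * ((dv u1 u2 x) ^ 2 + (cl u1 u2 x) ^ 2))
    (g := fun x => ((u1 x * pd 0 u1 x + pd 0 u1 x * u1 x - (u2 x * pd 0 u2 x + pd 0 u2 x * u2 x)) *
      (u1 x * pd 1 u2 x + pd 1 u1 x * u2 x + (u2 x * pd 1 u1 x + pd 1 u2 x * u1 x)) -
      (u1 x * pd 1 u1 x + pd 1 u1 x * u1 x - (u2 x * pd 1 u2 x + pd 1 u2 x * u2 x)) *
      (u1 x * pd 0 u2 x + pd 0 u1 x * u2 x + (u2 x * pd 0 u1 x + pd 0 u2 x * u1 x))))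
    (by unfold gs; fun_prop) (by unfold dv cl; fun_prop) (by fun_prop) 1 (-(1/2))
    (fun x _ => by
      unfold gs dv cl
      apply le_of_eq; ring)
  linarith

end
end

section
open scoped ENNReal

lemma lcs {α : Type*} [MeasurableSpace α] (μ : Measure α) {f g : α → ℝ≥0∞} (hf : AEMeasurable f μ)
    (hg : AEMeasurable g μ) :
    (∫⁻ x, f x * g x ∂μ) ^ 2 ≤ (∫⁻ x, f x ^ 2 ∂μ) * ∫⁻ x, g x ^ 2 ∂μ := by
  have h := ENNReal.lintegral_mul_le_Lp_mul_Lq μ (p := 2) (q := 2) (by constructor <;> norm_num) hf hg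
  simp only [Pi.mul_apply, ENNReal.rpow_two] at h
  calc (∫⁻ x, f x * g x ∂μ) ^ 2 ≤ ((∫⁻ x, f x ^ 2 ∂μ) ^ (1 / (2:ℝ)) * (∫⁻ x, g x ^ 2 ∂μ) ^ (1 / (2:ℝ))) ^ 2 := by
        gcongr
    _ = _ := by
        rw [mul_pow, ← ENNReal.rpow_natCast, ← ENNReal.rpow_natCast, ← ENNReal.rpow_mul, ← ENNReal.rpow_mul]
        norm_num

lemma add_sq4 (a b : ℝ≥0∞) : (a + b) ^ 2 ≤ 4 * (a ^ 2 + b ^ 2) := by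
  rcases le_total a b with h | h
  · calc (a + b) ^ 2 ≤ (b + b) ^ 2 := by gcongr
      _ = 4 * b ^ 2 := by ring
      _ ≤ _ := by gcongr; exact le_add_self
  · calc (a + b) ^ 2 ≤ (a + a) ^ 2 := by gcongr
      _ = 4 * a ^ 2 := by ring
      _ ≤ _ := by gcongr; exact le_self_add

/-- truncated radial kernel -/
def ka (s ρ : ℝ) (w : V2) : ℝ≥0∞ := if ‖w‖ ≤ ρ then ENNReal.ofReal (‖w‖ ^ (-s)) else 0
/-- annular kernel -/
def kb (δ ρ : ℝ) (w : V2) : ℝ≥0∞ := if δ < ‖w‖ ∧ ‖w‖ ≤ ρ then ENNReal.ofReal (‖w‖ ^ (-1:ℝ)) else 0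

lemma measurable_ka (s ρ : ℝ) : Measurable (ka s ρ) := by
  unfold ka
  apply Measurable.ite (measurableSet_le (by fun_prop) (by fun_prop)) (by fun_prop) (by fun_prop)

lemma measurable_kb (δ ρ : ℝ) : Measurable (kb δ ρ) := by
  unfold kb
  refine Measurable.ite (p := fun w : V2 => δ < ‖w‖ ∧ ‖w‖ ≤ ρ) ?_ (by fun_prop) (by fun_prop)
  exact (measurableSet_lt (f := fun _ : V2 => δ) (g := fun w : V2 => ‖w‖) (by fun_prop) (by fun_prop)).inter (measurableSet_le (f := fun w : V2 => ‖w‖) (g := fun _ : V2 => ρ) (by fun_prop) (by fun_prop))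

lemma ka_neg (s ρ : ℝ) (w : V2) : ka s ρ (-w) = ka s ρ w := by unfold ka; rw [norm_neg]
lemma kb_neg (s ρ : ℝ) (w : V2) : kb s ρ (-w) = kb s ρ w := by unfold kb; rw [norm_neg]

lemma ka_split (ρ : ℝ) (w : V2) : ka 1 ρ w = ka (3/4) ρ w * ka (1/4) ρ w := by
  unfold ka
  split_ifs with h
  · rw [← ENNReal.ofReal_mul (by positivity)]
    congr 1
    rcases (norm_nonneg w).eq_or_lt with h0 | h0
    · rw [← h0, Real.zero_rpow (by norm_num), Real.zero_rpow (by norm_num)]; ring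
    · rw [← Real.rpow_add h0]; norm_num
  · simp

lemma ka_sq (s ρ : ℝ) (w : V2) : ka s ρ w ^ 2 = ka (2 * s) ρ w := by
  unfold ka
  split_ifs with h
  · rw [← ENNReal.ofReal_pow (by positivity), ← Real.rpow_natCast, ← Real.rpow_mul (norm_nonneg w)]
    congr 2; push_cast; ring
  · simp

lemma ka_kb {δ ρ : ℝ} (w : V2) : ka 1 ρ w ≤ ka 1 δ w + kb δ ρ w := by
  unfold ka kb
  rcases le_or_gt ‖w‖ δ with h | h
  · simp only [h, if_true]
    split_ifs <;> simp
  · simp only [not_le.mpr h, if_false, h, true_and, zero_add]; exact le_rfl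

/-- volume of unit ball -/
def vb : ℝ := (volume : Measure V2).real (Metric.ball 0 1)

lemma vb_nonneg : 0 ≤ vb := measureReal_nonneg

lemma lint_radial {h : ℝ → ℝ} (h0 : ∀ y, 0 ≤ h y)
    (hi : IntegrableOn (fun y => y * h y) (Ioi 0)) :
    ∫⁻ w : V2, ENNReal.ofReal (h ‖w‖) = ENNReal.ofReal (2 * vb * ∫ y in Ioi (0:ℝ), y * h y) := by
  have hInt : Integrable (fun w : V2 => h ‖w‖) := by
    rw [integrable_fun_norm_addHaar (volume : Measure V2)]
    simpa using hi
  rw [← ofReal_integral_eq_lintegral_ofReal hInt (Eventually.of_forall fun w => h0 _)]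
  congr 1
  rw [integral_fun_norm_addHaar (volume : Measure V2)]
  simp [vb]; ring

lemma lint_ka {s ρ : ℝ} (hs : s < 2) (hρ : 0 < ρ) :
    ∫⁻ w : V2, ka s ρ w = ENNReal.ofReal (2 * vb * (ρ ^ (2 - s) / (2 - s))) := by
  have e : ∀ w : V2, ka s ρ w = ENNReal.ofReal ((Iic ρ).indicator (fun y => y ^ (-s)) ‖w‖) := by
    intro w
    unfold ka
    by_cases hw : ‖w‖ ≤ ρ <;> simp [hw]
  have heq : ∀ y ∈ Ioi (0:ℝ), y * (Iic ρ).indicator (fun y => y ^ (-s)) |y| =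
      (Ioc 0 ρ).indicator (fun y => y ^ (1 - s)) y := by
    intro y hy
    have hy0 : 0 < y := hy
    rw [abs_of_pos hy0]
    by_cases hyρ : y ≤ ρ
    · simp [hyρ, hy0]
      rw [sub_eq_add_neg, Real.rpow_add hy0, Real.rpow_one]
    · simp [hyρ]
  simp only [e]
  have := lint_radial (h := fun y => (Iic ρ).indicator (fun y => y ^ (-s)) |y|) (fun y => by
    by_cases hy : |y| ∈ Iic ρ
    · simp only [indicator_of_mem hy]; positivity
    · simp only [indicator_of_notMem hy]; exact le_rfl) (by
    rw [integrableOn_congr_fun heq measurableSet_Ioi]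
    apply Integrable.integrableOn
    rw [integrable_indicator_iff measurableSet_Ioc]
    rw [← intervalIntegrable_iff_integrableOn_Ioc_of_le hρ.le]
    exact intervalIntegral.intervalIntegrable_rpow' (by linarith))
  simp only [abs_norm] at this
  rw [this]
  congr 2
  rw [setIntegral_congr_fun measurableSet_Ioi heq, setIntegral_indicator measurableSet_Ioc,
    show Ioi (0:ℝ) ∩ Ioc 0 ρ = Ioc 0 ρ by ext y; simp, ← intervalIntegral.integral_of_le hρ.le,
    integral_rpow (Or.inl (by linarith)), Real.zero_rpow (by linarith)]
  rw [show 1 - s + 1 = 2 - s by ring, sub_zero]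

lemma lint_kb {δ ρ : ℝ} (hδ : 0 < δ) (hρ : δ ≤ ρ) :
    ∫⁻ w : V2, kb δ ρ w ^ 2 = ENNReal.ofReal (2 * vb * Real.log (ρ / δ)) := by
  have e : ∀ w : V2, kb δ ρ w ^ 2 = ENNReal.ofReal ((Ioc δ ρ).indicator (fun y => (y ^ 2)⁻¹) ‖w‖) := by
    intro w
    unfold kb
    by_cases hw : δ < ‖w‖ ∧ ‖w‖ ≤ ρ
    · have hp : 0 < ‖w‖ := hδ.trans hw.1
      simp only [hw, and_self, if_true]
      rw [indicator_of_mem (show ‖w‖ ∈ Ioc δ ρ from hw), ← ENNReal.ofReal_pow (by positivity)]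
      congr 1
      rw [Real.rpow_neg_one, inv_pow]
    · rw [if_neg hw, indicator_of_notMem (show ‖w‖ ∉ Ioc δ ρ from hw)]; simp
  have heq : ∀ y ∈ Ioi (0:ℝ), y * (Ioc δ ρ).indicator (fun y => (y ^ 2)⁻¹) y =
      (Ioc δ ρ).indicator (fun y => y⁻¹) y := by
    intro y hy
    have hy0 : 0 < y := hy
    by_cases hyρ : y ∈ Ioc δ ρ
    · rw [indicator_of_mem hyρ, indicator_of_mem hyρ]; field_simp
    · rw [indicator_of_notMem hyρ, indicator_of_notMem hyρ]; simp
  have h0 : (0:ℝ) ∉ uIcc δ ρ := by rw [uIcc_of_le hρ]; intro h; linarith [h.1]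
  simp only [e]
  rw [lint_radial (h := fun y => (Ioc δ ρ).indicator (fun y => (y ^ 2)⁻¹) y) (fun y => by
    exact Set.indicator_nonneg (fun _ _ => by positivity) _) (by
    rw [integrableOn_congr_fun heq measurableSet_Ioi]
    apply Integrable.integrableOn
    rw [integrable_indicator_iff measurableSet_Ioc]
    rw [← intervalIntegrable_iff_integrableOn_Ioc_of_le hρ]
    exact intervalIntegral.intervalIntegrable_inv (fun x hx => by rintro rfl; exact h0 hx) continuousOn_id)]
  congr 2
  rw [setIntegral_congr_fun measurableSet_Ioi heq, setIntegral_indicator measurableSet_Ioc,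
    show Ioi (0:ℝ) ∩ Ioc δ ρ = Ioc δ ρ by ext y; simp; intro h _; linarith, ← intervalIntegral.integral_of_le hρ,
    integral_inv h0]

lemma lint_shift (k : V2 → ℝ≥0∞) (hk : ∀ w, k (-w) = k w) (x : V2) :
    ∫⁻ z, k (z - x) = ∫⁻ w, k w := lintegral_sub_right_eq_self k x

/-- the double integral bound -/
lemma dbl {Ω : Set V2} {g q : V2 → ℝ≥0∞} (hg : Measurable g) (hq : Measurable q)
    {ρ : ℝ} (hρ : 0 < ρ) :
    ∫⁻ x in Ω, (∫⁻ z in Ω, g z * ka 1 ρ (z - x)) ^ 2 * q x ≤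
      ENNReal.ofReal (4 * (vb + 1) ^ 2 * (1 + 1) * ρ) * (∫⁻ z in Ω, g z ^ 2) * (∫⁻ x in Ω, q x ^ 2) ^ (1/2:ℝ) := by
  have mka : ∀ s x, Measurable (fun z => ka s ρ (z - x)) := fun s x => (measurable_ka s ρ).comp (by fun_prop)
  have mka2 : ∀ s, Measurable (fun p : V2 × V2 => ka s ρ (p.2 - p.1)) := fun s => (measurable_ka s ρ).comp (by fun_prop)
  have step1 : ∀ x, (∫⁻ z in Ω, g z * ka 1 ρ (z - x)) ^ 2 ≤
      (∫⁻ w, ka (3/2) ρ w) * ∫⁻ z in Ω, g z ^ 2 * ka (1/2) ρ (z - x) := by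
    intro x
    calc (∫⁻ z in Ω, g z * ka 1 ρ (z - x)) ^ 2 = (∫⁻ z in Ω, ka (3/4) ρ (z - x) * (g z * ka (1/4) ρ (z - x))) ^ 2 := by
          congr 2; ext z; rw [ka_split]; ring
      _ ≤ (∫⁻ z in Ω, ka (3/4) ρ (z - x) ^ 2) * ∫⁻ z in Ω, (g z * ka (1/4) ρ (z - x)) ^ 2 :=
          lcs _ (mka _ _).aemeasurable (hg.mul (mka _ _)).aemeasurable
      _ ≤ _ := by
          refine mul_le_mul' ?_ (lintegral_mono fun z => ?_)
          · calc ∫⁻ z in Ω, ka (3/4) ρ (z - x) ^ 2 ≤ ∫⁻ z, ka (3/4) ρ (z - x) ^ 2 := setLIntegral_le_lintegral _ _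
              _ = ∫⁻ z, ka (3/2) ρ (z - x) := by congr 1; ext z; rw [ka_sq]; norm_num
              _ = _ := lint_shift _ (ka_neg _ _) x
          · rw [mul_pow, ka_sq]; norm_num
  have step2 : ∀ z, ∫⁻ x in Ω, ka (1/2) ρ (z - x) * q x ≤
      (∫⁻ w, ka 1 ρ w) ^ (1/2:ℝ) * (∫⁻ x in Ω, q x ^ 2) ^ (1/2:ℝ) := by
    intro z
    have h1 := lcs (volume.restrict Ω) (f := fun x => ka (1/2) ρ (z - x)) (g := q)
      ((measurable_ka _ ρ).comp (by fun_prop)).aemeasurable hq.aemeasurable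
    have h2 : ∫⁻ x in Ω, ka (1/2) ρ (z - x) ^ 2 ≤ ∫⁻ w, ka 1 ρ w := by
      calc ∫⁻ x in Ω, ka (1/2) ρ (z - x) ^ 2 ≤ ∫⁻ x, ka (1/2) ρ (z - x) ^ 2 := setLIntegral_le_lintegral _ _
        _ = ∫⁻ x, ka 1 ρ (x - z) := by
            congr 1; ext x; rw [ka_sq, ← ka_neg, neg_sub]; norm_num
        _ = _ := lint_shift _ (ka_neg _ _) z
    calc ∫⁻ x in Ω, ka (1/2) ρ (z - x) * q x = ((∫⁻ x in Ω, ka (1/2) ρ (z - x) * q x) ^ 2) ^ (1/2:ℝ) := by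
          rw [← ENNReal.rpow_natCast, ← ENNReal.rpow_mul]; norm_num
      _ ≤ ((∫⁻ w, ka 1 ρ w) * (∫⁻ x in Ω, q x ^ 2)) ^ (1/2:ℝ) := by
          gcongr; exact h1.trans (by gcongr)
      _ = _ := ENNReal.mul_rpow_of_nonneg _ _ (by norm_num)
  have hv := vb_nonneg
  calc ∫⁻ x in Ω, (∫⁻ z in Ω, g z * ka 1 ρ (z - x)) ^ 2 * q x
      ≤ ∫⁻ x in Ω, ((∫⁻ w, ka (3/2) ρ w) * ∫⁻ z in Ω, g z ^ 2 * ka (1/2) ρ (z - x)) * q x := by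
        gcongr with x; exact step1 x
    _ = (∫⁻ w, ka (3/2) ρ w) * ∫⁻ x in Ω, ∫⁻ z in Ω, g z ^ 2 * ka (1/2) ρ (z - x) * q x := by
        rw [← lintegral_const_mul]
        · congr 1; ext x; rw [mul_assoc, lintegral_mul_const]
          exact (hg.pow_const 2).mul (mka _ _)
        · apply Measurable.lintegral_prod_right'
            (f := fun p : V2 × V2 => g p.2 ^ 2 * ka (1/2) ρ (p.2 - p.1) * q p.1)
          exact (((hg.comp measurable_snd).pow_const 2).mul (mka2 _)).mul (hq.comp measurable_fst)
    _ = (∫⁻ w, ka (3/2) ρ w) * ∫⁻ z in Ω, ∫⁻ x in Ω, g z ^ 2 * ka (1/2) ρ (z - x) * q x := by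
        rw [lintegral_lintegral_swap]
        exact ((((hg.comp measurable_snd).pow_const 2).mul (mka2 _)).mul (hq.comp measurable_fst)).aemeasurable
    _ ≤ (∫⁻ w, ka (3/2) ρ w) * ∫⁻ z in Ω, g z ^ 2 * ((∫⁻ w, ka 1 ρ w) ^ (1/2:ℝ) * (∫⁻ x in Ω, q x ^ 2) ^ (1/2:ℝ)) := by
        gcongr with z
        simp only [mul_assoc]
        have m : Measurable (fun x => ka (1/2) ρ (z - x) * q x) :=
          ((measurable_ka _ ρ).comp (by fun_prop)).mul hq
        rw [lintegral_const_mul _ m]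
        exact mul_le_mul' le_rfl (step2 z)
    _ = (∫⁻ w, ka (3/2) ρ w) * (∫⁻ w, ka 1 ρ w) ^ (1/2:ℝ) * (∫⁻ z in Ω, g z ^ 2) * (∫⁻ x in Ω, q x ^ 2) ^ (1/2:ℝ) := by
        rw [lintegral_mul_const _ (hg.pow_const 2)]; ring
    _ ≤ _ := by
        gcongr
        rw [lint_ka (by norm_num) hρ, lint_ka (by norm_num) hρ, ENNReal.ofReal_rpow_of_nonneg (by positivity) (by norm_num),
          ← ENNReal.ofReal_mul (by positivity)]
        apply ENNReal.ofReal_le_ofReal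
        norm_num
        have e1 : (2 * vb * ρ) ^ (1/2:ℝ) = (2 * vb) ^ (1/2:ℝ) * ρ ^ (1/2:ℝ) :=
          Real.mul_rpow (by positivity) (by positivity)
        have e2 : (2 * vb) ^ (1/2:ℝ) ≤ 2 * (vb + 1) := by
          rw [← Real.sqrt_eq_rpow]
          rw [Real.sqrt_le_left (by positivity)]
          nlinarith
        have e3 : ρ ^ (1/2:ℝ) * ρ ^ (1/2:ℝ) = ρ := by
          rw [← Real.sqrt_eq_rpow]; exact Real.mul_self_sqrt hρ.le
        rw [e1]
        calc 2 * vb * (ρ ^ (1/2:ℝ) / (1/2)) * ((2 * vb) ^ (1/2:ℝ) * ρ ^ (1/2:ℝ)) = 4 * vb * (2 * vb) ^ (1/2:ℝ) * (ρ ^ (1/2:ℝ) * ρ ^ (1/2:ℝ)) := by ring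
          _ ≤ 4 * vb * (2 * (vb + 1)) * ρ := by rw [e3]; gcongr
          _ ≤ 4 * (vb + 1) ^ 2 * 2 * ρ := by
            have : 4 * vb * (2 * (vb + 1)) ≤ 4 * (vb + 1) ^ 2 * 2 := by nlinarith
            gcongr
end

section
open scoped ENNReal

/-- l1 size of the gradient -/
def gl (f : V2 → ℝ) (x : V2) : ℝ := |pd 0 f x| + |pd 1 f x|

lemma gl_nonneg (f : V2 → ℝ) (x : V2) : 0 ≤ gl f x := by unfold gl; positivity
lemma C1.cgl {f : V2 → ℝ} (hf : C1 f) : Continuous (gl f) := by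
  unfold gl; exact (hf.cpd 0).abs.add (hf.cpd 1).abs

lemma lint_affine (H : V2 → ℝ≥0∞) (hH : Measurable H) (x : V2) {t : ℝ} (ht : 0 < t) :
    ∫⁻ y, H (x + t • (y - x)) = ENNReal.ofReal (t ^ (-2:ℝ)) * ∫⁻ z, H z := by
  have h1 : ∫⁻ y, H (x + t • (y - x)) = ∫⁻ w, H (x + t • w) :=
    lintegral_sub_right_eq_self (fun w => H (x + t • w)) x
  have h2 : ∫⁻ w, H (x + t • w) = ∫⁻ z, H (x + z) ∂(Measure.map (t • ·) (volume : Measure V2)) := by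
    have m1 : Measurable (fun z => H (x + z)) := hH.comp (by fun_prop)
    have m2 : Measurable (fun z : V2 => t • z) := by fun_prop
    rw [lintegral_map m1 m2]
  have h3 : ∫⁻ z, H (x + z) = ∫⁻ z, H z := lintegral_add_left_eq_self H x
  rw [h1, h2, Measure.map_addHaar_smul _ ht.ne', lintegral_smul_measure, h3]
  simp only [smul_eq_mul]
  congr 2
  simp only [Module.finrank_fintype_fun_eq_card, Fintype.card_fin]
  rw [abs_of_pos (by positivity), Real.rpow_neg ht.le]; norm_cast

lemma lint_tail {m d : ℝ} (hm : 0 < m) (hd : 0 < d) :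
    ∫⁻ t in Ici (m / d), ENNReal.ofReal (t ^ (-3:ℝ)) = ENNReal.ofReal (d ^ 2 / (2 * m ^ 2)) := by
  have hmd : 0 < m / d := by positivity
  rw [← restrict_Ioi_eq_restrict_Ici, ← ofReal_integral_eq_lintegral_ofReal (integrableOn_Ioi_rpow_of_lt (by norm_num) hmd)
    ((ae_restrict_mem measurableSet_Ioi).mono fun t ht => by
      have : 0 < t := hmd.trans ht
      positivity), integral_Ioi_rpow_of_lt (by norm_num) hmd]
  congr 1
  norm_num
  field_simp

lemma Dom.core {Ω : Set V2} {φ : V2 → ℝ} (h : Dom Ω φ) {d : ℝ} (hd : 0 < d)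
    (hdd : ∀ y ∈ Ω, ∀ z ∈ Ω, ‖y - z‖ ≤ d) {f : V2 → ℝ} (hf : C1 f) {x : V2} (hx : x ∈ Ω)
    {r : ℝ} (hr : 0 < r) (hr1 : r ≤ 1) :
    ∫⁻ y in Ω, ENNReal.ofReal |f x - f (x + r • (y - x))| ≤
      ENNReal.ofReal (d ^ 2 / 2) * ∫⁻ z in Ω, ENNReal.ofReal (gl f z) * ka 1 (r * d) (z - x) := by
  have hgc := hf.cgl
  -- step a
  have sa : ∀ y ∈ Ω, ENNReal.ofReal |f x - f (x + r • (y - x))| ≤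
      ∫⁻ t in Ioc 0 r, ENNReal.ofReal (gl f (x + t • (y - x)) * ‖y - x‖) := by
    intro y hy
    have hder : ∀ t ∈ uIcc 0 r, HasDerivAt (fun t : ℝ => f (x + t • (y - x))) (fderiv ℝ f (x + t • (y - x)) (y - x)) t :=
      fun t _ => fderiv_along hf x (y - x) t
    have hcont : Continuous (fun t : ℝ => fderiv ℝ f (x + t • (y - x)) (y - x)) :=
      ((hf.continuous_fderiv (by norm_num)).comp (by fun_prop)).clm_apply continuous_const
    have hI := intervalIntegral.integral_eq_sub_of_hasDerivAt hder (hcont.intervalIntegrable _ _)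
    simp only [zero_smul, add_zero] at hI
    rw [intervalIntegral.integral_of_le hr.le] at hI
    have e1 : ENNReal.ofReal |f x - f (x + r • (y - x))| = ‖∫ t in Ioc 0 r, fderiv ℝ f (x + t • (y - x)) (y - x)‖ₑ := by
      rw [hI, abs_sub_comm, ← ofReal_norm, Real.norm_eq_abs]
    rw [e1]
    refine (enorm_integral_le_lintegral_enorm _).trans (lintegral_mono fun t => ?_)
    rw [← ofReal_norm]
    apply ENNReal.ofReal_le_ofReal
    rw [fderiv_eq_pd, Real.norm_eq_abs]
    have n0 : |(y - x) 0| ≤ ‖y - x‖ := norm_le_pi_norm (y - x) 0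
    have n1 : |(y - x) 1| ≤ ‖y - x‖ := norm_le_pi_norm (y - x) 1
    calc _ ≤ |(y - x) 0 * pd 0 f (x + t • (y - x))| + |(y - x) 1 * pd 1 f (x + t • (y - x))| := abs_add_le _ _
      _ ≤ ‖y - x‖ * |pd 0 f (x + t • (y - x))| + ‖y - x‖ * |pd 1 f (x + t • (y - x))| := by
        rw [abs_mul, abs_mul]; gcongr
      _ = _ := by unfold gl; ring
  -- step c
  have sc : ∀ t ∈ Ioc 0 r, ∫⁻ y in Ω, ENNReal.ofReal (gl f (x + t • (y - x)) * ‖y - x‖) ≤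
      ∫⁻ z in Ω, (if ‖z - x‖ ≤ t * d then ENNReal.ofReal (gl f z * ‖z - x‖) * ENNReal.ofReal (t ^ (-3:ℝ)) else 0) := by
    intro t ht
    have ht0 : 0 < t := ht.1
    set H : V2 → ℝ≥0∞ := Ω.indicator (fun z => if ‖z - x‖ ≤ t * d then ENNReal.ofReal (gl f z * ‖z - x‖ * t⁻¹) else 0) with hHdef
    have hHm : Measurable H := by
      apply Measurable.indicator _ h.meas
      refine Measurable.ite (measurableSet_le (by fun_prop) (by fun_prop)) ?_ measurable_const
      exact (ENNReal.continuous_ofReal.comp (by fun_prop)).measurable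
    calc ∫⁻ y in Ω, ENNReal.ofReal (gl f (x + t • (y - x)) * ‖y - x‖) ≤ ∫⁻ y in Ω, H (x + t • (y - x)) := by
          apply setLIntegral_mono' h.meas
          intro y hy
          have hz : x + t • (y - x) ∈ Ω := h.cv.add_smul_sub_mem hx hy ⟨ht0.le, ht.2.trans hr1⟩
          have hn : ‖x + t • (y - x) - x‖ = t * ‖y - x‖ := by
            rw [add_sub_cancel_left, norm_smul, Real.norm_eq_abs, abs_of_pos ht0]
          rw [hHdef, indicator_of_mem hz, hn, if_pos (by gcongr; exact hdd y hy x hx)]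
          apply ENNReal.ofReal_le_ofReal
          apply le_of_eq; field_simp
      _ ≤ ∫⁻ y, H (x + t • (y - x)) := setLIntegral_le_lintegral _ _
      _ = ENNReal.ofReal (t ^ (-2:ℝ)) * ∫⁻ z, H z := lint_affine H hHm x ht0
      _ = ENNReal.ofReal (t ^ (-2:ℝ)) * ∫⁻ z in Ω, (if ‖z - x‖ ≤ t * d then ENNReal.ofReal (gl f z * ‖z - x‖ * t⁻¹) else 0) := by
          rw [hHdef, lintegral_indicator h.meas]
      _ = _ := by
          rw [← lintegral_const_mul']
          · congr 1; ext z
            split_ifs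
            · have := gl_nonneg f z
              rw [← ENNReal.ofReal_mul (by positivity), ← ENNReal.ofReal_mul (by positivity)]
              congr 1
              have : t ^ (-3:ℝ) = t ^ (-2:ℝ) * t⁻¹ := by
                rw [← Real.rpow_neg_one, ← Real.rpow_add ht0]; norm_num
              rw [this]; ring
            · simp
          · exact ENNReal.ofReal_ne_top
  have m1 : Measurable (fun p : V2 × ℝ => ENNReal.ofReal (gl f (x + p.2 • (p.1 - x)) * ‖p.1 - x‖)) := by
    exact (ENNReal.continuous_ofReal.comp (by fun_prop)).measurable
  have m2 : Measurable (fun p : ℝ × V2 => (if ‖p.2 - x‖ ≤ p.1 * d then ENNReal.ofReal (gl f p.2 * ‖p.2 - x‖) * ENNReal.ofReal (p.1 ^ (-3:ℝ)) else 0)) := by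
    refine Measurable.ite (measurableSet_le (by fun_prop) (by fun_prop)) ?_ measurable_const
    refine Measurable.mul (ENNReal.continuous_ofReal.comp (by fun_prop)).measurable (by fun_prop)
  calc ∫⁻ y in Ω, ENNReal.ofReal |f x - f (x + r • (y - x))|
      ≤ ∫⁻ y in Ω, ∫⁻ t in Ioc 0 r, ENNReal.ofReal (gl f (x + t • (y - x)) * ‖y - x‖) :=
        setLIntegral_mono' h.meas sa
    _ = ∫⁻ t in Ioc 0 r, ∫⁻ y in Ω, ENNReal.ofReal (gl f (x + t • (y - x)) * ‖y - x‖) :=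
        lintegral_lintegral_swap m1.aemeasurable
    _ ≤ ∫⁻ t in Ioc 0 r, ∫⁻ z in Ω, (if ‖z - x‖ ≤ t * d then ENNReal.ofReal (gl f z * ‖z - x‖) * ENNReal.ofReal (t ^ (-3:ℝ)) else 0) :=
        setLIntegral_mono' measurableSet_Ioc sc
    _ = ∫⁻ z in Ω, ∫⁻ t in Ioc 0 r, (if ‖z - x‖ ≤ t * d then ENNReal.ofReal (gl f z * ‖z - x‖) * ENNReal.ofReal (t ^ (-3:ℝ)) else 0) :=
        lintegral_lintegral_swap m2.aemeasurable
    _ ≤ ∫⁻ z in Ω, ENNReal.ofReal (d ^ 2 / 2) * (ENNReal.ofReal (gl f z) * ka 1 (r * d) (z - x)) := by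
        refine lintegral_mono fun z => ?_
        dsimp only
        have hg0 := gl_nonneg f z
        set m := ‖z - x‖ with hm
        have hm0 : 0 ≤ m := norm_nonneg _
        rcases hm0.eq_or_lt with h0 | h0
        · rw [← h0]; simp
        by_cases hmr : m ≤ r * d
        · calc ∫⁻ t in Ioc 0 r, (if m ≤ t * d then ENNReal.ofReal (gl f z * m) * ENNReal.ofReal (t ^ (-3:ℝ)) else 0)
              ≤ ∫⁻ t, (Ici (m / d)).indicator (fun t => ENNReal.ofReal (gl f z * m) * ENNReal.ofReal (t ^ (-3:ℝ))) t := by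
                refine (setLIntegral_le_lintegral _ _).trans (lintegral_mono fun t => ?_)
                dsimp only
                split_ifs with hc
                · rw [indicator_of_mem (show t ∈ Ici (m/d) from (div_le_iff₀ hd).mpr hc)]
                · exact bot_le
            _ = ENNReal.ofReal (gl f z * m) * ENNReal.ofReal (d ^ 2 / (2 * m ^ 2)) := by
                rw [lintegral_indicator measurableSet_Ici, lintegral_const_mul' _ _ ENNReal.ofReal_ne_top, lint_tail h0 hd]
            _ = _ := by
                unfold ka
                rw [if_pos hmr, ← ENNReal.ofReal_mul (by positivity), ← ENNReal.ofReal_mul (by positivity), ← ENNReal.ofReal_mul (by positivity), ← hm, Real.rpow_neg_one]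
                congr 1; field_simp
        · have : ∀ t ∈ Ioc 0 r, (if m ≤ t * d then ENNReal.ofReal (gl f z * m) * ENNReal.ofReal (t ^ (-3:ℝ)) else 0) = 0 := by
            intro t ht
            rw [if_neg]
            intro hc; apply hmr; exact hc.trans (by gcongr; exact ht.2)
          rw [setLIntegral_congr_fun measurableSet_Ioc this]; simp
    _ = _ := by rw [lintegral_const_mul' _ _ ENNReal.ofReal_ne_top]
end

section
open scoped ENNReal
variable {Ω : Set V2} {φ : V2 → ℝ}

lemma Dom.lint (h : Dom Ω φ) {g : V2 → ℝ} (hg : Continuous g) (h0 : ∀ x, 0 ≤ g x) :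
    ∫⁻ x in Ω, ENNReal.ofReal (g x) = ENNReal.ofReal (II Ω g) :=
  (ofReal_integral_eq_lintegral_ofReal (h.int hg) (Eventually.of_forall h0)).symm

/-- volume of the domain -/
def vol (Ω : Set V2) : ℝ := II Ω fun _ => 1

lemma Dom.vol_pos (h : Dom Ω φ) : 0 < vol Ω := by
  have h1 : vol Ω = (volume Ω).toReal := by
    unfold vol II; simp [Measure.real]
  rw [h1]
  exact ENNReal.toReal_pos (h.isOpen.measure_pos volume h.ne).ne' h.bd.measure_lt_top.ne

lemma Dom.volE (h : Dom Ω φ) : volume Ω = ENNReal.ofReal (vol Ω) := by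
  have h1 : vol Ω = (volume Ω).toReal := by
    unfold vol II; simp [Measure.real]
  rw [h1, ENNReal.ofReal_toReal h.bd.measure_lt_top.ne]

lemma Dom.exists_diam (h : Dom Ω φ) : ∃ d > 0, ∀ y ∈ Ω, ∀ z ∈ Ω, ‖y - z‖ ≤ d := by
  refine ⟨Metric.diam Ω + 1, by have := Metric.diam_nonneg (s := Ω); linarith, fun y hy z hz => ?_⟩
  rw [← dist_eq_norm]
  have := Metric.dist_le_diam_of_mem h.bd hy hz
  linarith

/-- the Riesz potential of the gradient -/
def nr (Ω : Set V2) (f : V2 → ℝ) (ρ : ℝ) (x : V2) : ℝ≥0∞ :=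
  ∫⁻ z in Ω, ENNReal.ofReal (gl f z) * ka 1 ρ (z - x)

lemma Dom.gl2 (h : Dom Ω φ) {f : V2 → ℝ} (hf : C1 f) :
    ∫⁻ z in Ω, ENNReal.ofReal (gl f z) ^ 2 ≤ ENNReal.ofReal (2 * II Ω (gs f)) := by
  have : ∀ z, ENNReal.ofReal (gl f z) ^ 2 = ENNReal.ofReal (gl f z ^ 2) := fun z =>
    (ENNReal.ofReal_pow (gl_nonneg f z) 2).symm
  simp only [this]
  rw [h.lint (g := fun z => gl f z ^ 2) (hf.cgl.pow 2) (fun x => sq_nonneg _)]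
  apply ENNReal.ofReal_le_ofReal
  apply h.le1 (hf.cgl.pow 2) hf.cgs
  intro x _
  show gl f x ^ 2 ≤ _
  unfold gl gs
  nlinarith [sq_nonneg (|pd 0 f x| - |pd 1 f x|), sq_abs (pd 0 f x), sq_abs (pd 1 f x)]

lemma Dom.dblR (h : Dom Ω φ) {f : V2 → ℝ} (hf : C1 f) {q : V2 → ℝ} (hq : Continuous q)
    (hq0 : ∀ x, 0 ≤ q x) {ρ : ℝ} (hρ : 0 < ρ) :
    ∫⁻ x in Ω, nr Ω f ρ x ^ 2 * ENNReal.ofReal (q x) ≤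
      ENNReal.ofReal (16 * (vb + 1) ^ 2 * ρ * II Ω (gs f) * √(II Ω fun x => q x ^ 2)) := by
  have h1 := dbl (Ω := Ω) (g := fun z => ENNReal.ofReal (gl f z)) (q := fun x => ENNReal.ofReal (q x))
    (ENNReal.continuous_ofReal.comp hf.cgl).measurable (ENNReal.continuous_ofReal.comp hq).measurable hρ
  refine h1.trans ?_
  have hv := vb_nonneg
  have hg : 0 ≤ II Ω (gs f) := h.nn fun x _ => gs_nonneg _ _
  have e : ∫⁻ x in Ω, ENNReal.ofReal (q x) ^ 2 = ENNReal.ofReal (II Ω fun x => q x ^ 2) := by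
    rw [← h.lint (g := fun z => q z ^ 2) (hq.pow 2) (fun x => sq_nonneg _)]
    congr 1; ext x; rw [ENNReal.ofReal_pow (hq0 x)]
  rw [e, ENNReal.ofReal_rpow_of_nonneg (h.nn fun x _ => sq_nonneg _) (by norm_num), ← Real.sqrt_eq_rpow]
  calc _ ≤ ENNReal.ofReal (4 * (vb + 1) ^ 2 * (1 + 1) * ρ) * ENNReal.ofReal (2 * II Ω (gs f)) * ENNReal.ofReal √(II Ω fun x => q x ^ 2) := by
        gcongr; exact h.gl2 hf
    _ = _ := by
        rw [← ENNReal.ofReal_mul (by positivity), ← ENNReal.ofReal_mul (by positivity)]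
        congr 1; ring

lemma Dom.rep (h : Dom Ω φ) {d : ℝ} (hd : 0 < d) (hdd : ∀ y ∈ Ω, ∀ z ∈ Ω, ‖y - z‖ ≤ d) :
    ∃ k > 0, ∀ f, C1 f → ∀ r, 0 < r → r ≤ 1 → ∀ x ∈ Ω,
      ENNReal.ofReal (f x ^ 2) ≤ ENNReal.ofReal k *
        (nr Ω f (r * d) x ^ 2 + ENNReal.ofReal (r ^ (-2:ℝ) * II Ω fun x => f x ^ 2)) := by
  have hv := h.vol_pos
  set v := vol Ω with hvd
  refine ⟨4 * ((d ^ 2 / 2) ^ 2 + v) / v ^ 2, by positivity, fun f hf r hr hr1 x hx => ?_⟩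
  have hS0 : 0 ≤ II Ω fun x => f x ^ 2 := h.nn fun x _ => sq_nonneg _
  set S := II Ω fun x => f x ^ 2 with hS
  set n := nr Ω f (r * d) x with hn
  have hfm : Measurable f := hf.cont.measurable
  have c1 := h.core hd hdd hf hx hr hr1
  set s : ℝ≥0∞ := ∫⁻ y in Ω, ENNReal.ofReal |f (x + r • (y - x))| with hs
  have hmm : Measurable (fun y => ENNReal.ofReal |f (x + r • (y - x))|) :=
    (ENNReal.continuous_ofReal.comp (by have := hf.cont; fun_prop)).measurable
  have c2 : ENNReal.ofReal v * ENNReal.ofReal |f x| ≤ ENNReal.ofReal (d ^ 2 / 2) * n + s := by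
    calc ENNReal.ofReal v * ENNReal.ofReal |f x| = ∫⁻ y in Ω, ENNReal.ofReal |f x| := by
          rw [setLIntegral_const, h.volE, mul_comm]
      _ ≤ ∫⁻ y in Ω, (ENNReal.ofReal |f x - f (x + r • (y - x))| + ENNReal.ofReal |f (x + r • (y - x))|) := by
          refine lintegral_mono fun y => ?_
          rw [← ENNReal.ofReal_add (abs_nonneg _) (abs_nonneg _)]
          apply ENNReal.ofReal_le_ofReal
          have := abs_add_le (f x - f (x + r • (y - x))) (f (x + r • (y - x)))
          simpa using this
      _ = (∫⁻ y in Ω, ENNReal.ofReal |f x - f (x + r • (y - x))|) + s := lintegral_add_right _ hmm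
      _ ≤ _ := by gcongr; exact c1
  have c3 : s ^ 2 ≤ ENNReal.ofReal v * ENNReal.ofReal (r ^ (-2:ℝ) * S) := by
    have l := lcs (volume.restrict Ω) (f := fun _ => 1) (g := fun y => ENNReal.ofReal |f (x + r • (y - x))|)
      aemeasurable_const hmm.aemeasurable
    simp only [one_mul, one_pow] at l
    refine l.trans ?_
    rw [setLIntegral_one, h.volE]
    gcongr
    have hHm : Measurable (Ω.indicator (fun z => ENNReal.ofReal (f z ^ 2))) :=
      ((ENNReal.continuous_ofReal.comp (hf.cont.pow 2)).measurable).indicator h.meas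
    calc ∫⁻ y in Ω, ENNReal.ofReal |f (x + r • (y - x))| ^ 2
        ≤ ∫⁻ y in Ω, Ω.indicator (fun z => ENNReal.ofReal (f z ^ 2)) (x + r • (y - x)) := by
          apply setLIntegral_mono' h.meas
          intro y hy
          have hz : x + r • (y - x) ∈ Ω := h.cv.add_smul_sub_mem hx hy ⟨hr.le, hr1⟩
          rw [indicator_of_mem hz, ← ENNReal.ofReal_pow (abs_nonneg _), sq_abs]
      _ ≤ ∫⁻ y, Ω.indicator (fun z => ENNReal.ofReal (f z ^ 2)) (x + r • (y - x)) := setLIntegral_le_lintegral _ _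
      _ = ENNReal.ofReal (r ^ (-2:ℝ)) * ∫⁻ z, Ω.indicator (fun z => ENNReal.ofReal (f z ^ 2)) z :=
          lint_affine _ hHm x hr
      _ = _ := by
          rw [lintegral_indicator h.meas, h.lint (g := fun z => f z ^ 2) (hf.cont.pow 2) (fun x => sq_nonneg _), ENNReal.ofReal_mul (by positivity)]
  calc ENNReal.ofReal (f x ^ 2) = ENNReal.ofReal ((v ^ 2)⁻¹) * (ENNReal.ofReal v * ENNReal.ofReal |f x|) ^ 2 := by
        rw [← ENNReal.ofReal_mul hv.le, ← ENNReal.ofReal_pow (by positivity), ← ENNReal.ofReal_mul (by positivity)]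
        congr 1; rw [mul_pow, sq_abs]; field_simp
    _ ≤ ENNReal.ofReal ((v ^ 2)⁻¹) * (4 * ((ENNReal.ofReal (d ^ 2 / 2) * n) ^ 2 + ENNReal.ofReal v * ENNReal.ofReal (r ^ (-2:ℝ) * S))) := by
        gcongr
        exact (pow_le_pow_left' c2 2).trans ((add_sq4 _ _).trans (by gcongr))
    _ ≤ ENNReal.ofReal ((v ^ 2)⁻¹) * (4 * (ENNReal.ofReal ((d ^ 2 / 2) ^ 2 + v) * n ^ 2 + ENNReal.ofReal ((d ^ 2 / 2) ^ 2 + v) * ENNReal.ofReal (r ^ (-2:ℝ) * S))) := by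
        rw [mul_pow, ← ENNReal.ofReal_pow (by positivity)]
        gcongr
        · linarith
        · nlinarith [sq_nonneg (d ^ 2 / 2)]
    _ = _ := by
        rw [← mul_add, ← mul_assoc, ← mul_assoc, show (4:ℝ≥0∞) = ENNReal.ofReal 4 by simp, ← ENNReal.ofReal_mul (by positivity), ← ENNReal.ofReal_mul (by positivity)]
        congr 2; field_simp

/-- squared `H¹` norm -/
def N1 (Ω : Set V2) (f : V2 → ℝ) : ℝ := (II Ω fun x => f x ^ 2) + II Ω (gs f)

lemma Dom.N1_nonneg (h : Dom Ω φ) (f : V2 → ℝ) : 0 ≤ N1 Ω f :=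
  add_nonneg (h.nn fun _ _ => sq_nonneg _) (h.nn fun _ _ => gs_nonneg _ _)

lemma Dom.gs_le_N1 (h : Dom Ω φ) (f : V2 → ℝ) : II Ω (gs f) ≤ N1 Ω f :=
  le_add_of_nonneg_left (h.nn fun _ _ => sq_nonneg _)

lemma Dom.sq_le_N1 (h : Dom Ω φ) (f : V2 → ℝ) : (II Ω fun x => f x ^ 2) ≤ N1 Ω f :=
  le_add_of_nonneg_right (h.nn fun _ _ => gs_nonneg _ _)

lemma Dom.rep_int (h : Dom Ω φ) {d : ℝ} (hd : 0 < d) (hdd : ∀ y ∈ Ω, ∀ z ∈ Ω, ‖y - z‖ ≤ d) :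
    ∃ k > 0, ∀ f, C1 f → ∀ r, 0 < r → r ≤ 1 → ∀ q : V2 → ℝ, Continuous q → (∀ x, 0 ≤ q x) →
      ENNReal.ofReal (II Ω fun x => f x ^ 2 * q x) ≤ ENNReal.ofReal k *
        ((∫⁻ x in Ω, nr Ω f (r * d) x ^ 2 * ENNReal.ofReal (q x)) + ENNReal.ofReal (r ^ (-2:ℝ) * (II Ω fun x => f x ^ 2) * II Ω q)) := by
  obtain ⟨k, hk, H⟩ := h.rep hd hdd
  refine ⟨k, hk, fun f hf r hr hr1 q hq hq0 => ?_⟩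
  have hS0 : 0 ≤ II Ω fun x => f x ^ 2 := h.nn fun x _ => sq_nonneg _
  rw [← h.lint (g := fun x => f x ^ 2 * q x) ((hf.cont.pow 2).mul hq) (fun x => mul_nonneg (sq_nonneg _) (hq0 x))]
  have hqm : Measurable (fun x => ENNReal.ofReal (q x)) := (ENNReal.continuous_ofReal.comp hq).measurable
  calc ∫⁻ x in Ω, ENNReal.ofReal (f x ^ 2 * q x)
      ≤ ∫⁻ x in Ω, ENNReal.ofReal k * (nr Ω f (r * d) x ^ 2 * ENNReal.ofReal (q x) + ENNReal.ofReal (r ^ (-2:ℝ) * II Ω fun x => f x ^ 2) * ENNReal.ofReal (q x)) := by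
        apply setLIntegral_mono' h.meas
        intro x hx
        rw [ENNReal.ofReal_mul (sq_nonneg _), ← add_mul, ← mul_assoc]
        gcongr
        exact H f hf r hr hr1 x hx
    _ = _ := by
        rw [lintegral_const_mul' _ _ ENNReal.ofReal_ne_top, lintegral_add_right _ (hqm.const_mul _),
          lintegral_const_mul' _ _ ENNReal.ofReal_ne_top, h.lint hq hq0, ← ENNReal.ofReal_mul (by positivity)]

lemma Dom.bdd (h : Dom Ω φ) {f : V2 → ℝ} (hf : Continuous f) : ∃ m, 0 ≤ m ∧ ∀ x ∈ closure Ω, |f x| ≤ m := by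
  obtain ⟨m, hm⟩ := h.compact.exists_bound_of_continuousOn hf.continuousOn
  exact ⟨max m 0, le_max_right _ _, fun x hx => (hm x hx).trans (le_max_left _ _)⟩

/-- Ladyzhenskaya inequality -/
lemma Dom.L4 (h : Dom Ω φ) : ∃ C > 0, ∀ f, C1 f →
    (II Ω fun x => f x ^ 4) ≤ C * (II Ω fun x => f x ^ 2) * N1 Ω f := by
  obtain ⟨d, hd, hdd⟩ := h.exists_diam
  obtain ⟨k, hk, H⟩ := h.rep_int hd hdd
  have hv := vb_nonneg
  set c := k * (16 * (vb + 1) ^ 2 * d) with hc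
  have hc0 : 0 < c := by positivity
  refine ⟨c ^ 2 + 2 * k, by positivity, fun f hf => ?_⟩
  set a := II Ω fun x => f x ^ 2 with ha
  set b := II Ω (gs f) with hb
  have ha0 : 0 ≤ a := h.nn fun x _ => sq_nonneg _
  have hb0 : 0 ≤ b := h.nn fun x _ => gs_nonneg _ _
  set X := II Ω fun x => f x ^ 4 with hX
  have hX0 : 0 ≤ X := h.nn fun x _ => by positivity
  have hN : N1 Ω f = a + b := rfl
  rw [hN]
  rcases ha0.eq_or_lt with h0 | h0
  · obtain ⟨m, hm0, hm⟩ := h.bdd hf.cont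
    have : X ≤ m ^ 2 * a := by
      apply h.le1 (hf.cont.pow 4) (hf.cont.pow 2)
      intro x hx
      have h1 := hm x (subset_closure hx)
      have h2 : f x ^ 2 ≤ m ^ 2 := sq_le_sq' (by linarith [neg_abs_le (f x)]) (by linarith [le_abs_self (f x)])
      show f x ^ 4 ≤ m ^ 2 * f x ^ 2
      nlinarith [sq_nonneg (f x)]
    rw [← h0] at this ⊢
    simpa using this
  · set r := √(a / (a + b)) with hr
    have hr0 : 0 < r := by positivity
    have hr1 : r ≤ 1 := by rw [hr, Real.sqrt_le_left zero_le_one, one_pow, div_le_one (by positivity)]; linarith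
    have hrs : r ^ 2 = a / (a + b) := Real.sq_sqrt (by positivity)
    have h1 := H f hf r hr0 hr1 (fun x => f x ^ 2) (hf.cont.pow 2) (fun x => sq_nonneg _)
    have h2 := h.dblR hf (q := fun x => f x ^ 2) (hf.cont.pow 2) (fun x => sq_nonneg _) (ρ := r * d) (by positivity)
    have e1 : (II Ω fun x => f x ^ 2 * f x ^ 2) = X := h.congr fun x _ => by ring
    have e2 : (II Ω fun x => (f x ^ 2) ^ 2) = X := h.congr fun x _ => by ring
    rw [e1] at h1
    simp only [e2] at h2
    have h3 : ENNReal.ofReal X ≤ ENNReal.ofReal (k * (16 * (vb + 1) ^ 2 * (r * d) * b * √X + r ^ (-2:ℝ) * a * a)) := by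
      rw [ENNReal.ofReal_mul hk.le, ENNReal.ofReal_add (by positivity) (by positivity)]
      exact h1.trans (by gcongr)
    rw [ENNReal.ofReal_le_ofReal_iff (by positivity)] at h3
    have e3 : r ^ (-2:ℝ) = (a + b) / a := by
      rw [Real.rpow_neg hr0.le]; norm_cast; rw [hrs, inv_div]
    rw [e3] at h3
    have h4 : X ≤ (c * r * b) * √X + k * (a * (a + b)) := by
      refine h3.trans (le_of_eq ?_)
      rw [hc]; field_simp
    have hs : √X ^ 2 = X := Real.sq_sqrt hX0
    have h5 : r ^ 2 * b ^ 2 ≤ a * (a + b) := by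
      rw [hrs, div_mul_eq_mul_div, div_le_iff₀ (by positivity)]
      have : b ^ 2 ≤ (a + b) ^ 2 := by nlinarith
      nlinarith
    nlinarith [sq_nonneg (c * r * b - √X), mul_le_mul_of_nonneg_left h5 (sq_nonneg c)]

lemma Dom.near_far (_h : Dom Ω φ) {f : V2 → ℝ} (hf : C1 f) {δ ρ : ℝ} (hδ : 0 < δ) (hρ : δ ≤ ρ) (x : V2) :
    nr Ω f ρ x ^ 2 ≤ 4 * (nr Ω f δ x ^ 2 + (∫⁻ z in Ω, ENNReal.ofReal (gl f z) ^ 2) * ENNReal.ofReal (2 * vb * Real.log (ρ / δ))) := by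
  have mg : Measurable (fun z => ENNReal.ofReal (gl f z)) := (ENNReal.continuous_ofReal.comp hf.cgl).measurable
  have mkb : Measurable (fun z => kb δ ρ (z - x)) := (measurable_kb _ _).comp (by fun_prop)
  have h1 : nr Ω f ρ x ≤ nr Ω f δ x + ∫⁻ z in Ω, ENNReal.ofReal (gl f z) * kb δ ρ (z - x) := by
    unfold nr
    have mm : Measurable (fun z => ENNReal.ofReal (gl f z) * kb δ ρ (z - x)) := mg.mul mkb
    rw [← lintegral_add_right _ mm]
    refine lintegral_mono fun z => ?_
    rw [← mul_add]; gcongr; exact ka_kb _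
  refine (pow_le_pow_left' h1 2).trans ((add_sq4 _ _).trans ?_)
  gcongr
  refine (lcs _ mg.aemeasurable mkb.aemeasurable).trans ?_
  gcongr
  refine (setLIntegral_le_lintegral _ _).trans ?_
  rw [← lint_kb hδ hρ]
  exact (lint_shift (fun w => kb δ ρ w ^ 2) (fun w => by rw [kb_neg]) x).le

/-- Logarithmic product estimate -/
lemma Dom.LOG (h : Dom Ω φ) : ∃ C > 0, ∀ f Q, C1 f → C1 Q → ∀ ε, 0 < ε → ε ≤ 1 →
    (II Ω fun x => f x ^ 2 * Q x ^ 2) ≤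
      C * N1 Ω f * ((1 + Real.log (1 / ε)) * (II Ω fun x => Q x ^ 2) + ε * N1 Ω Q) := by
  obtain ⟨d, hd, hdd⟩ := h.exists_diam
  obtain ⟨k, hk, H⟩ := h.rep_int hd hdd
  obtain ⟨C4, hC4, HL⟩ := h.L4
  have hv := vb_nonneg
  refine ⟨k * (64 * (vb + 1) ^ 2 * d * √C4 + 16 * vb + 1), by positivity, fun f Q hf hQ ε hε hε1 => ?_⟩
  set a := II Ω fun x => f x ^ 2 with ha
  set b := II Ω (gs f) with hb
  have ha0 : 0 ≤ a := h.nn fun x _ => sq_nonneg _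
  have hb0 : 0 ≤ b := h.nn fun x _ => gs_nonneg _ _
  have hN : N1 Ω f = a + b := rfl
  set q := II Ω fun x => Q x ^ 2 with hq
  have hq0 : 0 ≤ q := h.nn fun x _ => sq_nonneg _
  set n := N1 Ω Q with hn
  have hn0 : 0 ≤ n := h.N1_nonneg Q
  have hqn : q ≤ n := h.sq_le_N1 Q
  have hl : 0 ≤ Real.log (1 / ε) := Real.log_nonneg (by rw [le_div_iff₀ hε]; linarith)
  set l := Real.log (1 / ε) with hld
  have h1 := H f hf 1 one_pos le_rfl (fun x => Q x ^ 2) (hQ.cont.pow 2) (fun x => sq_nonneg _)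
  have h2 := h.dblR hf (q := fun x => Q x ^ 2) (hQ.cont.pow 2) (fun x => sq_nonneg _) (ρ := ε * d) (by positivity)
  have e2 : √(II Ω fun x => (Q x ^ 2) ^ 2) ≤ √C4 * n := by
    rw [show (II Ω fun x => (Q x ^ 2) ^ 2) = II Ω fun x => Q x ^ 4 from h.congr fun x _ => by ring]
    refine (Real.sqrt_le_sqrt (HL Q hQ)).trans ?_
    calc √(C4 * q * n) ≤ √(C4 * n ^ 2) := Real.sqrt_le_sqrt (by nlinarith [mul_nonneg hC4.le hn0])
      _ = √C4 * n := by rw [Real.sqrt_mul hC4.le, Real.sqrt_sq hn0]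
  have mQ : Measurable (fun x => ENNReal.ofReal (Q x ^ 2)) := (ENNReal.continuous_ofReal.comp (hQ.cont.pow 2)).measurable
  have h3 : ∫⁻ x in Ω, nr Ω f (1 * d) x ^ 2 * ENNReal.ofReal (Q x ^ 2) ≤
      ENNReal.ofReal (4 * (16 * (vb + 1) ^ 2 * (ε * d) * b * (√C4 * n) + 2 * b * (2 * vb * l) * q)) := by
    calc ∫⁻ x in Ω, nr Ω f (1 * d) x ^ 2 * ENNReal.ofReal (Q x ^ 2)
        ≤ ∫⁻ x in Ω, 4 * (nr Ω f (ε * d) x ^ 2 * ENNReal.ofReal (Q x ^ 2) + ENNReal.ofReal (2 * b * (2 * vb * l)) * ENNReal.ofReal (Q x ^ 2)) := by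
          refine lintegral_mono fun x => ?_
          rw [← add_mul, ← mul_assoc]
          gcongr
          refine (h.near_far hf (δ := ε * d) (ρ := 1 * d) (by positivity) (by gcongr) x).trans ?_
          rw [show 1 * d / (ε * d) = 1 / ε by field_simp, ENNReal.ofReal_mul (p := 2 * b) (by positivity)]
          gcongr
          exact h.gl2 hf
      _ = 4 * ((∫⁻ x in Ω, nr Ω f (ε * d) x ^ 2 * ENNReal.ofReal (Q x ^ 2)) + ENNReal.ofReal (2 * b * (2 * vb * l) * q)) := by
          rw [lintegral_const_mul' _ _ (by simp), lintegral_add_right _ (mQ.const_mul _),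
            lintegral_const_mul' _ _ ENNReal.ofReal_ne_top, h.lint (g := fun x => Q x ^ 2) (hQ.cont.pow 2) (fun x => sq_nonneg _), ← ENNReal.ofReal_mul (by positivity)]
      _ ≤ _ := by
          rw [ENNReal.ofReal_mul (p := 4) (by norm_num), ENNReal.ofReal_add (by positivity) (by positivity), show ENNReal.ofReal 4 = 4 by simp]
          gcongr
          refine h2.trans ?_
          gcongr
  have h4 : ENNReal.ofReal (II Ω fun x => f x ^ 2 * Q x ^ 2) ≤ ENNReal.ofReal (k * (4 * (16 * (vb + 1) ^ 2 * (ε * d) * b * (√C4 * n) + 2 * b * (2 * vb * l) * q) + a * q)) := by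
    rw [ENNReal.ofReal_mul hk.le, ENNReal.ofReal_add (by positivity) (by positivity)]
    refine h1.trans ?_
    simp only [Real.one_rpow, one_mul] at h3 ⊢
    gcongr
  rw [ENNReal.ofReal_le_ofReal_iff (by positivity)] at h4
  refine h4.trans ?_
  rw [hN, mul_assoc k, mul_assoc k]
  gcongr
  have p1 : 0 ≤ ε * n := by positivity
  have p2 : 0 ≤ l * q := by positivity
  set s := 64 * (vb + 1) ^ 2 * d * √C4 with hs
  have hs0 : 0 ≤ s := by positivity
  calc _ = s * b * (ε * n) + 16 * vb * b * (l * q) + a * q := by rw [hs]; ring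
    _ ≤ (s + 16 * vb + 1) * (a + b) * (ε * n) + (s + 16 * vb + 1) * (a + b) * (l * q) + (s + 16 * vb + 1) * (a + b) * q := by
      gcongr
      · linarith
      · linarith
      · linarith
      · linarith
      · have : 0 ≤ (s + 16 * vb) * (a + b) := by positivity
        nlinarith
    _ = _ := by ring

/-- Poincare -/
lemma Dom.poinc (h : Dom Ω φ) : ∃ C > 0, ∀ f, C1 f →
    (II Ω fun x => f x ^ 2) ≤ C * (II Ω (gs f) + (II Ω f) ^ 2) := by
  obtain ⟨d, hd, hdd⟩ := h.exists_diam
  have hv := h.vol_pos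
  have hvb := vb_nonneg
  set v := vol Ω with hvd
  set c := 16 * (vb + 1) ^ 2 * d * √v with hc
  refine ⟨4 * ((d ^ 2 / 2) ^ 2 * c + v) / v ^ 2, by positivity, fun f hf => ?_⟩
  set b := II Ω (gs f) with hb
  have hb0 : 0 ≤ b := h.nn fun x _ => gs_nonneg _ _
  set m := II Ω f with hm
  have pw : ∀ x ∈ Ω, ENNReal.ofReal (v ^ 2 * f x ^ 2) ≤ ENNReal.ofReal (4 * (d ^ 2 / 2) ^ 2) * nr Ω f (1 * d) x ^ 2 + ENNReal.ofReal (4 * m ^ 2) := by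
    intro x hx
    have c1 := h.core hd hdd hf hx one_pos le_rfl
    simp only [one_smul, add_sub_cancel] at c1
    have hcc : Continuous fun y => |f x - f y| := by have := hf.cont; fun_prop
    have c2 : ENNReal.ofReal |v * f x| ≤ (∫⁻ y in Ω, ENNReal.ofReal |f x - f y|) + ENNReal.ofReal |m| := by
      rw [h.lint hcc (fun y => abs_nonneg _), ← ENNReal.ofReal_add (h.nn fun y _ => abs_nonneg _) (abs_nonneg _)]
      apply ENNReal.ofReal_le_ofReal
      have e1 : (II Ω fun y => f x - f y) = v * f x - m := by
        rw [h.isub continuous_const hf.cont, hvd, vol]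
        have := h.lin1 (fun _ => 1) (f x)
        simp only [mul_one] at this
        rw [this, mul_comm]
      have e2 : |v * f x - m| ≤ II Ω fun y => |f x - f y| := by
        rw [← e1]; exact abs_integral_le_integral_abs
      have := abs_add_le (v * f x - m) m
      simp only [sub_add_cancel] at this
      linarith
    calc ENNReal.ofReal (v ^ 2 * f x ^ 2) = ENNReal.ofReal |v * f x| ^ 2 := by
          rw [← ENNReal.ofReal_pow (abs_nonneg _), sq_abs, mul_pow]
      _ ≤ 4 * ((ENNReal.ofReal (d ^ 2 / 2) * nr Ω f (1 * d) x) ^ 2 + ENNReal.ofReal |m| ^ 2) := by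
          refine (pow_le_pow_left' c2 2).trans ((add_sq4 _ _).trans ?_)
          gcongr
          exact c1
      _ = _ := by
          rw [mul_pow, mul_add, ← ENNReal.ofReal_pow (abs_nonneg _), sq_abs, ← ENNReal.ofReal_pow (by positivity),
            show (4:ℝ≥0∞) = ENNReal.ofReal 4 by simp, ← mul_assoc, ← ENNReal.ofReal_mul (by norm_num), ← ENNReal.ofReal_mul (by norm_num)]
  have h2 := h.dblR hf (q := fun _ => 1) continuous_const (fun _ => zero_le_one) (ρ := 1 * d) (by positivity)
  simp only [ENNReal.ofReal_one, mul_one, one_pow, one_mul] at h2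
  have h3 : ENNReal.ofReal (v ^ 2 * II Ω fun x => f x ^ 2) ≤ ENNReal.ofReal (4 * (d ^ 2 / 2) ^ 2 * (c * b) + 4 * m ^ 2 * v) := by
    rw [← h.lin1, ← h.lint (g := fun x => v ^ 2 * f x ^ 2) (by have := hf.cont; fun_prop) (fun x => by positivity)]
    refine (setLIntegral_mono' h.meas pw).trans ?_
    rw [lintegral_add_right _ measurable_const, lintegral_const_mul' _ _ ENNReal.ofReal_ne_top, setLIntegral_const, h.volE,
      ENNReal.ofReal_add (by positivity) (by positivity), ENNReal.ofReal_mul (by positivity) (p := 4 * (d ^ 2 / 2) ^ 2), ENNReal.ofReal_mul (by positivity) (p := 4 * m ^ 2)]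
    gcongr
    rw [one_mul]
    refine h2.trans (ENNReal.ofReal_le_ofReal (le_of_eq ?_))
    rw [hc, hvd, vol]; ring
  rw [ENNReal.ofReal_le_ofReal_iff (by positivity)] at h3
  rw [div_mul_eq_mul_div, le_div_iff₀ (by positivity)]
  have hc0 : 0 ≤ c := by positivity
  have : 0 ≤ (d ^ 2 / 2) ^ 2 * c * m ^ 2 + v * b := by positivity
  nlinarith
end

section
variable {Ω : Set V2} {φ : V2 → ℝ}

lemma sm_coord (i : Fin 2) : Sm (fun x : V2 => x i) := contDiff_apply ℝ ℝ i

lemma Dom.mean_tan (h : Dom Ω φ) : ∃ C > 0, ∀ u1 u2, Sm u1 → Sm u2 → Tan φ u1 u2 →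
    (II Ω u1) ^ 2 ≤ C * (II Ω fun x => dv u1 u2 x ^ 2) ∧ (II Ω u2) ^ 2 ≤ C * (II Ω fun x => dv u1 u2 x ^ 2) := by
  have key : ∀ i : Fin 2, ∀ u1 u2, Sm u1 → Sm u2 → Tan φ u1 u2 →
      (II Ω fun x => u1 x * (pd 0 (fun y : V2 => y i) x) + u2 x * pd 1 (fun y : V2 => y i) x) ^ 2 ≤
        (II Ω fun x => (x i) ^ 2) * (II Ω fun x => dv u1 u2 x ^ 2) := by
    intro i u1 u2 h1 h2 ht
    have e := h.ibp' (f := fun x => x i) (sm_coord i).c1 h1.c1 h2.c1 (fun x hx => by rw [ht x hx, mul_zero])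
    have e2 : (II Ω fun x => u1 x * (pd 0 (fun y : V2 => y i) x) + u2 x * pd 1 (fun y : V2 => y i) x) ^ 2 =
      (II Ω fun x => x i * dv u1 u2 x) ^ 2 := by
      unfold dv; rw [e, neg_sq]
    rw [e2]
    exact h.cs (sm_coord i).cont (h1.dv h2).cont
  have n0 : 0 ≤ II Ω fun x : V2 => (x 0) ^ 2 := h.nn fun _ _ => sq_nonneg _
  have n1 : 0 ≤ II Ω fun x : V2 => (x 1) ^ 2 := h.nn fun _ _ => sq_nonneg _
  refine ⟨(II Ω fun x => (x 0) ^ 2) + (II Ω fun x => (x 1) ^ 2) + 1, by positivity, fun u1 u2 h1 h2 ht => ?_⟩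
  have d0 : 0 ≤ II Ω fun x => dv u1 u2 x ^ 2 := h.nn fun _ _ => sq_nonneg _
  have k0 := key 0 u1 u2 h1 h2 ht
  have k1 := key 1 u1 u2 h1 h2 ht
  simp only [pd_coord] at k0 k1
  norm_num at k0 k1
  constructor
  · refine le_trans (by simpa using k0) ?_
    gcongr; linarith
  · refine le_trans (by simpa using k1) ?_
    gcongr; linarith

lemma Dom.N1_tan (h : Dom Ω φ) : ∃ C > 0, ∀ u1 u2, Sm u1 → Sm u2 → Tan φ u1 u2 →
    N1 Ω u1 + N1 Ω u2 ≤ C * ((II Ω fun x => dv u1 u2 x ^ 2) + II Ω fun x => cl u1 u2 x ^ 2) := by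
  obtain ⟨C1, hC1, H1⟩ := h.mean_tan
  obtain ⟨C2, hC2, H2⟩ := h.poinc
  refine ⟨C2 * (1 + 2 * C1) + 1, by positivity, fun u1 u2 h1 h2 ht => ?_⟩
  obtain ⟨m1, m2⟩ := H1 u1 u2 h1 h2 ht
  have p1 := H2 u1 h1.c1
  have p2 := H2 u2 h2.c1
  have g := h.grad_bound h1 h2 ht
  rw [h.iadd h1.c1.cgs h2.c1.cgs, h.iadd (f := fun x => dv u1 u2 x ^ 2) (g := fun x => cl u1 u2 x ^ 2) ((h1.dv h2).cont.pow 2) ((h1.cl h2).cont.pow 2)] at g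
  have d0 : 0 ≤ II Ω fun x => dv u1 u2 x ^ 2 := h.nn fun _ _ => sq_nonneg _
  have w0 : 0 ≤ II Ω fun x => cl u1 u2 x ^ 2 := h.nn fun _ _ => sq_nonneg _
  unfold N1
  set d := II Ω fun x => dv u1 u2 x ^ 2
  set w := II Ω fun x => cl u1 u2 x ^ 2
  set g1 := II Ω (gs u1)
  set g2 := II Ω (gs u2)
  have t1 := mul_le_mul_of_nonneg_left m1 hC2.le
  have t2 := mul_le_mul_of_nonneg_left m2 hC2.le
  have t3 := mul_le_mul_of_nonneg_left g hC2.le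
  have t4 : 0 ≤ C2 * C1 * w := by positivity
  nlinarith

lemma pd_mul_fun (i : Fin 2) {f g : V2 → ℝ} (hf : Sm f) (hg : Sm g) :
    pd i (fun y => f y * g y) = fun x => f x * pd i g x + pd i f x * g x :=
  funext fun x => pd_mul i (hf.d x) (hg.d x)

lemma lap_mul {f g : V2 → ℝ} (hf : Sm f) (hg : Sm g) (i : Fin 2) (x : V2) :
    pd i (pd i (fun y => f y * g y)) x = f x * pd i (pd i g) x + 2 * (pd i f x * pd i g x) + pd i (pd i f) x * g x := by
  rw [pd_mul_fun i hf hg, pd_add i ((hf.mul (hg.pd i)).d x) (((hf.pd i).mul hg).d x), pd_mul i (hf.d x) ((hg.pd i).d x),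
    pd_mul i ((hf.pd i).d x) (hg.d x)]
  ring

lemma Dom.lapprod (h : Dom Ω φ) {ψ : V2 → ℝ} (hψ : Sm ψ) : ∃ C > 0, ∀ b, Sm b → ∀ x ∈ Ω,
    (pd 0 (pd 0 (fun y => ψ y * b y)) x + pd 1 (pd 1 (fun y => ψ y * b y)) x) ^ 2 ≤
      C * ((pd 0 (pd 0 b) x + pd 1 (pd 1 b) x) ^ 2 + gs b x + b x ^ 2) ∧
    gs (fun y => ψ y * b y) x ≤ C * (gs b x + b x ^ 2) := by
  have hc : Continuous fun x => ψ x ^ 2 + 4 * gs ψ x + (pd 0 (pd 0 ψ) x + pd 1 (pd 1 ψ) x) ^ 2 := by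
    have := hψ.cont; have := hψ.c1.cgs; have := (hψ.pd 0).cpd 0; have := (hψ.pd 1).cpd 1
    fun_prop
  obtain ⟨m, hm0, hm⟩ := h.bdd hc
  refine ⟨4 * m + 1, by positivity, fun b hb x hx => ?_⟩
  have h1 := (le_abs_self _).trans (hm x (subset_closure hx))
  have g0 := gs_nonneg ψ x
  have gb0 := gs_nonneg b x
  have k1 : ψ x ^ 2 ≤ m := by nlinarith [sq_nonneg (pd 0 (pd 0 ψ) x + pd 1 (pd 1 ψ) x)]
  have k2 : 4 * gs ψ x ≤ m := by nlinarith [sq_nonneg (pd 0 (pd 0 ψ) x + pd 1 (pd 1 ψ) x), sq_nonneg (ψ x)]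
  have k3 : (pd 0 (pd 0 ψ) x + pd 1 (pd 1 ψ) x) ^ 2 ≤ m := by nlinarith [sq_nonneg (ψ x)]
  constructor
  · rw [lap_mul hψ hb, lap_mul hψ hb]
    set A := pd 0 (pd 0 b) x + pd 1 (pd 1 b) x with hA
    set A' := pd 0 (pd 0 ψ) x + pd 1 (pd 1 ψ) x with hA'
    have e : (ψ x * pd 0 (pd 0 b) x + 2 * (pd 0 ψ x * pd 0 b x) + pd 0 (pd 0 ψ) x * b x +
      (ψ x * pd 1 (pd 1 b) x + 2 * (pd 1 ψ x * pd 1 b x) + pd 1 (pd 1 ψ) x * b x)) =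
      ψ x * A + 2 * (pd 0 ψ x * pd 0 b x + pd 1 ψ x * pd 1 b x) + A' * b x := by rw [hA, hA']; ring
    rw [e]
    set s := pd 0 ψ x * pd 0 b x + pd 1 ψ x * pd 1 b x with hs
    have hs2 : s ^ 2 ≤ gs ψ x * gs b x := by
      rw [hs]; unfold gs; nlinarith [sq_nonneg (pd 0 ψ x * pd 1 b x - pd 1 ψ x * pd 0 b x)]
    have q1 : (ψ x * A + 2 * s + A' * b x) ^ 2 ≤ 3 * (ψ x ^ 2 * A ^ 2 + 4 * s ^ 2 + A' ^ 2 * b x ^ 2) := by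
      nlinarith [sq_nonneg (ψ x * A - 2 * s), sq_nonneg (ψ x * A - A' * b x), sq_nonneg (2 * s - A' * b x)]
    have q2 : ψ x ^ 2 * A ^ 2 ≤ m * A ^ 2 := by gcongr
    have q3 : A' ^ 2 * b x ^ 2 ≤ m * b x ^ 2 := by gcongr
    have q4 : 4 * gs ψ x * gs b x ≤ m * gs b x := by gcongr
    nlinarith [sq_nonneg A, sq_nonneg (b x), mul_nonneg hm0 (sq_nonneg A), mul_nonneg hm0 (sq_nonneg (b x)), mul_nonneg hm0 gb0]
  · have e : gs (fun y => ψ y * b y) x = (ψ x * pd 0 b x + pd 0 ψ x * b x) ^ 2 + (ψ x * pd 1 b x + pd 1 ψ x * b x) ^ 2 := by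
      show (pd 0 _ x) ^ 2 + (pd 1 _ x) ^ 2 = _
      rw [pd_mul_fun 0 hψ hb, pd_mul_fun 1 hψ hb]
    rw [e]
    have q1 : (ψ x * pd 0 b x + pd 0 ψ x * b x) ^ 2 + (ψ x * pd 1 b x + pd 1 ψ x * b x) ^ 2 ≤
      2 * (ψ x ^ 2 * gs b x + gs ψ x * b x ^ 2) := by
      unfold gs
      nlinarith [sq_nonneg (ψ x * pd 0 b x - pd 0 ψ x * b x), sq_nonneg (ψ x * pd 1 b x - pd 1 ψ x * b x)]
    have q2 : ψ x ^ 2 * gs b x ≤ m * gs b x := by gcongr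
    have q3 : 4 * gs ψ x * b x ^ 2 ≤ m * b x ^ 2 := by gcongr
    nlinarith [sq_nonneg (b x), mul_nonneg hm0 (sq_nonneg (b x)), mul_nonneg hm0 gb0]

/-- normal component of `b` (extended) -/
def al (φ b1 b2 : V2 → ℝ) : V2 → ℝ := fun x => pd 0 φ x * b1 x + pd 1 φ x * b2 x
/-- cut-off component -/
def ze (φ b : V2 → ℝ) : V2 → ℝ := fun x => φ x * b x

lemma Dom.al_sm (h : Dom Ω φ) {b1 b2 : V2 → ℝ} (h1 : Sm b1) (h2 : Sm b2) : Sm (al φ b1 b2) :=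
  ((h.sm.pd 0).mul h1).add ((h.sm.pd 1).mul h2)
lemma Dom.ze_sm (h : Dom Ω φ) {b : V2 → ℝ} (h1 : Sm b) : Sm (ze φ b) := h.sm.mul h1

lemma lapB (hO : IsOpen Ω) {b1 b2 : V2 → ℝ} (h1 : Sm b1) (h2 : Sm b2) (hd : ∀ x ∈ Ω, dv b1 b2 x = 0) (x : V2) (hx : x ∈ Ω) :
    pd 0 (pd 0 b1) x + pd 1 (pd 1 b1) x = - pd 1 (cl b1 b2) x ∧ pd 0 (pd 0 b2) x + pd 1 (pd 1 b2) x = pd 0 (cl b1 b2) x := by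
  have z : ∀ i, pd i (dv b1 b2) x = 0 := fun i => by
    rw [pd_congr_open i hO hx (g := fun _ => 0) hd, pd_const]
  have e0 : ∀ i, pd i (dv b1 b2) x = pd i (pd 0 b1) x + pd i (pd 1 b2) x := fun i =>
    pd_add i ((h1.pd 0).d x) ((h2.pd 1).d x)
  have e1 : ∀ i, pd i (cl b1 b2) x = pd i (pd 0 b2) x - pd i (pd 1 b1) x := fun i =>
    pd_sub i ((h2.pd 0).d x) ((h1.pd 1).d x)
  have z0 := z 0; have z1 := z 1
  rw [e0] at z0 z1
  rw [e1, e1]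
  have c1 := pd_comm h1 0 1 x
  have c2 := pd_comm h2 0 1 x
  constructor <;> linarith

lemma gradB_P1 {p q s f0 f1 f00 f01 f10 f11 β1 β2 α0 α1 m : ℝ} (hm0 : 0 ≤ m) (hf0 : f0 ^ 2 + f1 ^ 2 ≤ m)
    (hff : f00 ^ 2 + f10 ^ 2 + f01 ^ 2 + f11 ^ 2 ≤ m)
    (a0 : α0 = f0 * p + f00 * β1 + (f1 * s + f10 * β2)) (a1 : α1 = f0 * q + f01 * β1 + (f1 * -p + f11 * β2)) :
    (p ^ 2 + q ^ 2 + (s ^ 2 + (-p) ^ 2)) * (f0 ^ 2 + f1 ^ 2) ≤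
      12 * (α0 ^ 2 + α1 ^ 2) + (16 * m) * (β1 ^ 2 + β2 ^ 2) + (14 * m) * (s - q) ^ 2 := by
  have id : (p ^ 2 + q ^ 2) * (f0 ^ 2 + f1 ^ 2) = (α0 - (f00 * β1 + f10 * β2) - (s - q) * f1) ^ 2 + (α1 - (f01 * β1 + f11 * β2)) ^ 2 := by
    rw [a0, a1]; ring
  have r1 : (f00 * β1 + f10 * β2) ^ 2 ≤ (f00 ^ 2 + f10 ^ 2) * (β1 ^ 2 + β2 ^ 2) := by
    nlinarith [sq_nonneg (f00 * β2 - f10 * β1)]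
  have r2 : (f01 * β1 + f11 * β2) ^ 2 ≤ (f01 ^ 2 + f11 ^ 2) * (β1 ^ 2 + β2 ^ 2) := by
    nlinarith [sq_nonneg (f01 * β2 - f11 * β1)]
  have r3 : (f00 ^ 2 + f10 ^ 2 + f01 ^ 2 + f11 ^ 2) * (β1 ^ 2 + β2 ^ 2) ≤ m * (β1 ^ 2 + β2 ^ 2) := by
    gcongr
  have s4 := sq_nonneg f0
  have r4 : (s - q) ^ 2 * f1 ^ 2 ≤ (s - q) ^ 2 * m := by gcongr; linarith
  have r4' : (s - q) ^ 2 * (f0 ^ 2 + f1 ^ 2) ≤ (s - q) ^ 2 * m := by gcongr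
  have r5 : ∀ x y z : ℝ, (x - y - z) ^ 2 ≤ 3 * x ^ 2 + 3 * y ^ 2 + 3 * z ^ 2 := fun x y z => by
    nlinarith [sq_nonneg (x + y), sq_nonneg (x + z), sq_nonneg (y - z)]
  have r6 := r5 α0 (f00 * β1 + f10 * β2) ((s - q) * f1)
  have r7 := r5 α1 (f01 * β1 + f11 * β2) 0
  have r8 : s ^ 2 ≤ 2 * q ^ 2 + 2 * (s - q) ^ 2 := by nlinarith [sq_nonneg (s - 2 * q)]
  have r9 : s ^ 2 * (f0 ^ 2 + f1 ^ 2) ≤ (2 * q ^ 2 + 2 * (s - q) ^ 2) * (f0 ^ 2 + f1 ^ 2) := by gcongr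
  have r10 : (p ^ 2 + q ^ 2) * (f0 ^ 2 + f1 ^ 2) ≤ 3 * (α0 ^ 2 + α1 ^ 2) + 3 * (m * (β1 ^ 2 + β2 ^ 2)) + 3 * ((s - q) ^ 2 * m) := by
    rw [id]; rw [mul_pow] at r6; rw [sub_zero] at r7; linarith
  have r11 : 0 ≤ p ^ 2 * (f0 ^ 2 + f1 ^ 2) := by positivity
  have r12 : 0 ≤ m * (β1 ^ 2 + β2 ^ 2) := by positivity
  have r13 : 0 ≤ (s - q) ^ 2 * m := by positivity
  have r14 : 0 ≤ q ^ 2 * (f0 ^ 2 + f1 ^ 2) := by positivity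
  linarith

lemma gradB_P2 {p q s f f0 f1 β1 β2 ζ10 ζ11 ζ20 ζ21 m : ℝ} (hf0 : f0 ^ 2 + f1 ^ 2 ≤ m)
    (z10 : ζ10 = f * p + f0 * β1) (z11 : ζ11 = f * q + f1 * β1)
    (z20 : ζ20 = f * s + f0 * β2) (z21 : ζ21 = f * -p + f1 * β2) :
    (p ^ 2 + q ^ 2 + (s ^ 2 + (-p) ^ 2)) * f ^ 2 ≤ 2 * (ζ10 ^ 2 + ζ11 ^ 2 + (ζ20 ^ 2 + ζ21 ^ 2)) + 2 * m * (β1 ^ 2 + β2 ^ 2) := by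
  have id : (p ^ 2 + q ^ 2 + (s ^ 2 + (-p) ^ 2)) * f ^ 2 = (ζ10 - f0 * β1) ^ 2 + (ζ11 - f1 * β1) ^ 2 + ((ζ20 - f0 * β2) ^ 2 + (ζ21 - f1 * β2) ^ 2) := by
    rw [z10, z11, z20, z21]; ring
  have r1 : (f0 ^ 2 + f1 ^ 2) * (β1 ^ 2 + β2 ^ 2) ≤ m * (β1 ^ 2 + β2 ^ 2) := by gcongr
  rw [id]
  linarith [sq_nonneg (ζ10 + f0 * β1), sq_nonneg (ζ11 + f1 * β1), sq_nonneg (ζ20 + f0 * β2), sq_nonneg (ζ21 + f1 * β2)]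

/-- pointwise control of the gradient -/
lemma Dom.gradB (h : Dom Ω φ) : ∃ C > 0, ∀ b1 b2, Sm b1 → Sm b2 → (∀ x ∈ Ω, dv b1 b2 x = 0) → ∀ x ∈ Ω,
    gs b1 x + gs b2 x ≤ C * (gs (al φ b1 b2) x + gs (ze φ b1) x + gs (ze φ b2) x + b1 x ^ 2 + b2 x ^ 2 + cl b1 b2 x ^ 2) := by
  have cφ := h.sm.cont
  have cg := h.sm.c1.cgs
  have d00 := (h.sm.pd 0).cpd 0
  have d01 := (h.sm.pd 0).cpd 1
  have d10 := (h.sm.pd 1).cpd 0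
  have d11 := (h.sm.pd 1).cpd 1
  obtain ⟨m, hm0, hm⟩ := h.bdd (f := fun x => gs φ x + pd 0 (pd 0 φ) x ^ 2 + pd 1 (pd 0 φ) x ^ 2 + pd 0 (pd 1 φ) x ^ 2 + pd 1 (pd 1 φ) x ^ 2) (by fun_prop)
  obtain ⟨x0, hx0, hmin⟩ := h.compact.exists_isMinOn (h.ne.mono subset_closure) (f := fun x => gs φ x + φ x ^ 2) (by fun_prop)
  set c := gs φ x0 + φ x0 ^ 2 with hc
  have hc0 : 0 < c := by
    by_cases hz : φ x0 = 0
    · have h1 := h.gr x0 hz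
      have : 0 < gs φ x0 := h1
      positivity
    · have := gs_nonneg φ x0
      positivity
  refine ⟨(20 * m + 40) / c, by positivity, fun b1 b2 h1 h2 hd x hx => ?_⟩
  have hcx : c ≤ gs φ x + φ x ^ 2 := hmin (subset_closure hx)
  have hmx := (le_abs_self _).trans (hm x (subset_closure hx))
  rw [div_mul_eq_mul_div, le_div_iff₀ hc0]
  have hG0 : 0 ≤ gs b1 x + gs b2 x := add_nonneg (gs_nonneg _ _) (gs_nonneg _ _)
  have step : (gs b1 x + gs b2 x) * c ≤ (gs b1 x + gs b2 x) * (gs φ x + φ x ^ 2) := by gcongr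
  refine step.trans ?_
  have eal : ∀ i, pd i (al φ b1 b2) x = pd 0 φ x * pd i b1 x + pd i (pd 0 φ) x * b1 x + (pd 1 φ x * pd i b2 x + pd i (pd 1 φ) x * b2 x) := by
    intro i
    have := pd_add i (((h.sm.pd 0).mul h1).d x) (((h.sm.pd 1).mul h2).d x)
    rw [pd_mul i ((h.sm.pd 0).d x) (h1.d x), pd_mul i ((h.sm.pd 1).d x) (h2.d x)] at this
    exact this
  have eze : ∀ i b, Sm b → pd i (ze φ b) x = φ x * pd i b x + pd i φ x * b x := fun i b hb =>
    pd_mul i (h.sm.d x) (hb.d x)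
  have hdx := hd x hx
  unfold dv at hdx
  have a0 := eal 0
  have a1 := eal 1
  have z10 := eze 0 b1 h1
  have z11 := eze 1 b1 h1
  have z20 := eze 0 b2 h2
  have z21 := eze 1 b2 h2
  unfold gs cl at *
  have s0 := sq_nonneg (pd 0 (pd 0 φ) x)
  have s1 := sq_nonneg (pd 1 (pd 0 φ) x)
  have s2 := sq_nonneg (pd 0 (pd 1 φ) x)
  have s3 := sq_nonneg (pd 1 (pd 1 φ) x)
  have s4 := sq_nonneg (pd 0 φ x)
  have s5 := sq_nonneg (pd 1 φ x)
  generalize pd 0 (al φ b1 b2) x = α0 at *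
  generalize pd 1 (al φ b1 b2) x = α1 at *
  generalize pd 0 (ze φ b1) x = ζ10 at *
  generalize pd 1 (ze φ b1) x = ζ11 at *
  generalize pd 0 (ze φ b2) x = ζ20 at *
  generalize pd 1 (ze φ b2) x = ζ21 at *
  generalize pd 0 b1 x = p at *
  generalize pd 1 b1 x = q at *
  generalize pd 0 b2 x = s at *
  generalize pd 1 b2 x = p' at *
  generalize b1 x = β1 at *
  generalize b2 x = β2 at *
  generalize φ x = f at *
  generalize pd 0 φ x = f0 at *
  generalize pd 1 φ x = f1 at *
  generalize pd 0 (pd 0 φ) x = f00 at *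
  generalize pd 1 (pd 0 φ) x = f01 at *
  generalize pd 0 (pd 1 φ) x = f10 at *
  generalize pd 1 (pd 1 φ) x = f11 at *
  obtain rfl : p' = -p := by linarith
  have hf0 : f0 ^ 2 + f1 ^ 2 ≤ m := by linarith
  have hb0 : 0 ≤ β1 ^ 2 := sq_nonneg _
  have hb1 : 0 ≤ β2 ^ 2 := sq_nonneg _
  have hj0 : 0 ≤ (s - q) ^ 2 := sq_nonneg _
  have P1 := gradB_P1 hm0 hf0 (by linarith) a0 a1
  have P2 := gradB_P2 hf0 z10 z11 z20 z21
  have e1 : 0 ≤ m * (α0 ^ 2 + α1 ^ 2 + (ζ10 ^ 2 + ζ11 ^ 2) + (ζ20 ^ 2 + ζ21 ^ 2) + β1 ^ 2 + β2 ^ 2 + (s - q) ^ 2) := by positivity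
  have e2 : 0 ≤ α0 ^ 2 + α1 ^ 2 := by positivity
  have e3 : 0 ≤ ζ10 ^ 2 + ζ11 ^ 2 + (ζ20 ^ 2 + ζ21 ^ 2) := by positivity
  have e4 : 0 ≤ m * (β1 ^ 2 + β2 ^ 2) := by positivity
  have e5 : 0 ≤ m * (s - q) ^ 2 := by positivity
  have e6 : 0 ≤ m * (α0 ^ 2 + α1 ^ 2) := by positivity
  have e7 : 0 ≤ m * (ζ10 ^ 2 + ζ11 ^ 2 + (ζ20 ^ 2 + ζ21 ^ 2)) := by positivity
  linarith
end

section
variable {Ω : Set V2} {φ : V2 → ℝ}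

lemma Dom.hessG (h : Dom Ω φ) {ψ1 ψ2 : V2 → ℝ} (s1 : Sm ψ1) (s2 : Sm ψ2) : ∃ C > 0, ∀ b1 b2, Sm b1 → Sm b2 →
    (∀ x, φ x = 0 → ψ1 x * b1 x + ψ2 x * b2 x = 0) → (∀ x ∈ Ω, dv b1 b2 x = 0) →
    II Ω (gs (fun x => ψ1 x * b1 x + ψ2 x * b2 x)) ≤ C * (N1 Ω b1 + N1 Ω b2) ∧
    II Ω (gs (pd 0 (fun x => ψ1 x * b1 x + ψ2 x * b2 x))) + II Ω (gs (pd 1 (fun x => ψ1 x * b1 x + ψ2 x * b2 x)))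
      ≤ C * (II Ω (gs (cl b1 b2)) + (N1 Ω b1 + N1 Ω b2)) := by
  obtain ⟨C1, hC1, H1⟩ := h.lapprod s1
  obtain ⟨C2, hC2, H2⟩ := h.lapprod s2
  refine ⟨2 * (C1 + C2), by positivity, fun b1 b2 h1 h2 hb hd => ?_⟩
  set g : V2 → ℝ := fun x => ψ1 x * b1 x + ψ2 x * b2 x with hg
  have hgs : Sm g := (s1.mul h1).add (s2.mul h2)
  have cb1 := h1.cont
  have cb2 := h2.cont
  have cg1 := h1.c1.cgs
  have cg2 := h2.c1.cgs
  have cj := (h1.cl h2).c1.cgs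
  have eN : N1 Ω b1 + N1 Ω b2 = II Ω (fun x => gs b1 x + gs b2 x + b1 x ^ 2 + b2 x ^ 2) := by
    unfold N1
    rw [h.iadd (by fun_prop) (by fun_prop), h.iadd (by fun_prop) (by fun_prop), h.iadd (by fun_prop) (by fun_prop)]
    ring
  rw [eN]
  have epd : ∀ i x, pd i g x = pd i (fun y => ψ1 y * b1 y) x + pd i (fun y => ψ2 y * b2 y) x := fun i x =>
    pd_add i ((s1.mul h1).d x) ((s2.mul h2).d x)
  have epd2 : ∀ i x, pd i (pd i g) x = pd i (pd i (fun y => ψ1 y * b1 y)) x + pd i (pd i (fun y => ψ2 y * b2 y)) x := fun i x => by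
    rw [funext (epd i)]
    exact pd_add i (((s1.mul h1).pd i).d x) (((s2.mul h2).pd i).d x)
  constructor
  · have := h.le1 (e := gs g) hgs.c1.cgs (f := fun x => gs b1 x + gs b2 x + b1 x ^ 2 + b2 x ^ 2) (by fun_prop) (2 * (C1 + C2)) ?_
    · exact this
    · intro x hx
      have k1 := (H1 b1 h1 x hx).2
      have k2 := (H2 b2 h2 x hx).2
      have n1 := gs_nonneg b1 x
      have n2 := gs_nonneg b2 x
      have q : gs g x ≤ 2 * gs (fun y => ψ1 y * b1 y) x + 2 * gs (fun y => ψ2 y * b2 y) x := by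
        unfold gs; rw [epd, epd]
        nlinarith [sq_nonneg (pd 0 (fun y => ψ1 y * b1 y) x - pd 0 (fun y => ψ2 y * b2 y) x), sq_nonneg (pd 1 (fun y => ψ1 y * b1 y) x - pd 1 (fun y => ψ2 y * b2 y) x)]
      have m1 : 0 ≤ C1 * (gs b2 x + b2 x ^ 2) := by positivity
      have m2 : 0 ≤ C2 * (gs b1 x + b1 x ^ 2) := by positivity
      nlinarith
  · have hh := h.hess_bound hgs hb
    rw [h.iadd (hgs.pd 0).c1.cgs (hgs.pd 1).c1.cgs] at hh
    refine hh.trans ?_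
    rw [← h.iadd cj (by fun_prop)]
    have c0 := (hgs.pd 0).cpd 0
    have c1 := (hgs.pd 1).cpd 1
    refine h.le1 (e := fun x => (pd 0 (pd 0 g) x + pd 1 (pd 1 g) x) ^ 2) (by fun_prop) (f := fun x => gs (cl b1 b2) x + (gs b1 x + gs b2 x + b1 x ^ 2 + b2 x ^ 2)) (by fun_prop) (2 * (C1 + C2)) ?_
    intro x hx
    obtain ⟨l1, l2⟩ := lapB h.isOpen h1 h2 hd x hx
    have k1 := (H1 b1 h1 x hx).1
    have k2 := (H2 b2 h2 x hx).1
    rw [l1] at k1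
    rw [l2] at k2
    have n1 := gs_nonneg b1 x
    have n2 := gs_nonneg b2 x
    have n3 := gs_nonneg (cl b1 b2) x
    have n4 : gs (cl b1 b2) x = pd 0 (cl b1 b2) x ^ 2 + pd 1 (cl b1 b2) x ^ 2 := rfl
    rw [epd2, epd2]
    have j0 := sq_nonneg (pd 0 (cl b1 b2) x)
    have j1 := sq_nonneg (pd 1 (cl b1 b2) x)
    generalize pd 0 (cl b1 b2) x = J0 at *
    generalize pd 1 (cl b1 b2) x = J1 at *
    generalize pd 0 (pd 0 (fun y => ψ1 y * b1 y)) x = p1 at *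
    generalize pd 1 (pd 1 (fun y => ψ1 y * b1 y)) x = p2 at *
    generalize pd 0 (pd 0 (fun y => ψ2 y * b2 y)) x = p3 at *
    generalize pd 1 (pd 1 (fun y => ψ2 y * b2 y)) x = p4 at *
    generalize gs b1 x = G1 at *
    generalize gs b2 x = G2 at *
    generalize gs (cl b1 b2) x = G3 at *
    have b1s := sq_nonneg (b1 x)
    have b2s := sq_nonneg (b2 x)
    generalize b1 x ^ 2 = B1 at *
    generalize b2 x ^ 2 = B2 at *
    have q : (p1 + p3 + (p2 + p4)) ^ 2 ≤ 2 * (p1 + p2) ^ 2 + 2 * (p3 + p4) ^ 2 := by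
      nlinarith [sq_nonneg (p1 + p2 - p3 - p4)]
    have m1 : C1 * ((-J1) ^ 2 + G1 + B1) ≤ C1 * (G3 + (G1 + G2 + B1 + B2)) :=
      mul_le_mul_of_nonneg_left (by linarith [neg_sq J1]) hC1.le
    have m2 : C2 * (J0 ^ 2 + G2 + B2) ≤ C2 * (G3 + (G1 + G2 + B1 + B2)) :=
      mul_le_mul_of_nonneg_left (by linarith) hC2.le
    linarith

/-- the bound for an auxiliary function -/
def HB (Ω : Set V2) (C : ℝ) (g b1 b2 : V2 → ℝ) : Prop :=
  II Ω (gs g) ≤ C * (N1 Ω b1 + N1 Ω b2) ∧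
    II Ω (gs (pd 0 g)) + II Ω (gs (pd 1 g)) ≤ C * (II Ω (gs (cl b1 b2)) + (N1 Ω b1 + N1 Ω b2))

lemma Dom.HB_mono (h : Dom Ω φ) {C C' : ℝ} (hc : C ≤ C') {g b1 b2 : V2 → ℝ} (H : HB Ω C g b1 b2) : HB Ω C' g b1 b2 := by
  have n1 := h.N1_nonneg b1
  have n2 := h.N1_nonneg b2
  have n3 : 0 ≤ II Ω (gs (cl b1 b2)) := h.nn fun _ _ => gs_nonneg _ _
  refine ⟨H.1.trans ?_, H.2.trans ?_⟩ <;> gcongr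

lemma Dom.hessAll (h : Dom Ω φ) : ∃ C > 0, ∀ b1 b2, Sm b1 → Sm b2 → Tan φ b1 b2 → (∀ x ∈ Ω, dv b1 b2 x = 0) →
    HB Ω C (al φ b1 b2) b1 b2 ∧ HB Ω C (ze φ b1) b1 b2 ∧ HB Ω C (ze φ b2) b1 b2 := by
  obtain ⟨C1, hC1, H1⟩ := h.hessG (h.sm.pd 0) (h.sm.pd 1)
  have s0 : Sm (fun _ : V2 => (0:ℝ)) := contDiff_const
  obtain ⟨C2, hC2, H2⟩ := h.hessG h.sm s0
  obtain ⟨C3, hC3, H3⟩ := h.hessG s0 h.sm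
  refine ⟨C1 + C2 + C3, by positivity, fun b1 b2 h1 h2 ht hd => ⟨?_, ?_, ?_⟩⟩
  · exact h.HB_mono (by linarith) (H1 b1 b2 h1 h2 (fun x hx => by linarith [ht x hx]) hd)
  · have := H2 b1 b2 h1 h2 (fun x hx => by simp [hx]) hd
    have e : (fun x => φ x * b1 x + 0 * b2 x) = ze φ b1 := by ext x; unfold ze; ring
    rw [e] at this
    exact h.HB_mono (by linarith) this
  · have := H3 b1 b2 h1 h2 (fun x hx => by simp [hx]) hd
    have e : (fun x => 0 * b1 x + φ x * b2 x) = ze φ b2 := by ext x; unfold ze; ring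
    rw [e] at this
    exact h.HB_mono (by linarith) this
end

section
variable {Ω : Set V2} {φ : V2 → ℝ}

/-- all the scalar fields at a fixed time -/
structure Fld where
  (r rt P Pt u1 u2 b1 b2 ut1 ut2 c1 c2 : V2 → ℝ)

namespace Fld
variable (s : Fld)
def D : V2 → ℝ := dv s.u1 s.u2
def w : V2 → ℝ := cl s.u1 s.u2
def j : V2 → ℝ := cl s.b1 s.b2
def F (L : ℝ) : V2 → ℝ := fun x => L * s.D x - s.P x
def q : V2 → ℝ := fun x => s.u2 x * s.b1 x - s.u1 x * s.b2 x
def v1 : V2 → ℝ := fun x => s.ut1 x + (s.u1 x * pd 0 s.u1 x + s.u2 x * pd 1 s.u1 x)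
def v2 : V2 → ℝ := fun x => s.ut2 x + (s.u1 x * pd 0 s.u2 x + s.u2 x * pd 1 s.u2 x)
def U2 : V2 → ℝ := fun x => s.u1 x ^ 2 + s.u2 x ^ 2
def B2 : V2 → ℝ := fun x => s.b1 x ^ 2 + s.b2 x ^ 2
def gu : V2 → ℝ := fun x => gs s.u1 x + gs s.u2 x
def gb : V2 → ℝ := fun x => gs s.b1 x + gs s.b2 x
def d2 (Ω : Set V2) : ℝ := II Ω fun x => s.D x ^ 2
def w2 (Ω : Set V2) : ℝ := II Ω fun x => s.w x ^ 2
def j2 (Ω : Set V2) : ℝ := II Ω fun x => s.j x ^ 2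
def A (Ω : Set V2) (μ ν L : ℝ) : ℝ := L * s.d2 Ω + μ * s.w2 Ω + ν * s.j2 Ω
def X (Ω : Set V2) : ℝ := II Ω fun x => s.r x * (s.v1 x ^ 2 + s.v2 x ^ 2)
def Y (Ω : Set V2) : ℝ := II Ω fun x => s.c1 x ^ 2 + s.c2 x ^ 2
end Fld

/-- static hypotheses -/
structure Stat (Ω : Set V2) (φ : V2 → ℝ) (μ ν Rm Pm L : ℝ) (s : Fld) : Prop where
  dom : Dom Ω φ
  hμ : 0 < μ
  hν : 0 < ν
  hL : μ ≤ L
  hRm : 0 < Rm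
  hPm : 0 < Pm
  su1 : Sm s.u1
  su2 : Sm s.u2
  sb1 : Sm s.b1
  sb2 : Sm s.b2
  sr : Sm s.r
  sP : C1 s.P
  r0 : ∀ x ∈ Ω, 0 ≤ s.r x
  r1 : ∀ x ∈ Ω, s.r x ≤ Rm
  P0 : ∀ x ∈ Ω, 0 ≤ s.P x
  P1 : ∀ x ∈ Ω, s.P x ≤ Pm
  tu : Tan φ s.u1 s.u2
  tb : Tan φ s.b1 s.b2
  w0 : ∀ x, φ x = 0 → s.w x = 0
  j0 : ∀ x, φ x = 0 → s.j x = 0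
  db : ∀ x ∈ Ω, dv s.b1 s.b2 x = 0

/-- snapshot of a solution -/
structure Snap (Ω : Set V2) (φ : V2 → ℝ) (γ μ ν Rm Pm L : ℝ) (s : Fld) : Prop extends Stat Ω φ μ ν Rm Pm L s where
  hγ : 1 < γ
  sut1 : Sm s.ut1
  sut2 : Sm s.ut2
  sc1 : Sm s.c1
  sc2 : Sm s.c2
  crt : Continuous s.rt
  cPt : Continuous s.Pt
  tut : Tan φ s.ut1 s.ut2
  mass : ∀ x ∈ Ω, s.rt x + (s.u1 x * pd 0 s.r x + s.u2 x * pd 1 s.r x) + s.r x * s.D x = 0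
  mom1 : ∀ x ∈ Ω, s.r x * s.v1 x = pd 0 (s.F L) x - μ * pd 1 s.w x - s.j x * s.b2 x
  mom2 : ∀ x ∈ Ω, s.r x * s.v2 x = pd 1 (s.F L) x + μ * pd 0 s.w x + s.j x * s.b1 x
  mag1 : ∀ x ∈ Ω, s.c1 x = - (ν * pd 1 s.j x + pd 1 s.q x)
  mag2 : ∀ x ∈ Ω, s.c2 x = ν * pd 0 s.j x + pd 0 s.q x
  pres : ∀ x ∈ Ω, s.Pt x + (s.u1 x * pd 0 s.P x + s.u2 x * pd 1 s.P x) + γ * (s.P x * s.D x) = 0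

section
variable {γ μ ν Rm Pm L : ℝ} {s : Fld}

lemma Stat.sD (h : Stat Ω φ μ ν Rm Pm L s) : Sm s.D := h.su1.dv h.su2
lemma Stat.sw (h : Stat Ω φ μ ν Rm Pm L s) : Sm s.w := h.su1.cl h.su2
lemma Stat.sj (h : Stat Ω φ μ ν Rm Pm L s) : Sm s.j := h.sb1.cl h.sb2
lemma Stat.sF (h : Stat Ω φ μ ν Rm Pm L s) : C1 (s.F L) := (h.sD.c1.cmul L).sub h.sP
lemma Stat.sq (h : Stat Ω φ μ ν Rm Pm L s) : Sm s.q := (h.su2.mul h.sb1).sub (h.su1.mul h.sb2)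
lemma Stat.cU2 (h : Stat Ω φ μ ν Rm Pm L s) : Continuous s.U2 := ((h.su1.pow 2).add (h.su2.pow 2)).cont
lemma Stat.cB2 (h : Stat Ω φ μ ν Rm Pm L s) : Continuous s.B2 := ((h.sb1.pow 2).add (h.sb2.pow 2)).cont
lemma Stat.cgu (h : Stat Ω φ μ ν Rm Pm L s) : Continuous s.gu := (h.su1.c1.cgs).add h.su2.c1.cgs
lemma Stat.cgb (h : Stat Ω φ μ ν Rm Pm L s) : Continuous s.gb := (h.sb1.c1.cgs).add h.sb2.c1.cgs
lemma Stat.L0 (h : Stat Ω φ μ ν Rm Pm L s) : 0 < L := h.hμ.trans_le h.hL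
lemma Stat.d20 (h : Stat Ω φ μ ν Rm Pm L s) : 0 ≤ s.d2 Ω := h.dom.nn fun _ _ => sq_nonneg _
lemma Stat.w20 (h : Stat Ω φ μ ν Rm Pm L s) : 0 ≤ s.w2 Ω := h.dom.nn fun _ _ => sq_nonneg _
lemma Stat.j20 (h : Stat Ω φ μ ν Rm Pm L s) : 0 ≤ s.j2 Ω := h.dom.nn fun _ _ => sq_nonneg _
lemma Stat.A0 (h : Stat Ω φ μ ν Rm Pm L s) : 0 ≤ s.A Ω μ ν L := by
  have := h.d20; have := h.w20; have := h.j20; have := h.hμ; have := h.hν; have := h.L0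
  unfold Fld.A; positivity
lemma Stat.d2A (h : Stat Ω φ μ ν Rm Pm L s) : μ * s.d2 Ω ≤ s.A Ω μ ν L := by
  have := h.d20; have := h.w20; have := h.j20; have := h.hμ; have := h.hν; have := h.hL
  have : μ * s.d2 Ω ≤ L * s.d2 Ω := by gcongr
  have : 0 ≤ μ * s.w2 Ω := by positivity
  have : 0 ≤ ν * s.j2 Ω := by positivity
  unfold Fld.A; linarith
lemma Stat.w2A (h : Stat Ω φ μ ν Rm Pm L s) : μ * s.w2 Ω ≤ s.A Ω μ ν L := by
  have := h.d20; have := h.w20; have := h.j20; have := h.hμ; have := h.hν; have := h.L0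
  have : 0 ≤ L * s.d2 Ω := by positivity
  have : 0 ≤ ν * s.j2 Ω := by positivity
  unfold Fld.A; linarith
lemma Stat.j2A (h : Stat Ω φ μ ν Rm Pm L s) : ν * s.j2 Ω ≤ s.A Ω μ ν L := by
  have := h.d20; have := h.w20; have := h.j20; have := h.hμ; have := h.hν; have := h.L0
  have : 0 ≤ L * s.d2 Ω := by positivity
  have : 0 ≤ μ * s.w2 Ω := by positivity
  unfold Fld.A; linarith

lemma Stat.q0 (h : Stat Ω φ μ ν Rm Pm L s) (x : V2) (hx : φ x = 0) : s.q x = 0 := by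
  have t1 := h.tu x hx
  have t2 := h.tb x hx
  have g := h.dom.gr x hx
  unfold Fld.q
  have e0 : (s.u2 x * s.b1 x - s.u1 x * s.b2 x) * pd 0 φ x = 0 := by
    linear_combination s.u2 x * t2 - s.b2 x * t1
  have e1 : (s.u2 x * s.b1 x - s.u1 x * s.b2 x) * pd 1 φ x = 0 := by
    linear_combination s.b1 x * t1 - s.u1 x * t2
  by_contra hne
  have z0 := (mul_eq_zero.1 e0).resolve_left hne
  have z1 := (mul_eq_zero.1 e1).resolve_left hne
  simp [z0, z1] at g

lemma Dom.curl_ibp (h : Dom Ω φ) {g z1 z2 : V2 → ℝ} (hg : C1 g) (h1 : Sm z1) (h2 : Sm z2) (hb : ∀ x, φ x = 0 → g x = 0) :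
    (II Ω fun x => g x * cl z1 z2 x) = - II Ω fun x => z2 x * pd 0 g x - z1 x * pd 1 g x := by
  have := h.ibp' hg h2.c1 (h1.c1.neg) (fun x hx => by rw [hb x hx, zero_mul])
  simp only [pd_neg] at this
  rw [h.congr (f := fun x => g x * cl z1 z2 x) (g := fun x => g x * (pd 0 z2 x + - pd 1 z1 x)) (fun x _ => by unfold cl; ring), this]
  congr 1
  exact h.congr fun x _ => by ring

lemma Dom.dv_ibp (h : Dom Ω φ) {g z1 z2 : V2 → ℝ} (hg : C1 g) (h1 : C1 z1) (h2 : C1 z2) (hb : Tan φ z1 z2) :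
    (II Ω fun x => g x * dv z1 z2 x) = - II Ω fun x => z1 x * pd 0 g x + z2 x * pd 1 g x :=
  h.ibp' hg h1 h2 (fun x hx => by rw [hb x hx, mul_zero])

lemma Snap.mom_test (h : Snap Ω φ γ μ ν Rm Pm L s) {z1 z2 : V2 → ℝ} (h1 : Sm z1) (h2 : Sm z2) (ht : Tan φ z1 z2) :
    (II Ω fun x => s.r x * s.v1 x * z1 x + s.r x * s.v2 x * z2 x) =
      - (II Ω fun x => s.F L x * dv z1 z2 x) - μ * (II Ω fun x => s.w x * cl z1 z2 x)
      + II Ω fun x => s.j x * (s.b1 x * z2 x - s.b2 x * z1 x) := by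
  rw [h.dom.dv_ibp h.sF h1.c1 h2.c1 ht, h.dom.curl_ibp h.sw.c1 h1 h2 h.w0]
  have a1 := h.sF.cpd 0
  have a2 := h.sF.cpd 1
  have a3 := h.sw.cpd 0
  have a4 := h.sw.cpd 1
  have a5 := h.sj.cont
  have a6 := h.sb1.cont
  have a7 := h.sb2.cont
  have a8 := h1.cont
  have a9 := h2.cont
  have := h.dom.lin3 (f := fun x => z1 x * pd 0 (s.F L) x + z2 x * pd 1 (s.F L) x)
    (g := fun x => z2 x * pd 0 s.w x - z1 x * pd 1 s.w x)
    (k := fun x => s.j x * (s.b1 x * z2 x - s.b2 x * z1 x)) (by fun_prop) (by fun_prop) (by fun_prop) 1 μ 1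
  rw [neg_neg, mul_neg, sub_neg_eq_add]
  rw [one_mul, one_mul] at this
  rw [← this]
  refine h.dom.congr fun x hx => ?_
  rw [h.mom1 x hx, h.mom2 x hx]; ring

lemma Snap.bc (h : Snap Ω φ γ μ ν Rm Pm L s) :
    (II Ω fun x => s.b1 x * s.c1 x + s.b2 x * s.c2 x) = - (ν * s.j2 Ω) - II Ω fun x => s.j x * s.q x := by
  have sg : Sm (fun x => ν * s.j x + s.q x) := (h.sj.cmul ν).add h.sq
  have := h.dom.curl_ibp sg.c1 h.sb1 h.sb2 (fun x hx => by rw [h.j0 x hx, h.q0 x hx]; ring)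
  have e : ∀ i x, pd i (fun x => ν * s.j x + s.q x) x = ν * pd i s.j x + pd i s.q x := fun i x => by
    rw [pd_add i ((h.sj.cmul ν).d x) (h.sq.d x), pd_const_mul i ν (h.sj.d x)]
  simp only [e] at this
  have e1 : (II Ω fun x => s.b1 x * s.c1 x + s.b2 x * s.c2 x) = - II Ω fun x => (ν * s.j x + s.q x) * cl s.b1 s.b2 x := by
    rw [this, neg_neg]
    refine h.dom.congr fun x hx => ?_
    rw [h.mag1 x hx, h.mag2 x hx]; ring
  rw [e1]
  have a5 := h.sj.cont
  have a6 := h.sq.cont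
  have := h.dom.lin2 (f := fun x => s.j x ^ 2) (g := fun x => s.j x * s.q x) (by fun_prop) (by fun_prop) ν 1
  rw [h.dom.congr (g := fun x => ν * s.j x ^ 2 + 1 * (s.j x * s.q x)) (fun x _ => by
    show (ν * s.j x + s.q x) * s.j x = _
    ring), this]
  unfold Fld.j2; ring

lemma Snap.PD (h : Snap Ω φ γ μ ν Rm Pm L s) :
    (II Ω fun x => s.P x * s.D x) = - II Ω fun x => s.u1 x * pd 0 s.P x + s.u2 x * pd 1 s.P x :=
  h.dom.dv_ibp h.sP h.su1.c1 h.su2.c1 h.tu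

lemma pd_sq (i : Fin 2) {f : V2 → ℝ} (hf : C1 f) (x : V2) : pd i (fun y => f y ^ 2) x = 2 * (f x * pd i f x) := by
  have : (fun y => f y ^ 2) = fun y => f y * f y := by ext y; ring
  rw [this, pd_mul i (hf.d x) (hf.d x)]; ring

lemma Snap.P2D (h : Snap Ω φ γ μ ν Rm Pm L s) :
    (II Ω fun x => s.P x ^ 2 * s.D x) = - (2 * II Ω fun x => s.P x * (s.u1 x * pd 0 s.P x + s.u2 x * pd 1 s.P x)) := by
  have := h.dom.dv_ibp (h.sP.pow 2) h.su1.c1 h.su2.c1 h.tu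
  simp only [pd_sq _ h.sP] at this
  rw [← h.dom.lin1]
  refine this.trans ?_
  congr 1
  exact h.dom.congr fun x _ => by ring

/-- the physical energy identity -/
lemma Snap.energy (h : Snap Ω φ γ μ ν Rm Pm L s) :
    (II Ω fun x => (1 / 2) * (s.rt x * s.U2 x) + s.r x * (s.u1 x * s.ut1 x + s.u2 x * s.ut2 x)
      + (s.b1 x * s.c1 x + s.b2 x * s.c2 x) + (1 / (γ - 1)) * s.Pt x) = - s.A Ω μ ν L := by
  have hγ1 : γ - 1 ≠ 0 := by linarith [h.hγ]
  have cr := h.sr.cont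
  have crt := h.crt
  have cP := h.sP.cont
  have cPt := h.cPt
  have c1 := h.su1.cont
  have c2 := h.su2.cont
  have c3 := h.sb1.cont
  have c4 := h.sb2.cont
  have c5 := h.sut1.cont
  have c6 := h.sut2.cont
  have c7 := h.sc1.cont
  have c8 := h.sc2.cont
  have cU := h.cU2
  have cD := h.sD.cont
  have cj := h.sj.cont
  have cq := h.sq.cont
  have p1 := h.su1.cpd 0
  have p2 := h.su1.cpd 1
  have p3 := h.su2.cpd 0
  have p4 := h.su2.cpd 1
  have p5 := h.sP.cpd 0
  have p6 := h.sP.cpd 1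
  have e0 := h.dom.lin4 (f := fun x => s.rt x * s.U2 x) (g := fun x => s.r x * (s.u1 x * s.ut1 x + s.u2 x * s.ut2 x))
    (k := fun x => s.b1 x * s.c1 x + s.b2 x * s.c2 x) (l := s.Pt) (by fun_prop) (by fun_prop) (by fun_prop) (by fun_prop) (1/2) 1 1 (1/(γ-1))
  simp only [one_mul] at e0
  rw [e0]
  -- mass
  have tr : Tan φ (fun x => s.r x * s.u1 x) (fun x => s.r x * s.u2 x) := fun x hx => by
    linear_combination s.r x * h.tu x hx
  have m1 := h.dom.dv_ibp (g := s.U2) ((h.su1.pow 2).add (h.su2.pow 2)).c1 (h.sr.mul h.su1).c1 (h.sr.mul h.su2).c1 tr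
  have eU : ∀ i x, pd i s.U2 x = 2 * (s.u1 x * pd i s.u1 x) + 2 * (s.u2 x * pd i s.u2 x) := fun i x => by
    have := pd_add i ((h.su1.pow 2).d x) ((h.su2.pow 2).d x)
    rw [pd_sq i h.su1.c1, pd_sq i h.su2.c1] at this
    exact this
  have m2 : (II Ω fun x => s.rt x * s.U2 x) = - II Ω fun x => s.U2 x * dv (fun x => s.r x * s.u1 x) (fun x => s.r x * s.u2 x) x := by
    rw [← neg_one_mul, ← h.dom.lin1]
    refine h.dom.congr fun x hx => ?_
    have := h.mass x hx
    unfold Fld.D dv at this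
    unfold dv
    rw [pd_mul 0 (h.sr.d x) (h.su1.d x), pd_mul 1 (h.sr.d x) (h.su2.d x)]
    linear_combination s.U2 x * this
  rw [m1, neg_neg] at m2
  have m3 := h.mom_test h.su1 h.su2 h.tu
  have m4 : (II Ω fun x => s.r x * s.v1 x * s.u1 x + s.r x * s.v2 x * s.u2 x) =
     1 / 2 * (II Ω fun x => s.rt x * s.U2 x) + II Ω fun x => s.r x * (s.u1 x * s.ut1 x + s.u2 x * s.ut2 x) := by
    rw [m2]
    have d1 := h.su1.cpd 0
    have := h.dom.lin2 (f := fun x => s.r x * s.u1 x * pd 0 s.U2 x + s.r x * s.u2 x * pd 1 s.U2 x)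
      (g := fun x => s.r x * (s.u1 x * s.ut1 x + s.u2 x * s.ut2 x)) (by simp only [eU]; fun_prop) (by fun_prop) (1/2) 1
    rw [one_mul] at this
    rw [← this]
    refine h.dom.congr fun x _ => ?_
    rw [eU, eU]; unfold Fld.v1 Fld.v2; ring
  have m5 : II Ω s.Pt = (1 - γ) * II Ω fun x => s.P x * s.D x := by
    have := h.dom.lin2 (f := fun x => s.u1 x * pd 0 s.P x + s.u2 x * pd 1 s.P x) (g := fun x => s.P x * s.D x) (by fun_prop) (by fun_prop) (-1) (-γ)
    rw [h.dom.congr (f := s.Pt) (g := fun x => -1 * (s.u1 x * pd 0 s.P x + s.u2 x * pd 1 s.P x) + -γ * (s.P x * s.D x))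
      (fun x hx => by linear_combination h.pres x hx), this]
    have := h.PD
    linarith
  have m6 : (II Ω fun x => s.F L x * dv s.u1 s.u2 x) = L * s.d2 Ω - II Ω fun x => s.P x * s.D x := by
    have := h.dom.lin2 (f := fun x => s.D x ^ 2) (g := fun x => s.P x * s.D x) (by fun_prop) (by fun_prop) L (-1)
    rw [h.dom.congr (g := fun x => L * s.D x ^ 2 + -1 * (s.P x * s.D x)) (fun x _ => by
      show (L * s.D x - s.P x) * s.D x = _
      ring), this]
    unfold Fld.d2; ring
  have m7 : (II Ω fun x => s.w x * cl s.u1 s.u2 x) = s.w2 Ω := h.dom.congr fun x _ => by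
    show s.w x * s.w x = _
    ring
  have m8 : (II Ω fun x => s.j x * (s.b1 x * s.u2 x - s.b2 x * s.u1 x)) = II Ω fun x => s.j x * s.q x := h.dom.congr fun x _ => by
    unfold Fld.q; ring
  rw [m4, m6, m7, m8] at m3
  have m9 := h.bc
  rw [m9, m5]
  have e : 1 / (γ - 1) * ((1 - γ) * II Ω fun x => s.P x * s.D x) = - II Ω fun x => s.P x * s.D x := by
    field_simp; ring
  rw [e]
  unfold Fld.A
  linarith

end
end

section
variable {Ω : Set V2} {φ : V2 → ℝ}

namespace Fld
variable (s : Fld)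
def Z (φ : V2 → ℝ) (L : ℝ) : V2 → ℝ := fun x => s.w x ^ 2 + s.j x ^ 2 + (s.F L x / L) ^ 2 + gs (al φ s.b1 s.b2) x
  + gs (ze φ s.b1) x + gs (ze φ s.b2) x + s.b1 x ^ 2 + s.b2 x ^ 2 + 1
def R (Ω : Set V2) (φ : V2 → ℝ) (L : ℝ) : ℝ := II Ω fun x => (s.U2 x + s.B2 x) * s.Z φ L x
end Fld

section
variable {γ μ ν Rm Pm L : ℝ} {s : Fld}

lemma Fld.Z_ge (s : Fld) (φ : V2 → ℝ) (L : ℝ) (x : V2) : s.w x ^ 2 ≤ s.Z φ L x ∧ s.j x ^ 2 ≤ s.Z φ L x ∧ (s.F L x / L) ^ 2 ≤ s.Z φ L x ∧ 1 ≤ s.Z φ L x ∧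
    gs (al φ s.b1 s.b2) x + gs (ze φ s.b1) x + gs (ze φ s.b2) x + s.b1 x ^ 2 + s.b2 x ^ 2 + s.j x ^ 2 ≤ s.Z φ L x ∧
    s.w x ^ 2 + (s.F L x / L) ^ 2 + 1 ≤ s.Z φ L x := by
  have a1 := gs_nonneg (al φ s.b1 s.b2) x
  have a2 := gs_nonneg (ze φ s.b1) x
  have a3 := gs_nonneg (ze φ s.b2) x
  have a4 := sq_nonneg (s.w x)
  have a5 := sq_nonneg (s.j x)
  have a6 := sq_nonneg (s.F L x / L)
  have a7 := sq_nonneg (s.b1 x)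
  have a8 := sq_nonneg (s.b2 x)
  unfold Fld.Z
  refine ⟨?_, ?_, ?_, ?_, ?_, ?_⟩ <;> linarith

lemma Fld.U20 (s : Fld) (x : V2) : 0 ≤ s.U2 x := by unfold Fld.U2; positivity
lemma Fld.B20 (s : Fld) (x : V2) : 0 ≤ s.B2 x := by unfold Fld.B2; positivity
lemma Fld.gu0 (s : Fld) (x : V2) : 0 ≤ s.gu x := add_nonneg (gs_nonneg _ _) (gs_nonneg _ _)
lemma Fld.gb0 (s : Fld) (x : V2) : 0 ≤ s.gb x := add_nonneg (gs_nonneg _ _) (gs_nonneg _ _)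

lemma Stat.cZ (h : Stat Ω φ μ ν Rm Pm L s) : Continuous (s.Z φ L) := by
  have a1 := h.sw.cont
  have a2 := h.sj.cont
  have a3 := h.sF.cont
  have a4 := (h.dom.al_sm h.sb1 h.sb2).c1.cgs
  have a5 := (h.dom.ze_sm h.sb1).c1.cgs
  have a6 := (h.dom.ze_sm h.sb2).c1.cgs
  have a7 := h.sb1.cont
  have a8 := h.sb2.cont
  unfold Fld.Z
  fun_prop

lemma Stat.R0 (h : Stat Ω φ μ ν Rm Pm L s) : 0 ≤ s.R Ω φ L := h.dom.nn fun x _ =>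
  mul_nonneg (add_nonneg (s.U20 x) (s.B20 x)) (zero_le_one.trans (s.Z_ge φ L x).2.2.2.1)

lemma Stat.DZ (h : Stat Ω φ μ ν Rm Pm L s) (x : V2) (hx : x ∈ Ω) : s.D x ^ 2 + s.w x ^ 2 ≤ (3 + 2 * (Pm / μ) ^ 2) * s.Z φ L x := by
  have hL := h.L0
  have e : s.D x = s.F L x / L + s.P x / L := by unfold Fld.F; field_simp; ring
  obtain ⟨z1, z2, z3, z4, z5, z6⟩ := s.Z_ge φ L x
  have hp : (s.P x / L) ^ 2 ≤ (Pm / μ) ^ 2 := by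
    have := h.P0 x hx; have := h.P1 x hx; have := h.hL; have := h.hμ; have := h.hPm
    gcongr
  have : s.D x ^ 2 ≤ 2 * (s.F L x / L) ^ 2 + 2 * (s.P x / L) ^ 2 := by
    rw [e]; nlinarith [sq_nonneg (s.F L x / L - s.P x / L)]
  have : 2 * (Pm / μ) ^ 2 * 1 ≤ 2 * (Pm / μ) ^ 2 * s.Z φ L x := by gcongr
  nlinarith

lemma Stat.gq_pt (h : Stat Ω φ μ ν Rm Pm L s) (x : V2) : gs s.q x ≤ 2 * (s.B2 x * s.gu x) + 2 * (s.U2 x * s.gb x) := by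
  have e : ∀ i, pd i s.q x = s.u2 x * pd i s.b1 x + pd i s.u2 x * s.b1 x - (s.u1 x * pd i s.b2 x + pd i s.u1 x * s.b2 x) := fun i => by
    have := pd_sub i ((h.su2.mul h.sb1).d x) ((h.su1.mul h.sb2).d x)
    rw [pd_mul i (h.su2.d x) (h.sb1.d x), pd_mul i (h.su1.d x) (h.sb2.d x)] at this
    exact this
  have key : ∀ u1 u2 b1 b2 p1 p2 r1 r2 : ℝ, (u2 * r1 + p2 * b1 - (u1 * r2 + p1 * b2)) ^ 2 ≤
      2 * ((b1 ^ 2 + b2 ^ 2) * (p1 ^ 2 + p2 ^ 2)) + 2 * ((u1 ^ 2 + u2 ^ 2) * (r1 ^ 2 + r2 ^ 2)) := fun u1 u2 b1 b2 p1 p2 r1 r2 => by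
    nlinarith [sq_nonneg ((u2 * r1 - u1 * r2) - (p2 * b1 - p1 * b2)), sq_nonneg (u2 * r2 + u1 * r1), sq_nonneg (p2 * b2 + p1 * b1)]
  have k0 := key (s.u1 x) (s.u2 x) (s.b1 x) (s.b2 x) (pd 0 s.u1 x) (pd 0 s.u2 x) (pd 0 s.b1 x) (pd 0 s.b2 x)
  have k1 := key (s.u1 x) (s.u2 x) (s.b1 x) (s.b2 x) (pd 1 s.u1 x) (pd 1 s.u2 x) (pd 1 s.b1 x) (pd 1 s.b2 x)
  unfold Fld.gu Fld.gb Fld.U2 Fld.B2 gs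
  rw [e, e]
  linarith

/-- everything quadratic is controlled by `R` -/
lemma Dom.Rctl (h : Dom Ω φ) (μ ν Rm Pm : ℝ) : ∃ C > 0, ∀ L s, Stat Ω φ μ ν Rm Pm L s →
    (II Ω fun x => s.U2 x * s.gu x) ≤ C * s.R Ω φ L ∧ II Ω (gs s.q) ≤ C * s.R Ω φ L ∧
    (II Ω fun x => s.j x ^ 2 * s.U2 x) ≤ s.R Ω φ L ∧ (II Ω fun x => s.j x ^ 2 * s.B2 x) ≤ s.R Ω φ L := by
  obtain ⟨C1, hC1, H1⟩ := h.gradB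
  set a := 3 + 2 * (Pm / μ) ^ 2 with ha
  have ha0 : 0 < a := by positivity
  refine ⟨2 * (3 * a + 4 * C1) + 2 * C1 + a, by positivity, fun L s hs => ?_⟩
  have cD := hs.sD.cont
  have cw := hs.sw.cont
  have cj := hs.sj.cont
  have cU := hs.cU2
  have cB := hs.cB2
  have cgu := hs.cgu
  have cgb := hs.cgb
  have cZ := hs.cZ
  have R0 := hs.R0
  have t1 : (II Ω fun x => s.U2 x * (s.D x ^ 2 + s.w x ^ 2)) ≤ a * s.R Ω φ L := by
    refine h.le1 (by fun_prop) (by fun_prop) a fun x hx => ?_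
    have k := hs.DZ x hx
    have u0 := s.U20 x
    have b0 := s.B20 x
    have z0 := zero_le_one.trans (s.Z_ge φ L x).2.2.2.1
    have k2 := mul_le_mul_of_nonneg_left k u0
    have : 0 ≤ s.B2 x * (a * s.Z φ L x) := by positivity
    linarith
  have t2 : (II Ω fun x => s.B2 x * (s.D x ^ 2 + s.w x ^ 2)) ≤ a * s.R Ω φ L := by
    refine h.le1 (by fun_prop) (by fun_prop) a fun x hx => ?_
    have k := hs.DZ x hx
    have u0 := s.U20 x
    have b0 := s.B20 x
    have z0 := zero_le_one.trans (s.Z_ge φ L x).2.2.2.1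
    have k2 := mul_le_mul_of_nonneg_left k b0
    have : 0 ≤ s.U2 x * (a * s.Z φ L x) := by positivity
    linarith
  have t3 : (II Ω fun x => s.U2 x * s.gb x) ≤ C1 * s.R Ω φ L := by
    refine h.le1 (by fun_prop) (by fun_prop) C1 fun x hx => ?_
    have k : s.gb x ≤ C1 * s.Z φ L x := (H1 s.b1 s.b2 hs.sb1 hs.sb2 hs.db x hx).trans
      (mul_le_mul_of_nonneg_left (s.Z_ge φ L x).2.2.2.2.1 hC1.le)
    have u0 := s.U20 x
    have b0 := s.B20 x
    have z0 := zero_le_one.trans (s.Z_ge φ L x).2.2.2.1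
    have k2 := mul_le_mul_of_nonneg_left k u0
    have : 0 ≤ s.B2 x * (C1 * s.Z φ L x) := by positivity
    linarith
  have t4 : (II Ω fun x => s.U2 x * s.gu x) ≤ (II Ω fun x => s.U2 x * (s.D x ^ 2 + s.w x ^ 2)) := h.csq hs.su1 hs.su2 hs.tu
  have t5 : (II Ω fun x => s.B2 x * s.gu x) ≤ 3 * (II Ω fun x => s.B2 x * (s.D x ^ 2 + s.w x ^ 2)) + 4 * II Ω fun x => s.U2 x * s.gb x :=
    h.cprod hs.su1 hs.su2 hs.sb1 hs.sb2 hs.tu hs.tb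
  have t6 : II Ω (gs s.q) ≤ 2 * (II Ω fun x => s.B2 x * s.gu x) + 2 * (II Ω fun x => s.U2 x * s.gb x) :=
    h.le2 hs.sq.c1.cgs (by fun_prop) (by fun_prop) 2 2 fun x _ => hs.gq_pt x
  have aR : 0 ≤ a * s.R Ω φ L := by positivity
  have cR : 0 ≤ C1 * s.R Ω φ L := by positivity
  refine ⟨by linarith, by linarith, ?_, ?_⟩
  · refine h.mono (by fun_prop) (by fun_prop) fun x hx => ?_
    have u0 := s.U20 x
    have b0 := s.B20 x
    have z := (s.Z_ge φ L x).2.1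
    have z0 := zero_le_one.trans (s.Z_ge φ L x).2.2.2.1
    have k2 := mul_le_mul_of_nonneg_left z u0
    have : 0 ≤ s.B2 x * (s.Z φ L x) := by positivity
    linarith
  · refine h.mono (by fun_prop) (by fun_prop) fun x hx => ?_
    have u0 := s.U20 x
    have b0 := s.B20 x
    have z := (s.Z_ge φ L x).2.1
    have z0 := zero_le_one.trans (s.Z_ge φ L x).2.2.2.1
    have k2 := mul_le_mul_of_nonneg_left z b0
    have : 0 ≤ s.U2 x * (s.Z φ L x) := by positivity
    linarith

/-- (S1) -/
lemma Snap.S1 (h : Snap Ω φ γ μ ν Rm Pm L s) : II Ω (gs (s.F L)) + μ ^ 2 * II Ω (gs s.w) ≤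
    2 * Rm * s.X Ω + 2 * II Ω (fun x => s.j x ^ 2 * s.B2 x) := by
  have c1 := h.sF.cpd 0
  have c2 := h.sF.cpd 1
  have c3 := h.sw.cpd 0
  have c4 := h.sw.cpd 1
  have cgF := h.sF.cgs
  have cgw := h.sw.c1.cgs
  have cr := h.sr.cont
  have cj := h.sj.cont
  have cB := h.cB2
  have b1 := h.su1.cont
  have b2 := h.su2.cont
  have b3 := h.sut1.cont
  have b4 := h.sut2.cont
  have p1 := h.su1.cpd 0
  have p2 := h.su1.cpd 1
  have p3 := h.su2.cpd 0
  have p4 := h.su2.cpd 1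
  have z : (II Ω fun x => pd 1 s.w x * pd 0 (s.F L) x + - pd 0 s.w x * pd 1 (s.F L) x) = 0 := by
    have := h.dom.ibp' (w1 := pd 1 s.w) (w2 := fun x => - pd 0 s.w x) h.sF (h.sw.pd 1).c1 (h.sw.pd 0).neg.c1 (fun x hx => by
      have := h.dom.td_zero h.sw.c1 h.w0 x hx
      unfold td at this
      linear_combination (s.F L x) * this)
    simp only [pd_neg, pd_comm h.sw 0 1] at this
    have e : (II Ω fun x => s.F L x * (pd 1 (pd 0 s.w) x + -pd 1 (pd 0 s.w) x)) = 0 := by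
      simp [II]
    rw [e] at this
    linarith
  have key := h.dom.le2 (e := fun x => gs (s.F L) x + μ ^ 2 * gs s.w x - 2 * μ * (pd 1 s.w x * pd 0 (s.F L) x + - pd 0 s.w x * pd 1 (s.F L) x))
    (f := fun x => s.r x * (s.v1 x ^ 2 + s.v2 x ^ 2)) (g := fun x => s.j x ^ 2 * s.B2 x) (by fun_prop)
    (by unfold Fld.v1 Fld.v2; fun_prop) (by fun_prop) (2 * Rm) 2 (fun x hx => by
      have m1 := h.mom1 x hx
      have m2 := h.mom2 x hx
      have r0 := h.r0 x hx
      have r1 := h.r1 x hx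
      have q1 : (s.r x * s.v1 x + s.j x * s.b2 x) ^ 2 + (s.r x * s.v2 x - s.j x * s.b1 x) ^ 2 ≤
         2 * ((s.r x * s.v1 x) ^ 2 + (s.r x * s.v2 x) ^ 2) + 2 * (s.j x ^ 2 * s.B2 x) := by
        unfold Fld.B2
        nlinarith [sq_nonneg (s.r x * s.v1 x - s.j x * s.b2 x), sq_nonneg (s.r x * s.v2 x + s.j x * s.b1 x)]
      have q2 : (s.r x * s.v1 x) ^ 2 + (s.r x * s.v2 x) ^ 2 ≤ Rm * (s.r x * (s.v1 x ^ 2 + s.v2 x ^ 2)) := by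
        have : s.r x * (s.r x * (s.v1 x ^ 2 + s.v2 x ^ 2)) ≤ Rm * (s.r x * (s.v1 x ^ 2 + s.v2 x ^ 2)) := by gcongr
        linarith
      have q3 : gs (s.F L) x + μ ^ 2 * gs s.w x - 2 * μ * (pd 1 s.w x * pd 0 (s.F L) x + - pd 0 s.w x * pd 1 (s.F L) x) =
        (s.r x * s.v1 x + s.j x * s.b2 x) ^ 2 + (s.r x * s.v2 x - s.j x * s.b1 x) ^ 2 := by
        rw [m1, m2]; unfold gs; ring
      rw [q3]; linarith)
  rw [h.dom.isub (by fun_prop) (by fun_prop), h.dom.iadd (by fun_prop) (by fun_prop), h.dom.lin1, h.dom.lin1, z] at key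
  unfold Fld.X
  linarith

/-- (S2) -/
lemma Snap.S2 (h : Snap Ω φ γ μ ν Rm Pm L s) : ν ^ 2 * II Ω (gs s.j) ≤ 2 * s.Y Ω + 2 * II Ω (gs s.q) := by
  have cj := h.sj.c1.cgs
  have c7 := h.sc1.cont
  have c8 := h.sc2.cont
  have key := h.dom.le2 (e := fun x => ν ^ 2 * gs s.j x) (f := fun x => s.c1 x ^ 2 + s.c2 x ^ 2) (g := gs s.q) (by fun_prop) (by fun_prop)
    h.sq.c1.cgs 2 2 (fun x hx => by
      have m1 := h.mag1 x hx
      have m2 := h.mag2 x hx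
      rw [m1, m2]
      unfold gs
      nlinarith [sq_nonneg (ν * pd 0 s.j x + 2 * pd 0 s.q x), sq_nonneg (ν * pd 1 s.j x + 2 * pd 1 s.q x)])
  rw [h.dom.lin1] at key
  exact key

end
end

section
variable {Ω : Set V2} {φ : V2 → ℝ}

/-- additive form of the logarithmic inequality -/
def LGP (Ω : Set V2) (C l ε : ℝ) (f Z : V2 → ℝ) (G : ℝ) : Prop :=
  Continuous Z ∧ (II Ω fun x => f x ^ 2 * Z x) ≤ C * N1 Ω f * ((1 + l) * II Ω Z + ε * (II Ω Z + G))

lemma Dom.LGP_add (h : Dom Ω φ) {C l ε : ℝ} {f Z Z' : V2 → ℝ} {G G' : ℝ} (hf : Continuous f) (h1 : LGP Ω C l ε f Z G) (h2 : LGP Ω C l ε f Z' G') :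
    LGP Ω C l ε f (fun x => Z x + Z' x) (G + G') := by
  obtain ⟨c1, k1⟩ := h1
  obtain ⟨c2, k2⟩ := h2
  refine ⟨c1.add c2, ?_⟩
  have e : (fun x => f x ^ 2 * (Z x + Z' x)) = fun x => f x ^ 2 * Z x + f x ^ 2 * Z' x := by ext x; ring
  rw [e, h.iadd (by fun_prop) (by fun_prop), h.iadd c1 c2]
  linarith

lemma gs_const (c : ℝ) (x : V2) : gs (fun _ => c) x = 0 := by unfold gs; simp [pd_const]

lemma gs_div {f : V2 → ℝ} (hf : C1 f) (L : ℝ) (x : V2) : gs (fun y => f y / L) x = gs f x / L ^ 2 := by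
  have : (fun y => f y / L) = fun y => L⁻¹ * f y := by ext y; ring
  unfold gs
  rw [this, pd_const_mul 0 _ (hf.d x), pd_const_mul 1 _ (hf.d x)]
  by_cases hL : L = 0
  · subst hL; simp
  · field_simp

section
variable {γ μ ν Rm Pm L : ℝ} {s : Fld}

/-- sum of the gradient energies -/
def Fld.G (s : Fld) (Ω : Set V2) (φ : V2 → ℝ) (L : ℝ) : ℝ :=
  II Ω (gs s.w) + II Ω (gs s.j) + II Ω (gs (s.F L)) / L ^ 2
  + (II Ω (gs (pd 0 (al φ s.b1 s.b2))) + II Ω (gs (pd 1 (al φ s.b1 s.b2))))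
  + (II Ω (gs (pd 0 (ze φ s.b1))) + II Ω (gs (pd 1 (ze φ s.b1))))
  + (II Ω (gs (pd 0 (ze φ s.b2))) + II Ω (gs (pd 1 (ze φ s.b2)))) + II Ω (gs s.b1) + II Ω (gs s.b2) + 0

lemma Dom.Rlog (h : Dom Ω φ) (μ ν Rm Pm : ℝ) : ∃ C > 0, ∀ L s, Stat Ω φ μ ν Rm Pm L s → ∀ ε, 0 < ε → ε ≤ 1 →
    s.R Ω φ L ≤ C * (N1 Ω s.u1 + N1 Ω s.u2 + (N1 Ω s.b1 + N1 Ω s.b2)) *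
      ((1 + log (1 / ε)) * II Ω (s.Z φ L) + ε * (II Ω (s.Z φ L) + s.G Ω φ L)) := by
  obtain ⟨C, hC, H⟩ := h.LOG
  refine ⟨C, hC, fun L s hs ε e0 e1 => ?_⟩
  have base : ∀ f Q, C1 f → C1 Q → LGP Ω C (log (1 / ε)) ε f (fun x => Q x ^ 2) (II Ω (gs Q)) := fun f Q hf hQ =>
    ⟨(hQ.pow 2).cont, H f Q hf hQ ε e0 e1⟩
  have base2 : ∀ f g, C1 f → Sm g → LGP Ω C (log (1 / ε)) ε f (gs g) (II Ω (gs (pd 0 g)) + II Ω (gs (pd 1 g))) := fun f g hf hg =>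
    h.LGP_add hf.cont (base f (pd 0 g) hf (hg.pd 0).c1) (base f (pd 1 g) hf (hg.pd 1).c1)
  have all : ∀ f, C1 f → LGP Ω C (log (1 / ε)) ε f (s.Z φ L) (s.G Ω φ L) := by
    intro f hf
    have cf := hf.cont
    have b1 := base f s.w hf hs.sw.c1
    have b2 := base f s.j hf hs.sj.c1
    have sFL : C1 (fun x => s.F L x / L) := ContDiff.div_const hs.sF L
    have b3 := base f (fun x => s.F L x / L) hf sFL
    have e3 : II Ω (gs (fun x => s.F L x / L)) = II Ω (gs (s.F L)) / L ^ 2 := by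
      rw [h.congr (g := fun x => (L ^ 2)⁻¹ * gs (s.F L) x) (fun x _ => by rw [gs_div hs.sF]; ring), h.lin1]; ring
    rw [e3] at b3
    have b4 := base2 f _ hf (h.al_sm hs.sb1 hs.sb2)
    have b5 := base2 f _ hf (h.ze_sm hs.sb1)
    have b6 := base2 f _ hf (h.ze_sm hs.sb2)
    have b7 := base f s.b1 hf hs.sb1.c1
    have b8 := base f s.b2 hf hs.sb2.c1
    have b9 := base f (fun _ => 1) hf contDiff_const
    have e9 : II Ω (gs (fun _ => (1:ℝ))) = 0 := by
      rw [h.congr (g := fun _ => 0) (fun x _ => gs_const 1 x)]; simp [II]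
    rw [e9] at b9
    simp only [one_pow] at b9
    exact h.LGP_add cf (h.LGP_add cf (h.LGP_add cf (h.LGP_add cf (h.LGP_add cf (h.LGP_add cf (h.LGP_add cf (h.LGP_add cf b1 b2) b3) b4) b5) b6) b7) b8) b9
  have k1 := (all s.u1 hs.su1.c1).2
  have k2 := (all s.u2 hs.su2.c1).2
  have k3 := (all s.b1 hs.sb1.c1).2
  have k4 := (all s.b2 hs.sb2.c1).2
  have cZ := hs.cZ
  have c1 := hs.su1.cont
  have c2 := hs.su2.cont
  have c3 := hs.sb1.cont
  have c4 := hs.sb2.cont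
  have e : s.R Ω φ L = (II Ω fun x => s.u1 x ^ 2 * s.Z φ L x) + (II Ω fun x => s.u2 x ^ 2 * s.Z φ L x) +
      (II Ω fun x => s.b1 x ^ 2 * s.Z φ L x) + II Ω fun x => s.b2 x ^ 2 * s.Z φ L x := by
    rw [← h.iadd (by fun_prop) (by fun_prop), ← h.iadd (by fun_prop) (by fun_prop), ← h.iadd (by fun_prop) (by fun_prop)]
    refine h.congr fun x _ => ?_
    unfold Fld.U2 Fld.B2; ring
  rw [e]
  linarith

set_option maxHeartbeats 1000000 in
lemma Dom.basicA (h : Dom Ω φ) (μ ν Rm Pm : ℝ) (hμ : 0 < μ) (hν : 0 < ν) : ∃ C > 0, ∀ L s, Stat Ω φ μ ν Rm Pm L s →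
    N1 Ω s.u1 + N1 Ω s.u2 + (N1 Ω s.b1 + N1 Ω s.b2) ≤ C * s.A Ω μ ν L ∧ 
    II Ω (s.Z φ L) ≤ C * (1 + s.A Ω μ ν L) ∧
    s.G Ω φ L ≤ C * (s.A Ω μ ν L + II Ω (gs s.w) + II Ω (gs s.j) + II Ω (gs (s.F L))) := by
  obtain ⟨C1, hC1, H1⟩ := h.N1_tan
  obtain ⟨C2, hC2, H2⟩ := h.hessAll
  set K := C1 * (2 / μ) + C1 * (1 / ν) with hK
  have hK0 : 0 < K := by positivity
  have hv := h.vol_pos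
  set C := K + (1 / μ + 1 / ν + 2 / μ + 3 * C2 * K + K + 2 * (Pm / μ) ^ 2 * vol Ω + vol Ω) + (3 * C2 * K + K + 1 + 3 * C2 + 1 / μ ^ 2) with hC
  have hC0 : 0 < C := by positivity
  refine ⟨C, hC0, fun L s hs => ?_⟩
  have hA := hs.A0
  have iw : s.w2 Ω ≤ (1 / μ) * s.A Ω μ ν L := by
    have := hs.w2A; rw [div_mul_eq_mul_div, le_div_iff₀ hμ]; linarith
  have id : s.d2 Ω ≤ (1 / μ) * s.A Ω μ ν L := by
    have := hs.d2A; rw [div_mul_eq_mul_div, le_div_iff₀ hμ]; linarith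
  have ij : s.j2 Ω ≤ (1 / ν) * s.A Ω μ ν L := by
    have := hs.j2A; rw [div_mul_eq_mul_div, le_div_iff₀ hν]; linarith
  have n1 : N1 Ω s.u1 + N1 Ω s.u2 ≤ C1 * (s.d2 Ω + s.w2 Ω) := H1 s.u1 s.u2 hs.su1 hs.su2 hs.tu
  have n2 : N1 Ω s.b1 + N1 Ω s.b2 ≤ C1 * s.j2 Ω := by
    have := H1 s.b1 s.b2 hs.sb1 hs.sb2 hs.tb
    have e : (II Ω fun x => dv s.b1 s.b2 x ^ 2) = 0 := by
      rw [h.congr (g := fun _ => 0) (fun x hx => by rw [hs.db x hx]; ring)]; simp [II]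
    rw [e, zero_add] at this
    exact this
  have n3 : N1 Ω s.u1 + N1 Ω s.u2 + (N1 Ω s.b1 + N1 Ω s.b2) ≤ K * s.A Ω μ ν L := by
    have m1 : C1 * (s.d2 Ω + s.w2 Ω) ≤ C1 * ((1 / μ) * s.A Ω μ ν L + (1 / μ) * s.A Ω μ ν L) := by gcongr
    have m2 : C1 * s.j2 Ω ≤ C1 * ((1 / ν) * s.A Ω μ ν L) := by gcongr
    have : K * s.A Ω μ ν L = C1 * ((1 / μ) * s.A Ω μ ν L + (1 / μ) * s.A Ω μ ν L) + C1 * ((1 / ν) * s.A Ω μ ν L) := by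
      rw [hK]; ring
    linarith
  have p1 := h.N1_nonneg s.u1
  have p2 := h.N1_nonneg s.u2
  have p3 := h.N1_nonneg s.b1
  have p4 := h.N1_nonneg s.b2
  have n4 : N1 Ω s.b1 + N1 Ω s.b2 ≤ K * s.A Ω μ ν L := by linarith
  obtain ⟨q1, q2, q3⟩ := H2 s.b1 s.b2 hs.sb1 hs.sb2 hs.tb hs.db
  have gj0 : 0 ≤ II Ω (gs s.j) := h.nn fun _ _ => gs_nonneg _ _
  have gw0 : 0 ≤ II Ω (gs s.w) := h.nn fun _ _ => gs_nonneg _ _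
  have gF0 : 0 ≤ II Ω (gs (s.F L)) := h.nn fun _ _ => gs_nonneg _ _
  have n5 : C2 * (N1 Ω s.b1 + N1 Ω s.b2) ≤ C2 * (K * s.A Ω μ ν L) := by gcongr
  have KA : 0 ≤ K * s.A Ω μ ν L := by positivity
  have CKA : 0 ≤ C2 * (K * s.A Ω μ ν L) := by positivity
  have mA : 0 ≤ (1 / μ) * s.A Ω μ ν L := by positivity
  have nA : 0 ≤ (1 / ν) * s.A Ω μ ν L := by positivity
  have PV : 0 ≤ (Pm / μ) ^ 2 * vol Ω := by positivity
  have PVA : 0 ≤ ((Pm / μ) ^ 2 * vol Ω) * s.A Ω μ ν L := by positivity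
  have VA : 0 ≤ vol Ω * s.A Ω μ ν L := by positivity
  refine ⟨?_, ?_, ?_⟩
  · refine n3.trans ?_
    gcongr
    rw [hC]
    have : 0 ≤ (1 / μ + 1 / ν + 2 / μ + 3 * C2 * K + K + 2 * (Pm / μ) ^ 2 * vol Ω + vol Ω) + (3 * C2 * K + K + 1 + 3 * C2 + 1 / μ ^ 2) := by positivity
    linarith
  · have cw := hs.sw.cont
    have cj := hs.sj.cont
    have cF := hs.sF.cont
    have cal := (h.al_sm hs.sb1 hs.sb2).c1.cgs
    have cz1 := (h.ze_sm hs.sb1).c1.cgs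
    have cz2 := (h.ze_sm hs.sb2).c1.cgs
    have cb1 := hs.sb1.cont
    have cb2 := hs.sb2.cont
    have cD := hs.sD.cont
    have cP := hs.sP.cont
    have eZ : II Ω (s.Z φ L) = s.w2 Ω + s.j2 Ω + II Ω (fun x => (s.F L x / L) ^ 2) + II Ω (gs (al φ s.b1 s.b2))
        + II Ω (gs (ze φ s.b1)) + II Ω (gs (ze φ s.b2)) + II Ω (fun x => s.b1 x ^ 2) + II Ω (fun x => s.b2 x ^ 2) + II Ω (fun _ => 1) := by
      unfold Fld.w2 Fld.j2
      rw [← h.iadd (by fun_prop) (by fun_prop), ← h.iadd (by fun_prop) (by fun_prop), ← h.iadd (by fun_prop) (by fun_prop),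
        ← h.iadd (by fun_prop) (by fun_prop), ← h.iadd (by fun_prop) (by fun_prop), ← h.iadd (by fun_prop) (by fun_prop),
        ← h.iadd (by fun_prop) (by fun_prop), ← h.iadd (by fun_prop) (by fun_prop)]
      rfl
    have e1 : II Ω (fun _ => (1:ℝ)) = vol Ω := rfl
    have eF : II Ω (fun x => (s.F L x / L) ^ 2) ≤ 2 * s.d2 Ω + 2 * (Pm / μ) ^ 2 * vol Ω := by
      rw [← e1]
      refine h.le2 (by fun_prop) (by fun_prop) (by fun_prop) _ _ fun x hx => ?_
      have hL := hs.L0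
      have e : s.F L x / L = s.D x - s.P x / L := by unfold Fld.F; field_simp
      have hp : (s.P x / L) ^ 2 ≤ (Pm / μ) ^ 2 := by
        have := hs.P0 x hx; have := hs.P1 x hx; have := hs.hL; have := hs.hPm
        gcongr
      rw [e]
      nlinarith [sq_nonneg (s.D x + s.P x / L)]
    have s1 := h.sq_le_N1 s.b1
    have s2 := h.sq_le_N1 s.b2
    rw [eZ, e1]
    have b1 := q1.1
    have b2 := q2.1
    have b3 := q3.1
    have tot : s.w2 Ω + s.j2 Ω + II Ω (fun x => (s.F L x / L) ^ 2) + II Ω (gs (al φ s.b1 s.b2))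
        + II Ω (gs (ze φ s.b1)) + II Ω (gs (ze φ s.b2)) + II Ω (fun x => s.b1 x ^ 2) + II Ω (fun x => s.b2 x ^ 2) + vol Ω ≤
        (1 / μ + 1 / ν + 2 / μ + 3 * C2 * K + K + 2 * (Pm / μ) ^ 2 * vol Ω + vol Ω) * (1 + s.A Ω μ ν L) := by
      have g1 := b1.trans n5
      have g2 := b2.trans n5
      have g3 := b3.trans n5
      have x1 : 0 ≤ 1 / μ + 1 / ν + 2 / μ + 3 * C2 * K + K := by positivity
      have e : (1 / μ + 1 / ν + 2 / μ + 3 * C2 * K + K + 2 * (Pm / μ) ^ 2 * vol Ω + vol Ω) * (1 + s.A Ω μ ν L)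
        = (1 / μ + 1 / ν + 2 / μ + 3 * C2 * K + K) + (1 / μ) * s.A Ω μ ν L + (1 / ν) * s.A Ω μ ν L + 2 * ((1 / μ) * s.A Ω μ ν L)
          + 3 * (C2 * (K * s.A Ω μ ν L)) + K * s.A Ω μ ν L + 2 * ((Pm / μ) ^ 2 * vol Ω) + vol Ω + 2 * (((Pm / μ) ^ 2 * vol Ω) * s.A Ω μ ν L) + vol Ω * s.A Ω μ ν L := by ring
      rw [e]
      clear * - g1 g2 g3 x1 iw id ij eF s1 s2 n4 PVA VA mA
      rw [mul_assoc] at eF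
      linarith
    refine tot.trans ?_
    gcongr
    rw [hC]
    have : 0 ≤ (3 * C2 * K + K + 1 + 3 * C2 + 1 / μ ^ 2) := by positivity
    linarith
  · have gb1 := h.gs_le_N1 s.b1
    have gb2 := h.gs_le_N1 s.b2
    have b1 := q1.2
    have b2 := q2.2
    have b3 := q3.2
    have hgF : II Ω (gs (s.F L)) / L ^ 2 ≤ (1 / μ ^ 2) * II Ω (gs (s.F L)) := by
      rw [div_eq_inv_mul, ← one_div]
      have := hs.hL
      gcongr
    have tot : s.G Ω φ L ≤ (3 * C2 * K + K + 1 + 3 * C2 + 1 / μ ^ 2) * (s.A Ω μ ν L + II Ω (gs s.w) + II Ω (gs s.j) + II Ω (gs (s.F L))) := by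
      unfold Fld.G
      have ej : cl s.b1 s.b2 = s.j := rfl
      rw [ej] at b1 b2 b3
      set gw := II Ω (gs s.w)
      set gj := II Ω (gs s.j)
      set gF := II Ω (gs (s.F L))
      have x1 : 0 ≤ (3 * C2 * K + K) * (gw + gj + gF) := by positivity
      have x2 : 0 ≤ (1 + 3 * C2 + 1 / μ ^ 2) * s.A Ω μ ν L := by positivity
      have x3 : 0 ≤ gF + (3 * C2) * (gw + gF) + (1 / μ ^ 2) * (gw + gj) := by positivity
      linarith
    refine tot.trans ?_
    gcongr
    rw [hC]
    have : 0 ≤ K + (1 / μ + 1 / ν + 2 / μ + 3 * C2 * K + K + 2 * (Pm / μ) ^ 2 * vol Ω + vol Ω) := by positivity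
    linarith

end
end

section
variable {Ω : Set V2} {φ : V2 → ℝ}

/-- the nonlinear function -/
def Th (A : ℝ) : ℝ := A * (1 + A) * (1 + log (1 + A))

lemma Th_nonneg {A : ℝ} (h : 0 ≤ A) : 0 ≤ Th A := by
  have : 0 ≤ log (1 + A) := log_nonneg (by linarith)
  unfold Th; positivity

lemma le_Th {A : ℝ} (h : 0 ≤ A) : A ≤ Th A := by
  have : 0 ≤ log (1 + A) := log_nonneg (by linarith)
  unfold Th
  have h1 : 1 ≤ (1 + A) * (1 + log (1 + A)) := by nlinarith [mul_nonneg h this]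
  rw [mul_assoc]
  nlinarith

set_option maxHeartbeats 1000000 in
lemma arithR {C0 C K : ℝ} (hC0 : 0 < C0) (hC : 0 < C) (hK : 0 < K) : ∃ c > 0, ∀ A N Zi G g R W : ℝ,
    0 ≤ A → 0 ≤ N → 0 ≤ Zi → 0 ≤ R → 0 ≤ W → N ≤ C * A → Zi ≤ C * (1 + A) → G ≤ C * (A + g) → g ≤ K * (W + R) → 
    (∀ ε, 0 < ε → ε ≤ 1 → R ≤ C0 * N * ((1 + log (1 / ε)) * Zi + ε * (Zi + G))) →
    ∀ η, 0 < η → η ≤ 1 → R ≤ η * W + c / η * Th A := by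
  set k := C0 * C ^ 2 with hk
  have k0 : 0 < k := by positivity
  clear_value k
  set m := 2 * k * K + 1 with hm
  clear_value m
  have m1 : 1 ≤ m := by have : 0 < 2 * k * K := by positivity
                        linarith
  have m0 : 0 < m := by linarith
  refine ⟨2 * k * (4 + m), by positivity, fun A N Zi G g R W hA hN hZ hR hW h1 h2 h3 h4 H η η0 η1 => ?_⟩
  have A1 : 0 < 1 + A := by linarith
  set ε := η / (m * (1 + A)) with hε
  have ε0 : 0 < ε := by positivity
  have ε1 : ε ≤ 1 := by
    rw [hε, div_le_one (by positivity)]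
    nlinarith [mul_nonneg m0.le hA]
  clear_value ε
  set l := log (1 / ε) with hl
  clear_value l
  have l0 : 0 ≤ l := by rw [hl]; exact log_nonneg (by rw [le_div_iff₀ ε0]; linarith)
  have LA : 0 ≤ log (1 + A) := log_nonneg (by linarith)
  have el : l = log m + log (1 + A) + log (1 / η) := by
    rw [hl, hε, one_div_div, div_eq_mul_one_div, log_mul (by positivity) (by positivity), log_mul (by positivity) (by positivity)]
  have lm : log m ≤ m := (log_le_sub_one_of_pos m0).trans (by linarith)
  have lη : log (1 / η) ≤ 1 / η := (log_le_sub_one_of_pos (by positivity)).trans (by linarith)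
  have oη : 1 ≤ 1 / η := by rw [le_div_iff₀ η0]; linarith
  have l3 : 3 + l ≤ (4 + m) * (1 / η) * (1 + log (1 + A)) := by
    have a1 : 3 + m ≤ (3 + m) * (1 / η) := by nlinarith
    have a2 : log (1 + A) ≤ (1 / η) * log (1 + A) := by nlinarith
    have a3 : 0 ≤ (3 + m) * (1 / η) * log (1 + A) := by positivity
    have : (4 + m) * (1 / η) * (1 + log (1 + A)) = (3 + m) * (1 / η) + 1 / η + (1 / η) * log (1 + A) + (3 + m) * (1 / η) * log (1 + A) := by ring
    rw [this, el]
    linarith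
  have b1 := H ε ε0 ε1
  rw [← hl] at b1
  have b2 : (1 + l) * Zi + ε * (Zi + G) ≤ C * ((3 + l) * (1 + A) + ε * (K * (W + R))) := by
    have c1 : (1 + l) * Zi ≤ (1 + l) * (C * (1 + A)) := by gcongr
    have c2 : ε * (Zi + G) ≤ ε * (C * (1 + A) + C * (A + K * (W + R))) := by
      gcongr
      exact h3.trans (by gcongr)
    have c3 : ε * (C * (1 + A)) ≤ 1 * (C * (1 + A)) := by gcongr
    have c4 : ε * (C * A) ≤ 1 * (C * A) := by gcongr
    nlinarith
  have b3 : R ≤ C0 * (C * A) * (C * ((3 + l) * (1 + A) + ε * (K * (W + R)))) := by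
    refine b1.trans ?_
    have : C0 * N * ((1 + l) * Zi + ε * (Zi + G)) ≤ C0 * N * (C * ((3 + l) * (1 + A) + ε * (K * (W + R)))) := by gcongr
    refine this.trans ?_
    gcongr
  have b4 : k * K * ε * A ≤ η / 2 := by
    have : ε * A ≤ η / m := by
      rw [hε, div_mul_eq_mul_div, div_le_div_iff₀ (by positivity) m0]
      have : 0 ≤ η * m := by positivity
      nlinarith
    have h5 : k * K * (η / m) ≤ η / 2 := by
      rw [mul_div_assoc', div_le_iff₀ m0, hm]
      nlinarith
    calc k * K * ε * A = k * K * (ε * A) := by ring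
      _ ≤ k * K * (η / m) := by gcongr
      _ ≤ _ := h5
  have b5 : R ≤ k * (A * (1 + A)) * (3 + l) + (η / 2) * (W + R) := by
    have : (k * K * ε * A) * (W + R) ≤ (η / 2) * (W + R) := by gcongr
    refine b3.trans ?_
    have e : C0 * (C * A) * (C * ((3 + l) * (1 + A) + ε * (K * (W + R)))) = k * (A * (1 + A)) * (3 + l) + (k * K * ε * A) * (W + R) := by rw [hk]; ring
    rw [e]; linarith
  have b6 : (η / 2) * R ≤ (1 / 2) * R := by gcongr
  have b7 : k * (A * (1 + A)) * (3 + l) ≤ k * (A * (1 + A)) * ((4 + m) * (1 / η) * (1 + log (1 + A))) := by gcongr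
  have e : 2 * k * (4 + m) / η * Th A = 2 * (k * (A * (1 + A)) * ((4 + m) * (1 / η) * (1 + log (1 + A)))) := by unfold Th; ring
  rw [e]
  linarith

section
variable {γ μ ν Rm Pm L : ℝ} {s : Fld}

lemma Snap.X0 (h : Snap Ω φ γ μ ν Rm Pm L s) : 0 ≤ s.X Ω := h.dom.nn fun x hx => by
  have := h.r0 x hx; positivity
lemma Snap.Y0 (h : Snap Ω φ γ μ ν Rm Pm L s) : 0 ≤ s.Y Ω := h.dom.nn fun x hx => by positivity

lemma Dom.S5 (h : Dom Ω φ) {μ ν Rm Pm : ℝ} (hμ : 0 < μ) (hν : 0 < ν) (hRm : 0 < Rm) : ∃ c > 0, ∀ γ L s, Snap Ω φ γ μ ν Rm Pm L s →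
    (∀ η, 0 < η → η ≤ 1 → s.R Ω φ L ≤ η * (s.X Ω + s.Y Ω) + c / η * Th (s.A Ω μ ν L)) ∧
    II Ω (gs s.j) ≤ c * (s.X Ω + s.Y Ω + Th (s.A Ω μ ν L)) := by
  obtain ⟨C1, hC1, H1⟩ := h.Rctl μ ν Rm Pm
  obtain ⟨C2, hC2, H2⟩ := h.Rlog μ ν Rm Pm
  obtain ⟨C3, hC3, H3⟩ := h.basicA μ ν Rm Pm hμ hν
  set K := (1 + 1 / μ ^ 2) * (2 * Rm + 2) + (1 / ν ^ 2) * (2 + 2 * C1) with hK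
  have hK0 : 0 < K := by positivity
  obtain ⟨c, hc, Hc⟩ := arithR hC2 hC3 hK0
  have key : ∀ γ L s, Snap Ω φ γ μ ν Rm Pm L s →
      II Ω (gs s.w) + II Ω (gs s.j) + II Ω (gs (s.F L)) ≤ K * (s.X Ω + s.Y Ω + s.R Ω φ L) := by
    intro γ L s hs
    obtain ⟨r1, r2, r3, r4⟩ := H1 L s hs.toStat
    have x1 := hs.S1
    have x2 := hs.S2
    have X0 := hs.X0
    have Y0 := hs.Y0
    have R0 := hs.toStat.R0
    have gw0 : 0 ≤ II Ω (gs s.w) := h.nn fun _ _ => gs_nonneg _ _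
    have gF0 : 0 ≤ II Ω (gs (s.F L)) := h.nn fun _ _ => gs_nonneg _ _
    set X := s.X Ω
    set Y := s.Y Ω
    set R := s.R Ω φ L
    have m0 : 0 < μ ^ 2 := by positivity
    have n0 : 0 < ν ^ 2 := by positivity
    have y1 : II Ω (gs s.w) ≤ (1 / μ ^ 2) * (2 * Rm * X + 2 * R) := by
      rw [div_mul_eq_mul_div, le_div_iff₀ m0]; linarith
    have y2 : II Ω (gs (s.F L)) ≤ 2 * Rm * X + 2 * R := by
      have : 0 ≤ μ ^ 2 * II Ω (gs s.w) := by positivity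
      linarith
    have y3 : II Ω (gs s.j) ≤ (1 / ν ^ 2) * (2 * Y + 2 * (C1 * R)) := by
      rw [div_mul_eq_mul_div, le_div_iff₀ n0]; linarith
    have z1 : 2 * Rm * X + 2 * R ≤ (2 * Rm + 2) * (X + Y + R) := by
      have : 0 ≤ 2 * Rm * (Y + R) + 2 * (X + Y) := by positivity
      linarith
    have z2 : 2 * Y + 2 * (C1 * R) ≤ (2 + 2 * C1) * (X + Y + R) := by
      have : 0 ≤ 2 * C1 * (X + Y) + 2 * (X + R) := by positivity
      linarith
    have z3 : (1 / μ ^ 2) * (2 * Rm * X + 2 * R) ≤ (1 / μ ^ 2) * ((2 * Rm + 2) * (X + Y + R)) := by gcongr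
    have z4 : (1 / ν ^ 2) * (2 * Y + 2 * (C1 * R)) ≤ (1 / ν ^ 2) * ((2 + 2 * C1) * (X + Y + R)) := by gcongr
    rw [hK]
    linarith
  have A : ∀ γ L s, Snap Ω φ γ μ ν Rm Pm L s → ∀ η, 0 < η → η ≤ 1 → s.R Ω φ L ≤ η * (s.X Ω + s.Y Ω) + c / η * Th (s.A Ω μ ν L) := by
    intro γ L s hs
    obtain ⟨a1, a2, a3⟩ := H3 L s hs.toStat
    have k := key γ L s hs
    refine Hc (s.A Ω μ ν L) _ (II Ω (s.Z φ L)) (s.G Ω φ L) _ (s.R Ω φ L) (s.X Ω + s.Y Ω) hs.A0 ?_ ?_ hs.toStat.R0 (add_nonneg hs.X0 hs.Y0)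
      a1 a2 (a3.trans (le_of_eq ?_)) k (H2 L s hs.toStat)
    · have := h.N1_nonneg s.u1; have := h.N1_nonneg s.u2; have := h.N1_nonneg s.b1; have := h.N1_nonneg s.b2
      positivity
    · exact h.nn fun x _ => zero_le_one.trans (s.Z_ge φ L x).2.2.2.1
    · ring
  refine ⟨c + 2 * K * (1 + c), by positivity, fun γ L s hs => ⟨fun η e0 e1 => ?_, ?_⟩⟩
  · refine (A γ L s hs η e0 e1).trans ?_
    have := Th_nonneg hs.A0
    gcongr
    have : 0 < 2 * K * (1 + c) := by positivity
    linarith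
  · have a := A γ L s hs 1 one_pos le_rfl
    have k := key γ L s hs
    have T0 := Th_nonneg hs.A0
    have X0 := hs.X0
    have Y0 := hs.Y0
    have gw0 : 0 ≤ II Ω (gs s.w) := h.nn fun _ _ => gs_nonneg _ _
    have gF0 : 0 ≤ II Ω (gs (s.F L)) := h.nn fun _ _ => gs_nonneg _ _
    set X := s.X Ω
    set Y := s.Y Ω
    set R := s.R Ω φ L
    set T := Th (s.A Ω μ ν L)
    have : K * (X + Y + R) ≤ K * (X + Y + (1 * (X + Y) + c / 1 * T)) := by gcongr
    have p1 : 0 ≤ c * (X + Y + T) := by positivity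
    have p2 : 0 ≤ K * c * (2 * (X + Y) + T) + 2 * K * T := by positivity
    have e : (c + 2 * K * (1 + c)) * (X + Y + T) = K * (X + Y + (1 * (X + Y) + c / 1 * T)) + c * (X + Y + T) + (K * c * (2 * (X + Y) + T) + 2 * K * T) := by ring
    rw [e]; linarith

end
end

section
variable {Ω : Set V2} {φ : V2 → ℝ}

namespace Fld
variable (s : Fld)
def Dt : V2 → ℝ := dv s.ut1 s.ut2
def wt : V2 → ℝ := cl s.ut1 s.ut2
def jt : V2 → ℝ := cl s.c1 s.c2
def qt : V2 → ℝ := fun x => s.ut2 x * s.b1 x + s.u2 x * s.c1 x - (s.ut1 x * s.b2 x + s.u1 x * s.c2 x)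
/-- modified energy density -/
def eE (γ μ ν L Λ : ℝ) : V2 → ℝ := fun x => (1 / 2) * (L * s.D x ^ 2 + μ * s.w x ^ 2) - s.P x * s.D x - s.j x * s.q x
  + (1 / (L * (2 * γ - 1))) / 2 * s.P x ^ 2 + Λ * (ν / 2) * s.j x ^ 2
/-- its time derivative -/
def dE (γ μ ν L Λ : ℝ) : V2 → ℝ := fun x => L * (s.D x * s.Dt x) + μ * (s.w x * s.wt x) - (s.Pt x * s.D x + s.P x * s.Dt x)
  - (s.jt x * s.q x + s.j x * s.qt x)
  + (1 / (L * (2 * γ - 1))) * (s.P x * s.Pt x) + Λ * ν * (s.j x * s.jt x)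
end Fld

section
variable {γ μ ν Rm Pm L : ℝ} {s : Fld}

lemma Snap.presD (h : Snap Ω φ γ μ ν Rm Pm L s) :
    (II Ω fun x => s.Pt x * s.D x) = - (γ - 1) * (II Ω fun x => s.P x * s.D x ^ 2)
      + (1 / L) * (II Ω fun x => s.P x * (s.u1 x * pd 0 (s.F L) x + s.u2 x * pd 1 (s.F L) x))
      - (1 / (2 * L)) * (II Ω fun x => s.P x ^ 2 * s.D x) := by
  have L0 := h.L0
  have cP := h.sP.cont
  have cPt := h.cPt
  have cD := h.sD.cont
  have c1 := h.su1.cont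
  have c2 := h.su2.cont
  have cp0 := h.sP.cpd 0
  have cp1 := h.sP.cpd 1
  have cF := h.sF.cont
  have cf0 := h.sF.cpd 0
  have cf1 := h.sF.cpd 1
  have p2 := h.P2D
  have i1 := h.dom.ibp' h.sP (h.sF.mul h.su1.c1) (h.sF.mul h.su2.c1) (fun x hx => by
    have := h.tu x hx
    linear_combination (s.P x * s.F L x) * this)
  have e1 : (II Ω fun x => s.P x * (pd 0 (fun y => s.F L y * s.u1 y) x + pd 1 (fun y => s.F L y * s.u2 y) x)) =
      L * (II Ω fun x => s.P x * s.D x ^ 2) + (-1) * (II Ω fun x => s.P x ^ 2 * s.D x)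
        + 1 * (II Ω fun x => s.P x * (s.u1 x * pd 0 (s.F L) x + s.u2 x * pd 1 (s.F L) x)) := by
    rw [← h.dom.lin3 (by fun_prop) (by fun_prop) (by fun_prop)]
    refine h.dom.congr fun x _ => ?_
    rw [pd_mul 0 (h.sF.d x) (h.su1.d x), pd_mul 1 (h.sF.d x) (h.su2.d x)]
    have : pd 0 s.u1 x + pd 1 s.u2 x = s.D x := rfl
    have e : s.F L x = L * s.D x - s.P x := rfl
    linear_combination (s.P x * s.F L x) * this + (s.P x * s.D x) * e
  have e2 : (II Ω fun x => s.Pt x * s.D x) = (-γ) * (II Ω fun x => s.P x * s.D x ^ 2)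
      + (-(1 / L)) * (II Ω fun x => s.F L x * s.u1 x * pd 0 s.P x + s.F L x * s.u2 x * pd 1 s.P x)
      + (-(1 / L)) * (II Ω fun x => s.P x * (s.u1 x * pd 0 s.P x + s.u2 x * pd 1 s.P x)) := by
    rw [← h.dom.lin3 (by fun_prop) (by fun_prop) (by fun_prop)]
    refine h.dom.congr fun x hx => ?_
    have e : s.F L x = L * s.D x - s.P x := rfl
    have hp := h.pres x hx
    rw [e]
    field_simp
    linear_combination L * s.D x * hp
  rw [e1] at i1
  rw [e2]
  have i1' : (II Ω fun x => s.F L x * s.u1 x * pd 0 s.P x + s.F L x * s.u2 x * pd 1 s.P x) = 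
    -(L * (II Ω fun x => s.P x * s.D x ^ 2) + (-1) * (II Ω fun x => s.P x ^ 2 * s.D x)
        + 1 * (II Ω fun x => s.P x * (s.u1 x * pd 0 (s.F L) x + s.u2 x * pd 1 (s.F L) x))) := by linarith
  rw [i1']
  have p2' : (II Ω fun x => s.P x * (s.u1 x * pd 0 s.P x + s.u2 x * pd 1 s.P x)) = -(1 / 2) * II Ω fun x => s.P x ^ 2 * s.D x := by linarith
  rw [p2']
  field_simp
  ring

lemma Snap.PPt (h : Snap Ω φ γ μ ν Rm Pm L s) :
    (II Ω fun x => s.P x * s.Pt x) = ((1 - 2 * γ) / 2) * (II Ω fun x => s.P x ^ 2 * s.D x) := by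
  have cP := h.sP.cont
  have cPt := h.cPt
  have cD := h.sD.cont
  have c1 := h.su1.cont
  have c2 := h.su2.cont
  have cp0 := h.sP.cpd 0
  have cp1 := h.sP.cpd 1
  have p2 := h.P2D
  have e : (II Ω fun x => s.P x * s.Pt x) = (-1) * (II Ω fun x => s.P x * (s.u1 x * pd 0 s.P x + s.u2 x * pd 1 s.P x))
      + (-γ) * (II Ω fun x => s.P x ^ 2 * s.D x) := by
    rw [← h.dom.lin2 (by fun_prop) (by fun_prop)]
    refine h.dom.congr fun x hx => ?_
    linear_combination s.P x * h.pres x hx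
  rw [e]
  linarith

lemma Snap.dE_id (h : Snap Ω φ γ μ ν Rm Pm L s) (Λ : ℝ) :
    II Ω (s.dE γ μ ν L Λ) = - (II Ω fun x => s.r x * s.v1 x * s.ut1 x + s.r x * s.v2 x * s.ut2 x)
      - (II Ω fun x => s.j x * (s.u2 x * s.c1 x - s.u1 x * s.c2 x))
      + (II Ω fun x => s.c2 x * pd 0 s.q x - s.c1 x * pd 1 s.q x)
      - Λ * (s.Y Ω - II Ω fun x => s.c2 x * pd 0 s.q x - s.c1 x * pd 1 s.q x)
      + (γ - 1) * (II Ω fun x => s.P x * s.D x ^ 2)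
      - (1 / L) * (II Ω fun x => s.P x * (s.u1 x * pd 0 (s.F L) x + s.u2 x * pd 1 (s.F L) x)) := by
  have L0 := h.L0
  have hγ := h.hγ
  have cP := h.sP.cont
  have cPt := h.cPt
  have cD := h.sD.cont
  have cF := h.sF.cont
  have cw := h.sw.cont
  have cj := h.sj.cont
  have cq := h.sq.cont
  have cq0 := h.sq.cpd 0
  have cq1 := h.sq.cpd 1
  have c1 := h.su1.cont
  have c2 := h.su2.cont
  have c3 := h.sb1.cont
  have c4 := h.sb2.cont
  have c5 := h.sut1.cont
  have c6 := h.sut2.cont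
  have c7 := h.sc1.cont
  have c8 := h.sc2.cont
  have cDt : Continuous s.Dt := (h.sut1.dv h.sut2).cont
  have cwt : Continuous s.wt := (h.sut1.cl h.sut2).cont
  have cjt : Continuous s.jt := (h.sc1.cl h.sc2).cont
  have m := h.mom_test h.sut1 h.sut2 h.tut
  have k1 := h.dom.curl_ibp h.sq.c1 h.sc1 h.sc2 h.toStat.q0
  have k2 := h.dom.curl_ibp h.sj.c1 h.sc1 h.sc2 h.j0
  have p1 := h.presD
  have p2 := h.PPt
  have k3 : ν * (II Ω fun x => s.j x * cl s.c1 s.c2 x) = - (s.Y Ω - II Ω fun x => s.c2 x * pd 0 s.q x - s.c1 x * pd 1 s.q x) := by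
    rw [k2, Fld.Y, ← h.dom.isub (by fun_prop) (by fun_prop), mul_neg, ← h.dom.lin1]
    congr 1
    refine h.dom.congr fun x hx => ?_
    linear_combination (-s.c2 x) * h.mag2 x hx - s.c1 x * h.mag1 x hx
  have split : II Ω (s.dE γ μ ν L Λ) = 1 * (II Ω fun x => s.F L x * dv s.ut1 s.ut2 x) + μ * (II Ω fun x => s.w x * cl s.ut1 s.ut2 x)
      + (-1) * (II Ω fun x => s.Pt x * s.D x) + (-1) * (II Ω fun x => s.q x * cl s.c1 s.c2 x) + 
      (1 * (II Ω fun x => s.j x * (s.u2 x * s.c1 x - s.u1 x * s.c2 x)) * (-1) + (-1) * (II Ω fun x => s.j x * (s.b1 x * s.ut2 x - s.b2 x * s.ut1 x))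
      + (1 / (L * (2 * γ - 1))) * (II Ω fun x => s.P x * s.Pt x) + Λ * ν * (II Ω fun x => s.j x * cl s.c1 s.c2 x)) := by
    have cDt' : Continuous (dv s.ut1 s.ut2) := cDt
    have cwt' : Continuous (cl s.ut1 s.ut2) := cwt
    have cjt' : Continuous (cl s.c1 s.c2) := cjt
    have a1 := h.dom.lin4 (f := fun x => s.F L x * dv s.ut1 s.ut2 x) (g := fun x => s.w x * cl s.ut1 s.ut2 x) (k := fun x => s.Pt x * s.D x)
      (l := fun x => s.q x * cl s.c1 s.c2 x) (by fun_prop) (by fun_prop) (by fun_prop) (by fun_prop) 1 μ (-1) (-1)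
    have a2 := h.dom.lin4 (f := fun x => s.j x * (s.u2 x * s.c1 x - s.u1 x * s.c2 x)) (g := fun x => s.j x * (s.b1 x * s.ut2 x - s.b2 x * s.ut1 x))
      (k := fun x => s.P x * s.Pt x) (l := fun x => s.j x * cl s.c1 s.c2 x) (by fun_prop) (by fun_prop) (by fun_prop) (by fun_prop) (-1) (-1) (1 / (L * (2 * γ - 1))) (Λ * ν)
    rw [one_mul (II Ω fun x => s.j x * (s.u2 x * s.c1 x - s.u1 x * s.c2 x)), mul_comm _ (-1 : ℝ), ← a1, ← a2, ← h.dom.iadd (by fun_prop) (by fun_prop)]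
    refine h.dom.congr fun x _ => ?_
    unfold Fld.dE Fld.F Fld.qt Fld.Dt Fld.wt Fld.jt
    ring
  have kap : (1 / (L * (2 * γ - 1))) * (((1 - 2 * γ) / 2) * (II Ω fun x => s.P x ^ 2 * s.D x)) = - (1 / (2 * L)) * (II Ω fun x => s.P x ^ 2 * s.D x) := by
    have : 2 * γ - 1 ≠ 0 := by linarith
    field_simp
    ring
  rw [split, p2, kap, p1, k1, mul_assoc Λ, k3]
  linarith

end
end

section
variable {Ω : Set V2} {φ : V2 → ℝ}

section
variable {γ μ ν Rm Pm L : ℝ} {s : Fld}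

lemma Snap.b1 (h : Snap Ω φ γ μ ν Rm Pm L s) :
    - (II Ω fun x => s.r x * s.v1 x * s.ut1 x + s.r x * s.v2 x * s.ut2 x) ≤ - (3 / 4) * s.X Ω + Rm * II Ω fun x => s.U2 x * s.gu x := by
  have cr := h.sr.cont
  have c1 := h.su1.cont
  have c2 := h.su2.cont
  have c5 := h.sut1.cont
  have c6 := h.sut2.cont
  have d1 := h.su1.cpd 0
  have d2 := h.su1.cpd 1
  have d3 := h.su2.cpd 0
  have d4 := h.su2.cpd 1
  have cv1 : Continuous s.v1 := by unfold Fld.v1; fun_prop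
  have cv2 : Continuous s.v2 := by unfold Fld.v2; fun_prop
  have cU := h.cU2
  have cg := h.cgu
  have := h.dom.le2 (e := fun x => (-1) * (s.r x * s.v1 x * s.ut1 x + s.r x * s.v2 x * s.ut2 x)) (f := fun x => s.r x * (s.v1 x ^ 2 + s.v2 x ^ 2))
    (g := fun x => s.U2 x * s.gu x) (by fun_prop) (by fun_prop) (by fun_prop) (-(3/4)) Rm (fun x hx => by
      have r0 := h.r0 x hx
      have r1 := h.r1 x hx
      set a1 := s.u1 x * pd 0 s.u1 x + s.u2 x * pd 1 s.u1 x with ha1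
      set a2 := s.u1 x * pd 0 s.u2 x + s.u2 x * pd 1 s.u2 x with ha2
      have e1 : s.ut1 x = s.v1 x - a1 := by rw [ha1]; unfold Fld.v1; ring
      have e2 : s.ut2 x = s.v2 x - a2 := by rw [ha2]; unfold Fld.v2; ring
      have k : a1 ^ 2 + a2 ^ 2 ≤ s.U2 x * s.gu x := by
        rw [ha1, ha2]; unfold Fld.U2 Fld.gu gs
        nlinarith [sq_nonneg (s.u1 x * pd 1 s.u1 x - s.u2 x * pd 0 s.u1 x), sq_nonneg (s.u1 x * pd 1 s.u2 x - s.u2 x * pd 0 s.u2 x)]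
      have k0 : 0 ≤ s.U2 x * s.gu x := mul_nonneg (s.U20 x) (s.gu0 x)
      have k1 : s.r x * (a1 ^ 2 + a2 ^ 2) ≤ s.r x * (s.U2 x * s.gu x) := by gcongr
      have k2 : s.r x * (s.U2 x * s.gu x) ≤ Rm * (s.U2 x * s.gu x) := by gcongr
      have k3 : 0 ≤ s.r x * ((s.v1 x / 2 - a1) ^ 2 + (s.v2 x / 2 - a2) ^ 2) := by positivity
      rw [e1, e2]
      linarith)
  rw [h.dom.lin1] at this
  unfold Fld.X
  linarith

lemma Snap.b2 (h : Snap Ω φ γ μ ν Rm Pm L s) :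
    - (II Ω fun x => s.j x * (s.u2 x * s.c1 x - s.u1 x * s.c2 x)) ≤ s.Y Ω + II Ω fun x => s.j x ^ 2 * s.U2 x := by
  have c1 := h.su1.cont
  have c2 := h.su2.cont
  have c7 := h.sc1.cont
  have c8 := h.sc2.cont
  have cj := h.sj.cont
  have cU := h.cU2
  have := h.dom.le2 (e := fun x => (-1) * (s.j x * (s.u2 x * s.c1 x - s.u1 x * s.c2 x))) (f := fun x => s.c1 x ^ 2 + s.c2 x ^ 2)
    (g := fun x => s.j x ^ 2 * s.U2 x) (by fun_prop) (by fun_prop) (by fun_prop) 1 1 (fun x hx => by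
      unfold Fld.U2
      nlinarith [sq_nonneg (s.c1 x + s.j x * s.u2 x / 2), sq_nonneg (s.c2 x - s.j x * s.u1 x / 2), sq_nonneg (s.j x * s.u1 x), sq_nonneg (s.j x * s.u2 x)])
  rw [h.dom.lin1] at this
  unfold Fld.Y
  linarith

lemma Snap.b3 (h : Snap Ω φ γ μ ν Rm Pm L s) :
    (II Ω fun x => s.c2 x * pd 0 s.q x - s.c1 x * pd 1 s.q x) ≤ (1 / 4) * s.Y Ω + II Ω (gs s.q) := by
  have c7 := h.sc1.cont
  have c8 := h.sc2.cont
  have cq := h.sq.c1.cgs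
  have cq0 := h.sq.cpd 0
  have cq1 := h.sq.cpd 1
  have := h.dom.le2 (e := fun x => s.c2 x * pd 0 s.q x - s.c1 x * pd 1 s.q x) (f := fun x => s.c1 x ^ 2 + s.c2 x ^ 2)
    (g := gs s.q) (by fun_prop) (by fun_prop) (by fun_prop) (1 / 4) 1 (fun x hx => by
      unfold gs
      nlinarith [sq_nonneg (s.c2 x / 2 - pd 0 s.q x), sq_nonneg (s.c1 x / 2 + pd 1 s.q x)])
  unfold Fld.Y
  linarith

lemma Snap.b4 (h : Snap Ω φ γ μ ν Rm Pm L s) :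
    (γ - 1) * (II Ω fun x => s.P x * s.D x ^ 2) ≤ (γ - 1) * (Pm * s.d2 Ω) := by
  have cP := h.sP.cont
  have cD := h.sD.cont
  have hγ := h.hγ
  have g0 : 0 ≤ γ - 1 := by linarith
  gcongr
  refine h.dom.le1 (by fun_prop) (by fun_prop) Pm fun x hx => ?_
  have := h.P1 x hx
  gcongr

lemma Snap.b5 (h : Snap Ω φ γ μ ν Rm Pm L s) :
    - ((1 / L) * (II Ω fun x => s.P x * (s.u1 x * pd 0 (s.F L) x + s.u2 x * pd 1 (s.F L) x))) ≤
      (1 / (8 * Rm + 8)) * II Ω (gs (s.F L)) + (8 * Rm + 8) * (Pm / μ) ^ 2 * (N1 Ω s.u1 + N1 Ω s.u2) := by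
  have cP := h.sP.cont
  have c1 := h.su1.cont
  have c2 := h.su2.cont
  have cf0 := h.sF.cpd 0
  have cf1 := h.sF.cpd 1
  have cg := h.sF.cgs
  have cU := h.cU2
  have R0 := h.hRm
  have L0 := h.L0
  set κ := 8 * Rm + 8 with hκ
  have κ0 : 0 < κ := by positivity
  have := h.dom.le2 (e := fun x => (-(1/L)) * (s.P x * (s.u1 x * pd 0 (s.F L) x + s.u2 x * pd 1 (s.F L) x))) (f := gs (s.F L))
    (g := s.U2) (by fun_prop) (by fun_prop) (by fun_prop) (1 / κ) (κ * (Pm / μ) ^ 2) (fun x hx => by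
      have hp : (s.P x / L) ^ 2 ≤ (Pm / μ) ^ 2 := by
        have := h.P0 x hx; have := h.P1 x hx; have := h.hL; have := h.hμ; have := h.hPm
        gcongr
      have U0 := s.U20 x
      have k1 : κ * (s.P x / L) ^ 2 * s.U2 x ≤ κ * (Pm / μ) ^ 2 * s.U2 x := by gcongr
      set p := s.P x / L with hpd
      have e : (-(1/L)) * (s.P x * (s.u1 x * pd 0 (s.F L) x + s.u2 x * pd 1 (s.F L) x)) = - (p * (s.u1 x * pd 0 (s.F L) x + s.u2 x * pd 1 (s.F L) x)) := by
        rw [hpd]; ring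
      rw [e]
      refine le_trans ?_ (add_le_add_right k1 _)
      unfold gs Fld.U2
      have k2 : 0 ≤ (1 / κ) * ((pd 0 (s.F L) x + κ * p * s.u1 x / 2) ^ 2 + (pd 1 (s.F L) x + κ * p * s.u2 x / 2) ^ 2) := by positivity
      have e2 : (1 / κ) * ((pd 0 (s.F L) x + κ * p * s.u1 x / 2) ^ 2 + (pd 1 (s.F L) x + κ * p * s.u2 x / 2) ^ 2) = 
        1 / κ * (pd 0 (s.F L) x ^ 2 + pd 1 (s.F L) x ^ 2) + p * (s.u1 x * pd 0 (s.F L) x + s.u2 x * pd 1 (s.F L) x) + (1 / 4) * (κ * p ^ 2 * (s.u1 x ^ 2 + s.u2 x ^ 2)) := by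
        field_simp; ring
      have k3 : 0 ≤ κ * p ^ 2 * (s.u1 x ^ 2 + s.u2 x ^ 2) := by positivity
      linarith)
  rw [h.dom.lin1] at this
  have eU : II Ω s.U2 ≤ N1 Ω s.u1 + N1 Ω s.u2 := by
    have : II Ω s.U2 = (II Ω fun x => s.u1 x ^ 2) + II Ω fun x => s.u2 x ^ 2 := by
      rw [← h.dom.iadd (by fun_prop) (by fun_prop)]; rfl
    rw [this]
    exact add_le_add (h.dom.sq_le_N1 _) (h.dom.sq_le_N1 _)
  have : κ * (Pm / μ) ^ 2 * II Ω s.U2 ≤ κ * (Pm / μ) ^ 2 * (N1 Ω s.u1 + N1 Ω s.u2) := by gcongr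
  linarith

lemma arithS6 {K Λ R A c T X Y dE : ℝ} (hK : 1 ≤ K) (hΛ : 8 ≤ Λ) (hT : 0 ≤ T) (hAT : A ≤ T) (hY : 0 ≤ Y)
    (hR : ∀ η, 0 < η → η ≤ 1 → R ≤ η * (X + Y) + c / η * T) (h : dE ≤ - (1 / 2) * X - 4 * Y + K * Λ * R + K * A) :
    dE ≤ - (1 / 4) * (X + Y) + (4 * c * K ^ 2 + K) * Λ ^ 2 * T := by
  have p : 0 < K * Λ := by nlinarith
  have p1 : 1 ≤ K * Λ := by nlinarith
  have r := hR (1 / (4 * (K * Λ))) (by positivity) (by rw [div_le_one (by positivity)]; linarith)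
  have r2 : K * Λ * R ≤ K * Λ * (1 / (4 * (K * Λ)) * (X + Y) + c / (1 / (4 * (K * Λ))) * T) := by gcongr
  have e : K * Λ * (1 / (4 * (K * Λ)) * (X + Y) + c / (1 / (4 * (K * Λ))) * T) = (1 / 4) * (X + Y) + 4 * c * K ^ 2 * Λ ^ 2 * T := by
    field_simp
  rw [e] at r2
  have : K * A ≤ K * Λ ^ 2 * T := by
    have : 1 ≤ Λ ^ 2 := by nlinarith
    have h1 : K * A ≤ K * T := by gcongr
    have h2 : K * 1 * T ≤ K * Λ ^ 2 * T := by gcongr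
    linarith
  linarith

set_option maxHeartbeats 1000000 in
lemma Dom.S6 (h : Dom Ω φ) {γ μ ν Rm Pm : ℝ} (hγ : 1 < γ) (hμ : 0 < μ) (hν : 0 < ν) (hRm : 0 < Rm) (hPm : 0 < Pm) : ∃ c > 0, ∀ L s, Snap Ω φ γ μ ν Rm Pm L s → ∀ Λ, 8 ≤ Λ →
    II Ω (s.dE γ μ ν L Λ) ≤ - (1 / 4) * (s.X Ω + s.Y Ω) + c * Λ ^ 2 * Th (s.A Ω μ ν L) := by
  obtain ⟨C1, hC1, H1⟩ := h.Rctl μ ν Rm Pm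
  obtain ⟨C2, hC2, H2⟩ := h.S5 (Pm := Pm) hμ hν hRm
  obtain ⟨C3, hC3, H3⟩ := h.basicA μ ν Rm Pm hμ hν
  have g0 : 0 < γ - 1 := by linarith
  set K := (Rm * C1 + 2 + 2 * C1) + ((γ - 1) * Pm / μ + (8 * Rm + 8) * (Pm / μ) ^ 2 * C3) with hK
  have hK1 : 1 ≤ K := by
    have : 0 < (Rm * C1 + 2 * C1) + ((γ - 1) * Pm / μ + (8 * Rm + 8) * (Pm / μ) ^ 2 * C3) := by positivity
    linarith
  refine ⟨4 * C2 * K ^ 2 + K, by positivity, fun L s hs Λ hΛ => ?_⟩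
  obtain ⟨r1, r2, r3, r4⟩ := H1 L s hs.toStat
  obtain ⟨a1, a2, a3⟩ := H3 L s hs.toStat
  refine arithS6 hK1 hΛ (Th_nonneg hs.A0) (le_Th hs.A0) hs.Y0 (H2 γ L s hs).1 ?_
  have A0 := hs.A0
  have X0 := hs.X0
  have Y0 := hs.Y0
  have R0 := hs.toStat.R0
  rw [hs.dE_id]
  have b1 := hs.b1
  have b2 := hs.b2
  have b3 := hs.b3
  have b4 := hs.b4
  have b5 := hs.b5
  have s1 := hs.S1
  have p3 := h.N1_nonneg s.b1
  have p4 := h.N1_nonneg s.b2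
  have gw0 : 0 ≤ II Ω (gs s.w) := h.nn fun _ _ => gs_nonneg _ _
  have d := hs.d2A
  set X := s.X Ω
  set Y := s.Y Ω
  set R := s.R Ω φ L
  set A := s.A Ω μ ν L
  set Q := II Ω (fun x => s.c2 x * pd 0 s.q x - s.c1 x * pd 1 s.q x)
  have t1 : Rm * (II Ω fun x => s.U2 x * s.gu x) ≤ Rm * (C1 * R) := by gcongr
  have t3 : Λ * Q ≤ Λ * ((1 / 4) * Y + C1 * R) := by gcongr; linarith
  have t4 : (γ - 1) * (Pm * s.d2 Ω) ≤ (γ - 1) * Pm / μ * A := by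
    rw [div_mul_eq_mul_div, le_div_iff₀ hμ]
    have : (γ - 1) * Pm * (μ * s.d2 Ω) ≤ (γ - 1) * Pm * A := by gcongr
    linarith
  have t5 : (8 * Rm + 8) * (Pm / μ) ^ 2 * (N1 Ω s.u1 + N1 Ω s.u2) ≤ (8 * Rm + 8) * (Pm / μ) ^ 2 * (C3 * A) := by
    gcongr; linarith
  have t6 : (1 / (8 * Rm + 8)) * II Ω (gs (s.F L)) ≤ (1 / 4) * X + R := by
    rw [div_mul_eq_mul_div, div_le_iff₀ (by positivity)]
    have m0 : 0 ≤ μ ^ 2 * II Ω (gs s.w) := by positivity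
    have : 0 ≤ Rm * R := by positivity
    nlinarith
  have t7 : Λ * (C1 * R) + (Rm * C1 + 2 + C1) * R ≤ (Rm * C1 + 2 + 2 * C1) * Λ * R := by
    have : (Rm * C1 + 2 + C1) * R * 1 ≤ (Rm * C1 + 2 + C1) * R * Λ := by gcongr; linarith
    linarith
  have t8 : (Rm * C1 + 2 + 2 * C1) * Λ * R ≤ K * Λ * R := by
    gcongr
    have : 0 ≤ (γ - 1) * Pm / μ + (8 * Rm + 8) * (Pm / μ) ^ 2 * C3 := by positivity
    linarith
  have t9 : (γ - 1) * Pm / μ * A + (8 * Rm + 8) * (Pm / μ) ^ 2 * (C3 * A) ≤ K * A := by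
    have : 0 ≤ (Rm * C1 + 2 + 2 * C1) * A := by positivity
    rw [hK]; linarith
  have t10 : Λ * Y ≥ 8 * Y := by gcongr
  have t11 : Q ≤ (1 / 4) * Y + C1 * R := by linarith
  clear_value K Q X Y R A
  linarith

end
end

section
variable {Ω : Set V2} {φ : V2 → ℝ}

section
variable {γ μ ν Rm Pm L : ℝ} {s : Fld}

lemma Stat.jq_id (h : Stat Ω φ μ ν Rm Pm L s) : (II Ω fun x => s.j x * s.q x) =
    II Ω fun x => (1 / 2) * (s.B2 x * s.D x) - (s.b1 x * (s.b1 x * pd 0 s.u1 x + s.b2 x * pd 1 s.u1 x) + s.b2 x * (s.b1 x * pd 0 s.u2 x + s.b2 x * pd 1 s.u2 x)) := by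
  have cD := h.sD.cont
  have cB := h.cB2
  have cj := h.sj.cont
  have cq := h.sq.cont
  have c1 := h.su1.cont
  have c2 := h.su2.cont
  have c3 := h.sb1.cont
  have c4 := h.sb2.cont
  have d1 := h.su1.cpd 0
  have d2 := h.su1.cpd 1
  have d3 := h.su2.cpd 0
  have d4 := h.su2.cpd 1
  have d5 := h.sb1.cpd 0
  have d6 := h.sb1.cpd 1
  have d7 := h.sb2.cpd 0
  have d8 := h.sb2.cpd 1
  have i1 := h.dom.dv_ibp (g := fun x => s.b1 x * s.u1 x + s.b2 x * s.u2 x) ((h.sb1.mul h.su1).add (h.sb2.mul h.su2)).c1 h.sb1.c1 h.sb2.c1 h.tb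
  have i2 := h.dom.dv_ibp (g := s.B2) ((h.sb1.pow 2).add (h.sb2.pow 2)).c1 h.su1.c1 h.su2.c1 h.tu
  have z : (II Ω fun x => (s.b1 x * s.u1 x + s.b2 x * s.u2 x) * dv s.b1 s.b2 x) = 0 := by
    rw [h.dom.congr (g := fun _ => 0) (fun x hx => by rw [h.db x hx]; ring)]; simp [II]
  have eg : ∀ i x, pd i (fun x => s.b1 x * s.u1 x + s.b2 x * s.u2 x) x = s.b1 x * pd i s.u1 x + pd i s.b1 x * s.u1 x + (s.b2 x * pd i s.u2 x + pd i s.b2 x * s.u2 x) := by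
    intro i x
    rw [pd_add i ((h.sb1.mul h.su1).d x) ((h.sb2.mul h.su2).d x), pd_mul i (h.sb1.d x) (h.su1.d x), pd_mul i (h.sb2.d x) (h.su2.d x)]
  have eB : ∀ i x, pd i s.B2 x = 2 * (s.b1 x * pd i s.b1 x) + 2 * (s.b2 x * pd i s.b2 x) := by
    intro i x
    have : s.B2 = fun x => s.b1 x ^ 2 + s.b2 x ^ 2 := rfl
    rw [this, pd_add i ((h.sb1.pow 2).d x) ((h.sb2.pow 2).d x), pd_sq i h.sb1.c1, pd_sq i h.sb2.c1]
  rw [z] at i1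
  simp only [eg] at i1
  simp only [eB] at i2
  have e : (II Ω fun x => s.j x * s.q x) = 
    1 * (II Ω fun x => (1 / 2) * (s.B2 x * s.D x) - (s.b1 x * (s.b1 x * pd 0 s.u1 x + s.b2 x * pd 1 s.u1 x) + s.b2 x * (s.b1 x * pd 0 s.u2 x + s.b2 x * pd 1 s.u2 x)))
    + (-(1/2)) * (II Ω fun x => s.B2 x * dv s.u1 s.u2 x)
    + 1 * (II Ω fun x => s.b1 x * (s.b1 x * pd 0 s.u1 x + pd 0 s.b1 x * s.u1 x + (s.b2 x * pd 0 s.u2 x + pd 0 s.b2 x * s.u2 x)) + s.b2 x * (s.b1 x * pd 1 s.u1 x + pd 1 s.b1 x * s.u1 x + (s.b2 x * pd 1 s.u2 x + pd 1 s.b2 x * s.u2 x)))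
    + (-(1/2)) * (II Ω fun x => s.u1 x * (2 * (s.b1 x * pd 0 s.b1 x) + 2 * (s.b2 x * pd 0 s.b2 x)) + s.u2 x * (2 * (s.b1 x * pd 1 s.b1 x) + 2 * (s.b2 x * pd 1 s.b2 x))) := by
    have cdu : Continuous (dv s.u1 s.u2) := cD
    rw [← h.dom.lin4 (by fun_prop) (by fun_prop) (by fun_prop) (by fun_prop)]
    refine h.dom.congr fun x _ => ?_
    unfold Fld.j Fld.q Fld.D cl dv
    ring
  rw [e]
  linarith

lemma Dom.S7a (h : Dom Ω φ) {μ ν Rm Pm : ℝ} (hμ : 0 < μ) : ∃ c > 0, ∀ L s, Stat Ω φ μ ν Rm Pm L s → ∀ K, II Ω s.B2 ≤ K →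
    |II Ω fun x => s.j x * s.q x| ≤ (1 / 8) * (L * s.d2 Ω + μ * s.w2 Ω) + c * K * s.j2 Ω := by
  obtain ⟨C1, hC1, H1⟩ := h.N1_tan
  obtain ⟨C4, hC4, H4⟩ := h.L4
  refine ⟨(16 / μ) * (2 * (C4 * C1)), by positivity, fun L s hs K hK => ?_⟩
  have cD := hs.sD.cont
  have cw := hs.sw.cont
  have cB := hs.cB2
  have cg := hs.cgu
  have c3 := hs.sb1.cont
  have c4 := hs.sb2.cont
  have d1 := hs.su1.cpd 0
  have d2 := hs.su1.cpd 1
  have d3 := hs.su2.cpd 0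
  have d4 := hs.su2.cpd 1
  have n2 : N1 Ω s.b1 + N1 Ω s.b2 ≤ C1 * s.j2 Ω := by
    have := H1 s.b1 s.b2 hs.sb1 hs.sb2 hs.tb
    have e : (II Ω fun x => dv s.b1 s.b2 x ^ 2) = 0 := by
      rw [h.congr (g := fun _ => 0) (fun x hx => by rw [hs.db x hx]; ring)]; simp [II]
    rw [e, zero_add] at this
    exact this
  have eB : II Ω s.B2 = (II Ω fun x => s.b1 x ^ 2) + II Ω fun x => s.b2 x ^ 2 := by
    rw [← h.iadd (by fun_prop) (by fun_prop)]; rfl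
  have z1 : 0 ≤ II Ω fun x => s.b1 x ^ 2 := h.nn fun _ _ => sq_nonneg _
  have z2 : 0 ≤ II Ω fun x => s.b2 x ^ 2 := h.nn fun _ _ => sq_nonneg _
  have p1 := h.N1_nonneg s.b1
  have p2 := h.N1_nonneg s.b2
  have K0 : 0 ≤ K := by linarith
  have f1 := H4 s.b1 hs.sb1.c1
  have f2 := H4 s.b2 hs.sb2.c1
  have f3 : C4 * (II Ω fun x => s.b1 x ^ 2) * N1 Ω s.b1 ≤ C4 * K * N1 Ω s.b1 := by gcongr; linarith
  have f4 : C4 * (II Ω fun x => s.b2 x ^ 2) * N1 Ω s.b2 ≤ C4 * K * N1 Ω s.b2 := by gcongr; linarith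
  have f5 : (II Ω fun x => s.B2 x ^ 2) ≤ 2 * (II Ω fun x => s.b1 x ^ 4) + 2 * (II Ω fun x => s.b2 x ^ 4) := by
    refine h.le2 (by fun_prop) (by fun_prop) (by fun_prop) _ _ fun x _ => ?_
    unfold Fld.B2
    nlinarith [sq_nonneg (s.b1 x ^ 2 - s.b2 x ^ 2)]
  have f6 : C4 * K * (N1 Ω s.b1 + N1 Ω s.b2) ≤ C4 * K * (C1 * s.j2 Ω) := by gcongr
  have f7 : (II Ω fun x => s.B2 x ^ 2) ≤ 2 * (C4 * K * (C1 * s.j2 Ω)) := by linarith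
  have gg : II Ω s.gu ≤ s.d2 Ω + s.w2 Ω := by
    have := h.grad_bound hs.su1 hs.su2 hs.tu
    refine this.trans (le_of_eq ?_)
    exact h.iadd (f := fun x => s.D x ^ 2) (g := fun x => s.w x ^ 2) (by fun_prop) (by fun_prop)
  set δ := μ / 16 with hδ
  have δ0 : 0 < δ := by positivity
  have pt : ∀ x, |(1 / 2) * (s.B2 x * s.D x) - (s.b1 x * (s.b1 x * pd 0 s.u1 x + s.b2 x * pd 1 s.u1 x) + s.b2 x * (s.b1 x * pd 0 s.u2 x + s.b2 x * pd 1 s.u2 x))|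
      ≤ δ * s.gu x + δ * s.D x ^ 2 + (1 / δ) * s.B2 x ^ 2 := by
    intro x
    set W := s.b1 x * (s.b1 x * pd 0 s.u1 x + s.b2 x * pd 1 s.u1 x) + s.b2 x * (s.b1 x * pd 0 s.u2 x + s.b2 x * pd 1 s.u2 x) with hW
    have B0 := s.B20 x
    have w : W ^ 2 ≤ s.B2 x ^ 2 * s.gu x := by
      have e : s.B2 x ^ 2 * s.gu x - W ^ 2 = (s.b1 x * s.b1 x * pd 1 s.u1 x - s.b1 x * s.b2 x * pd 0 s.u1 x) ^ 2
        + (s.b1 x * s.b1 x * pd 0 s.u2 x - s.b2 x * s.b1 x * pd 0 s.u1 x) ^ 2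
        + (s.b1 x * s.b1 x * pd 1 s.u2 x - s.b2 x * s.b2 x * pd 0 s.u1 x) ^ 2
        + (s.b1 x * s.b2 x * pd 0 s.u2 x - s.b2 x * s.b1 x * pd 1 s.u1 x) ^ 2
        + (s.b1 x * s.b2 x * pd 1 s.u2 x - s.b2 x * s.b2 x * pd 1 s.u1 x) ^ 2
        + (s.b2 x * s.b1 x * pd 1 s.u2 x - s.b2 x * s.b2 x * pd 0 s.u2 x) ^ 2 := by
        rw [hW]; unfold Fld.B2 Fld.gu gs; ring
      have : 0 ≤ s.B2 x ^ 2 * s.gu x - W ^ 2 := by rw [e]; positivity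
      linarith
    have g0 := s.gu0 x
    have w2 : |W| ≤ δ * s.gu x + (1 / δ) * s.B2 x ^ 2 / 4 := by
      refine abs_le_of_sq_le_sq (w.trans ?_) (by positivity)
      have : (δ * s.gu x + (1 / δ) * s.B2 x ^ 2 / 4) ^ 2 = (δ * s.gu x - (1 / δ) * s.B2 x ^ 2 / 4) ^ 2 + s.B2 x ^ 2 * s.gu x := by
        field_simp; ring
      rw [this]
      linarith [sq_nonneg (δ * s.gu x - (1 / δ) * s.B2 x ^ 2 / 4)]
    have w3 : |(1 / 2) * (s.B2 x * s.D x)| ≤ δ * s.D x ^ 2 + (1 / δ) * s.B2 x ^ 2 / 4 := by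
      refine abs_le_of_sq_le_sq ?_ (by positivity)
      have : (δ * s.D x ^ 2 + (1 / δ) * s.B2 x ^ 2 / 4) ^ 2 = (δ * s.D x ^ 2 - (1 / δ) * s.B2 x ^ 2 / 4) ^ 2 + s.B2 x ^ 2 * s.D x ^ 2 := by
        field_simp; ring
      rw [this]
      nlinarith [sq_nonneg (δ * s.D x ^ 2 - (1 / δ) * s.B2 x ^ 2 / 4), sq_nonneg (s.B2 x * s.D x)]
    have p : 0 ≤ (1 / δ) * s.B2 x ^ 2 := by positivity
    have := abs_sub ((1 / 2) * (s.B2 x * s.D x)) W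
    linarith
  have up := h.le3 (e := fun x => (1 / 2) * (s.B2 x * s.D x) - (s.b1 x * (s.b1 x * pd 0 s.u1 x + s.b2 x * pd 1 s.u1 x) + s.b2 x * (s.b1 x * pd 0 s.u2 x + s.b2 x * pd 1 s.u2 x)))
    (f := s.gu) (g := fun x => s.D x ^ 2) (k := fun x => s.B2 x ^ 2) (by fun_prop) (by fun_prop) (by fun_prop) (by fun_prop) δ δ (1 / δ) (fun x _ => (le_abs_self _).trans (pt x))
  have lo := h.le3 (e := fun x => (-1) * ((1 / 2) * (s.B2 x * s.D x) - (s.b1 x * (s.b1 x * pd 0 s.u1 x + s.b2 x * pd 1 s.u1 x) + s.b2 x * (s.b1 x * pd 0 s.u2 x + s.b2 x * pd 1 s.u2 x))))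
    (f := s.gu) (g := fun x => s.D x ^ 2) (k := fun x => s.B2 x ^ 2) (by fun_prop) (by fun_prop) (by fun_prop) (by fun_prop) δ δ (1 / δ) (fun x _ => by rw [neg_one_mul]; exact (neg_le_abs _).trans (pt x))
  rw [h.lin1] at lo
  rw [← hs.jq_id] at up lo
  have fin : δ * II Ω s.gu + δ * (II Ω fun x => s.D x ^ 2) + (1 / δ) * (II Ω fun x => s.B2 x ^ 2) ≤
      (1 / 8) * (L * s.d2 Ω + μ * s.w2 Ω) + (16 / μ) * (2 * (C4 * C1)) * K * s.j2 Ω := by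
    have e0 : (II Ω fun x => s.D x ^ 2) = s.d2 Ω := rfl
    have k1 : δ * II Ω s.gu ≤ δ * (s.d2 Ω + s.w2 Ω) := by gcongr
    have k2 : (1 / δ) * (II Ω fun x => s.B2 x ^ 2) ≤ (1 / δ) * (2 * (C4 * K * (C1 * s.j2 Ω))) := by gcongr
    have e1 : 1 / δ = 16 / μ := by rw [hδ]; field_simp
    have hL := hs.hL
    have d0 := hs.d20
    have w0 := hs.w20
    have k3 : μ * s.d2 Ω ≤ L * s.d2 Ω := by gcongr
    have k4 : 0 ≤ μ * s.w2 Ω := by positivity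
    rw [e1] at k2 ⊢
    rw [e0]
    have : δ * (s.d2 Ω + s.w2 Ω) + δ * s.d2 Ω = (1 / 8) * (μ * s.d2 Ω) + (1 / 16) * (μ * s.w2 Ω) := by rw [hδ]; ring
    linarith
  rw [abs_le]
  constructor <;> linarith

lemma Dom.S7 (h : Dom Ω φ) {γ μ ν Rm Pm : ℝ} (hγ : 1 < γ) (hμ : 0 < μ) (hν : 0 < ν) (hPm : 0 < Pm) : ∃ c > 0, ∀ L s, Stat Ω φ μ ν Rm Pm L s → ∀ K, II Ω s.B2 ≤ K →
    ∀ Λ, 8 + c * K ≤ Λ → s.A Ω μ ν L / 4 - c ≤ II Ω (s.eE γ μ ν L Λ) ∧ II Ω (s.eE γ μ ν L Λ) ≤ c * Λ * (1 + s.A Ω μ ν L) := by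
  obtain ⟨c0, hc0, H⟩ := h.S7a (ν := ν) (Rm := Rm) (Pm := Pm) hμ
  have hv := h.vol_pos
  set c1 := (2 / μ) * Pm ^ 2 * vol Ω with hc1
  set c2 := (1 / μ) * Pm ^ 2 * vol Ω with hc2
  have c10 : 0 < c1 := by positivity
  have c20 : 0 < c2 := by positivity
  refine ⟨2 * c0 / ν + 1 + c1 + c2, by positivity, fun L s hs K hK Λ hΛ => ?_⟩
  have cD := hs.sD.cont
  have cw := hs.sw.cont
  have cj := hs.sj.cont
  have cq := hs.sq.cont
  have cP := hs.sP.cont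
  have L0 := hs.L0
  have hL := hs.hL
  have d0 := hs.d20
  have w0 := hs.w20
  have j0 := hs.j20
  have K0 : 0 ≤ K := le_trans (h.nn fun x _ => s.B20 x) hK
  have c0K : 2 * c0 / ν * K + 8 ≤ Λ := by
    have : 0 ≤ (1 + c1 + c2) * K := by positivity
    linarith
  have Λn : c0 * K + 4 * ν ≤ Λ * (ν / 2) := by
    have : (2 * c0 / ν * K + 8) * (ν / 2) ≤ Λ * (ν / 2) := by gcongr
    have e : (2 * c0 / ν * K + 8) * (ν / 2) = c0 * K + 4 * ν := by field_simp; ring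
    linarith
  have q := abs_le.1 (H L s hs K hK)
  have g1 : 1 ≤ 2 * γ - 1 := by linarith
  set κ := 1 / (L * (2 * γ - 1)) with hκ
  have κ0 : 0 ≤ κ := by positivity
  have κ1 : κ ≤ 1 / μ := by
    rw [hκ]
    apply one_div_le_one_div_of_le hμ
    nlinarith
  have eE : II Ω (s.eE γ μ ν L Λ) = (L / 2) * s.d2 Ω + (μ / 2) * s.w2 Ω + (-1) * (II Ω fun x => s.P x * s.D x) + (-1) * (II Ω fun x => s.j x * s.q x)
      + (κ / 2) * (II Ω fun x => s.P x ^ 2) + (Λ * (ν / 2)) * s.j2 Ω := by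
    unfold Fld.d2 Fld.w2 Fld.j2
    rw [← h.lin5 (by fun_prop) (by fun_prop) (by fun_prop) (by fun_prop) (by fun_prop), ← h.lin1 _ (Λ * (ν / 2)), ← h.iadd (by fun_prop) (by fun_prop)]
    refine h.congr fun x _ => ?_
    unfold Fld.eE
    rw [← hκ]; ring
  have P2 : (II Ω fun x => s.P x ^ 2) ≤ Pm ^ 2 * vol Ω := by
    refine h.le1 (by fun_prop) (by fun_prop) _ fun x hx => ?_
    have := h.ne
    have := hs.P0 x hx
    have := hs.P1 x hx
    rw [mul_one]; gcongr
  have P20 : 0 ≤ (II Ω fun x => s.P x ^ 2) := h.nn fun _ _ => sq_nonneg _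
  have up := h.le2 (e := fun x => s.P x * s.D x) (f := fun x => s.D x ^ 2) (g := fun x => s.P x ^ 2) (by fun_prop) (by fun_prop) (by fun_prop) (L / 8) (2 / L) (fun x _ => by
    have : L / 8 * s.D x ^ 2 + 2 / L * s.P x ^ 2 - s.P x * s.D x = (2 / L) * (L * s.D x / 4 - s.P x) ^ 2 := by field_simp; ring
    have : 0 ≤ (2 / L) * (L * s.D x / 4 - s.P x) ^ 2 := by positivity
    linarith)
  have lo := h.le2 (e := fun x => (-1) * (s.P x * s.D x)) (f := fun x => s.D x ^ 2) (g := fun x => s.P x ^ 2) (by fun_prop) (by fun_prop) (by fun_prop) (L / 8) (2 / L) (fun x _ => by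
    have : L / 8 * s.D x ^ 2 + 2 / L * s.P x ^ 2 + s.P x * s.D x = (2 / L) * (L * s.D x / 4 + s.P x) ^ 2 := by field_simp; ring
    have : 0 ≤ (2 / L) * (L * s.D x / 4 + s.P x) ^ 2 := by positivity
    linarith)
  rw [h.lin1] at lo
  have t1 : (2 / L) * (II Ω fun x => s.P x ^ 2) ≤ c1 := by
    have : (2 / L) * (II Ω fun x => s.P x ^ 2) ≤ (2 / μ) * (Pm ^ 2 * vol Ω) := by gcongr
    rw [hc1]; linarith
  have t2 : (κ / 2) * (II Ω fun x => s.P x ^ 2) ≤ c2 := by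
    have : κ * (II Ω fun x => s.P x ^ 2) ≤ (1 / μ) * (Pm ^ 2 * vol Ω) := by gcongr
    have : 0 ≤ κ * (II Ω fun x => s.P x ^ 2) := by positivity
    rw [hc2]; linarith
  have t20 : 0 ≤ (κ / 2) * (II Ω fun x => s.P x ^ 2) := by positivity
  have e0 : (II Ω fun x => s.D x ^ 2) = s.d2 Ω := rfl
  rw [e0] at up lo
  have t3 : (c0 * K + 4 * ν) * s.j2 Ω ≤ (Λ * (ν / 2)) * s.j2 Ω := by gcongr
  have t4 : 0 ≤ L * s.d2 Ω := by positivity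
  have t5 : 0 ≤ μ * s.w2 Ω := by positivity
  have t6 : 0 ≤ ν * s.j2 Ω := by positivity
  have t7 : 0 ≤ c0 / ν := by positivity
  have t8 : 0 < 2 * c0 / ν := by positivity
  rw [eE]
  unfold Fld.A
  constructor
  · linarith
  · have Λ8 : 8 ≤ Λ := by
      have : 0 ≤ 2 * c0 / ν * K := by positivity
      linarith
    have u1 : 1 * (L * s.d2 Ω + μ * s.w2 Ω) ≤ Λ * (L * s.d2 Ω + μ * s.w2 Ω) := by gcongr; linarith
    have u2 : (c1 + c2) * 1 ≤ (c1 + c2) * Λ := by gcongr; linarith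
    have u3 : 0 ≤ (2 * c0 / ν + c1 + c2) * Λ * (L * s.d2 Ω + μ * s.w2 Ω + ν * s.j2 Ω) + (2 * c0 / ν + 1) * Λ := by positivity
    have e : (2 * c0 / ν + 1 + c1 + c2) * Λ * (1 + (L * s.d2 Ω + μ * s.w2 Ω + ν * s.j2 Ω)) = (c1 + c2) * Λ + Λ * (L * s.d2 Ω + μ * s.w2 Ω) + 2 * ((Λ * (ν / 2)) * s.j2 Ω) +
      ((2 * c0 / ν + c1 + c2) * Λ * (L * s.d2 Ω + μ * s.w2 Ω + ν * s.j2 Ω) + (2 * c0 / ν + 1) * Λ) := by ring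
    rw [e]
    linarith

end
end

section
variable {Ω : Set V2} {φ : V2 → ℝ}

lemma Smooth2.sm {f : ℝ → V2 → ℝ} (hf : Smooth2 f) (t : ℝ) : Sm (f t) := by
  have h : ContDiff ℝ (⊤ : ℕ∞) (fun x : V2 => ((t, x) : ℝ × V2)) := contDiff_const.prodMk contDiff_id
  exact ContDiff.comp (g := fun p : ℝ × V2 => f p.1 p.2) hf h

lemma Smooth2.fd {f : ℝ → V2 → ℝ} (hf : Smooth2 f) (p : ℝ × V2) :
    HasFDerivAt (fun p : ℝ × V2 => f p.1 p.2) (fderiv ℝ (fun p : ℝ × V2 => f p.1 p.2) p) p :=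
  ((ContDiff.differentiable hf (by norm_cast)) p).hasFDerivAt

lemma Smooth2.hd' {f : ℝ → V2 → ℝ} (hf : Smooth2 f) (t : ℝ) (x : V2) :
    HasDerivAt (fun s => f s x) (fderiv ℝ (fun p : ℝ × V2 => f p.1 p.2) (t, x) (1, 0)) t := by
  have h1 : HasDerivAt (fun s : ℝ => ((s, x) : ℝ × V2)) (1, 0) t :=
    (hasDerivAt_id t).prodMk (hasDerivAt_const t x)
  exact (hf.fd (t, x)).comp_hasDerivAt t h1

lemma Smooth2.dt_eq {f : ℝ → V2 → ℝ} (hf : Smooth2 f) (t : ℝ) (x : V2) :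
    dt f t x = fderiv ℝ (fun p : ℝ × V2 => f p.1 p.2) (t, x) (1, 0) := (hf.hd' t x).deriv

lemma Smooth2.hd {f : ℝ → V2 → ℝ} (hf : Smooth2 f) (t : ℝ) (x : V2) :
    HasDerivAt (fun s => f s x) (dt f t x) t := by
  rw [hf.dt_eq]; exact hf.hd' t x

lemma Smooth2.pd_eq {f : ℝ → V2 → ℝ} (hf : Smooth2 f) (i : Fin 2) (t : ℝ) (x : V2) :
    pd i (f t) x = fderiv ℝ (fun p : ℝ × V2 => f p.1 p.2) (t, x) (0, Pi.single i 1) := by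
  have h1 : HasFDerivAt (fun y : V2 => ((t, y) : ℝ × V2)) (ContinuousLinearMap.inr ℝ ℝ V2) x :=
    hasFDerivAt_prodMk_right t x
  have h2 := (hf.fd (t, x)).comp x h1
  have h3 : HasFDerivAt (f t) ((fderiv ℝ (fun p : ℝ × V2 => f p.1 p.2) (t, x)).comp
    (ContinuousLinearMap.inr ℝ ℝ V2)) x := h2
  unfold pd
  rw [h3.fderiv]; simp

lemma Smooth2.fdd {f : ℝ → V2 → ℝ} (hf : Smooth2 f) (v : ℝ × V2) :
    Smooth2 (fun t x => fderiv ℝ (fun p : ℝ × V2 => f p.1 p.2) (t, x) v) := by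
  have h : ContDiff ℝ (⊤ : ℕ∞) (fderiv ℝ (fun p : ℝ × V2 => f p.1 p.2)) :=
    ContDiff.fderiv_right hf (by norm_cast)
  exact h.clm_apply contDiff_const

lemma Smooth2.dt {f : ℝ → V2 → ℝ} (hf : Smooth2 f) : Smooth2 (dt f) := by
  have : MHD.dt f = fun t x => fderiv ℝ (fun p : ℝ × V2 => f p.1 p.2) (t, x) (1, 0) := by
    ext t x; exact hf.dt_eq t x
  rw [this]; exact hf.fdd _

lemma Smooth2.pd {f : ℝ → V2 → ℝ} (hf : Smooth2 f) (i : Fin 2) : Smooth2 (fun t => pd i (f t)) := by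
  have : (fun t => MHD.pd i (f t)) = fun t x => fderiv ℝ (fun p : ℝ × V2 => f p.1 p.2) (t, x) (0, Pi.single i 1) := by
    ext t x; exact hf.pd_eq i t x
  rw [this]; exact hf.fdd _

lemma Smooth2.comm {f : ℝ → V2 → ℝ} (hf : Smooth2 f) (i : Fin 2) (t : ℝ) (x : V2) :
    MHD.dt (fun t => MHD.pd i (f t)) t x = MHD.pd i (MHD.dt f t) x := by
  rw [(hf.pd i).dt_eq, hf.dt.pd_eq]
  have e1 : (fun p : ℝ × V2 => MHD.pd i (f p.1) p.2) =
    fun p => fderiv ℝ (fun p : ℝ × V2 => f p.1 p.2) p (0, Pi.single i 1) := by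
    ext p; exact hf.pd_eq i p.1 p.2
  have e2 : (fun p : ℝ × V2 => MHD.dt f p.1 p.2) =
    fun p => fderiv ℝ (fun p : ℝ × V2 => f p.1 p.2) p (1, 0) := by
    ext p; exact hf.dt_eq p.1 p.2
  rw [e1, e2]
  set F : ℝ × V2 → ℝ := fun p : ℝ × V2 => f p.1 p.2 with hF
  have hF' : ContDiff ℝ (⊤ : ℕ∞) F := hf
  have hs : IsSymmSndFDerivAt ℝ F (t, x) := by
    apply ContDiffAt.isSymmSndFDerivAt hF'.contDiffAt
    simp; norm_cast
  have hd : DifferentiableAt ℝ (fderiv ℝ F) (t, x) := by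
    have h : ContDiff ℝ 1 (fderiv ℝ F) := hF'.fderiv_right (by norm_cast)
    exact (h.differentiable (by norm_num)) _
  have key : ∀ v w : ℝ × V2, fderiv ℝ (fun y => fderiv ℝ F y w) (t, x) v = fderiv ℝ (fderiv ℝ F) (t, x) v w := by
    intro v w
    have := (hd.hasFDerivAt.clm_apply (hasFDerivAt_const w (t, x))).fderiv
    rw [this]; simp
  rw [key, key]; exact hs _ _

lemma Smooth2.pdhd {f : ℝ → V2 → ℝ} (hf : Smooth2 f) (i : Fin 2) (t : ℝ) (x : V2) :
    HasDerivAt (fun s => MHD.pd i (f s) x) (MHD.pd i (MHD.dt f t) x) t := by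
  rw [← hf.comm]; exact (hf.pd i).hd t x

/-- joint continuity -/
abbrev CC (f : ℝ → V2 → ℝ) : Prop := Continuous (fun p : ℝ × V2 => f p.1 p.2)

lemma Smooth2.cc {f : ℝ → V2 → ℝ} (hf : Smooth2 f) : CC f := ContDiff.continuous hf

lemma CC.at {f : ℝ → V2 → ℝ} (hf : CC f) (t : ℝ) : Continuous (f t) :=
  hf.comp (Continuous.prodMk_right t)

lemma Dom.bddT (h : Dom Ω φ) {f : ℝ → V2 → ℝ} (hf : CC f) (a b : ℝ) :
    ∃ C, ∀ t ∈ Icc a b, ∀ x ∈ Ω, ‖f t x‖ ≤ C := by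
  obtain ⟨C, hC⟩ := (isCompact_Icc.prod h.compact).exists_bound_of_continuousOn (s := Icc a b ×ˢ closure Ω) hf.continuousOn
  exact ⟨C, fun t ht x hx => hC (t, x) ⟨ht, subset_closure hx⟩⟩

lemma Dom.hasDeriv (h : Dom Ω φ) {f f' : ℝ → V2 → ℝ} (hf : CC f) (hf' : CC f')
    (hd : ∀ t x, HasDerivAt (fun s => f s x) (f' t x) t) (t : ℝ) :
    HasDerivAt (fun t => II Ω (f t)) (II Ω (f' t)) t := by
  obtain ⟨C, hC⟩ := h.bddT hf' (t - 1) (t + 1)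
  refine (hasDerivAt_integral_of_dominated_loc_of_deriv_le (μ := volume.restrict Ω) (F := f) (F' := f')
    (bound := fun _ => C) (s := Icc (t - 1) (t + 1)) (Icc_mem_nhds (by linarith) (by linarith)) ?_ ?_ ?_ ?_ ?_ ?_).2
  · exact Eventually.of_forall fun s => (h.int (hf.at s)).aestronglyMeasurable
  · exact h.int (hf.at t)
  · exact (h.int (hf'.at t)).aestronglyMeasurable
  · filter_upwards [ae_restrict_mem h.meas] with x hx s hs
    exact hC s hs x hx
  · exact h.int continuous_const
  · exact Eventually.of_forall fun x s _ => hd s x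

lemma Dom.contT (h : Dom Ω φ) {f : ℝ → V2 → ℝ} (hf : CC f) : Continuous (fun t => II Ω (f t)) := by
  rw [continuous_iff_continuousAt]
  intro t
  obtain ⟨C, hC⟩ := h.bddT hf (t - 1) (t + 1)
  refine continuousAt_of_dominated (μ := volume.restrict Ω) (F := f) (bound := fun _ => C) ?_ ?_ ?_ ?_
  · exact Eventually.of_forall fun s => (h.int (hf.at s)).aestronglyMeasurable
  · filter_upwards [Icc_mem_nhds (show t - 1 < t by linarith) (show t < t + 1 by linarith)] with s hs
    filter_upwards [ae_restrict_mem h.meas] with x hx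
    exact hC s hs x hx
  · exact h.int continuous_const
  · refine Eventually.of_forall fun x => ?_
    exact (hf.comp (Continuous.prodMk_left x)).continuousAt
end

section
variable {Ω : Set V2} {φ : V2 → ℝ}

/-- fields at time `t` -/
def mkF (a γ : ℝ) (ρ u1 u2 b1 b2 : ℝ → V2 → ℝ) (t : ℝ) : Fld where
  r := ρ t
  rt := dt ρ t
  P := fun x => a * ρ t x ^ γ
  Pt := fun x => a * (dt ρ t x * γ * ρ t x ^ (γ - 1))
  u1 := u1 t
  u2 := u2 t
  b1 := b1 t
  b2 := b2 t
  ut1 := dt u1 t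
  ut2 := dt u2 t
  c1 := dt b1 t
  c2 := dt b2 t

lemma Dom.ofSmooth {n : V2 → V2} (hΩ : SmoothDomain Ω n) (hc : Convex ℝ Ω) :
    ∃ φ, Dom Ω φ ∧ ∀ x, φ x = 0 → ∀ v : V2, dot v (n x) = 0 → v 0 * pd 0 φ x + v 1 * pd 1 φ x = 0 := by
  obtain ⟨hne, hb, φ, hs, he, hf, hg, hn⟩ := hΩ
  have gr : ∀ x, φ x = 0 → 0 < (pd 0 φ x)^2 + (pd 1 φ x)^2 := by
    intro x hx
    have h1 := hg x (by rw [hf]; exact hx)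
    by_contra hcon
    apply h1
    have z0 : pd 0 φ x = 0 := by nlinarith [sq_nonneg (pd 0 φ x), sq_nonneg (pd 1 φ x)]
    have z1 : pd 1 φ x = 0 := by nlinarith [sq_nonneg (pd 0 φ x), sq_nonneg (pd 1 φ x)]
    ext i; fin_cases i <;> simp [grad, z0, z1]
  refine ⟨φ, ⟨hs, he, hf, gr, hb, hc, hne⟩, ?_⟩
  intro x hx v hv
  rw [hn x (by rw [hf]; exact hx)] at hv
  have g := gr x hx
  have hp : 0 < (Real.sqrt (nsq (grad φ x)))⁻¹ := by
    apply inv_pos.2; apply Real.sqrt_pos.2; simpa [nsq, grad, Fin.sum_univ_two] using g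
  simp only [dot, Fin.sum_univ_two, Pi.smul_apply, smul_eq_mul] at hv
  have e0 : grad φ x 0 = pd 0 φ x := rfl
  have e1 : grad φ x 1 = pd 1 φ x := rfl
  rw [e0, e1] at hv
  apply mul_left_cancel₀ hp.ne'
  linear_combination hv

lemma C1.rpow {f : V2 → ℝ} (hf : C1 f) {γ : ℝ} (hγ : 1 ≤ γ) : C1 (fun x => f x ^ γ) :=
  (Real.contDiff_rpow_const_of_le (n := 1) (by simpa using hγ)).comp hf

lemma pd_rpow (i : Fin 2) {f : V2 → ℝ} {x : V2} (hf : DifferentiableAt ℝ f x) {γ : ℝ} (hγ : 1 ≤ γ) :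
    pd i (fun y => f y ^ γ) x = pd i f x * γ * f x ^ (γ - 1) := by
  unfold pd
  rw [(hf.hasFDerivAt.rpow_const (Or.inr hγ)).fderiv]; simp; ring

lemma rpow_eq_mul {r γ : ℝ} (hr : 0 ≤ r) (hγ : 1 < γ) : r ^ γ = r ^ (γ - 1) * r := by
  rw [← Real.rpow_add_one' hr (by linarith)]; congr 1; ring

section
variable {n : V2 → V2} {a γ μ lam ν ρhat M T : ℝ} {ρ : ℝ → V2 → ℝ} {u B : ℝ → V2 → V2}

/-- fields of a solution -/
abbrev fl (a γ : ℝ) (ρ : ℝ → V2 → ℝ) (u B : ℝ → V2 → V2) (t : ℝ) : Fld :=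
  mkF a γ ρ (fun t x => u t x 0) (fun t x => u t x 1) (fun t x => B t x 0) (fun t x => B t x 1) t

lemma fl_stat (hd : Dom Ω φ) (hn : ∀ x, φ x = 0 → ∀ v : V2, dot v (n x) = 0 → v 0 * pd 0 φ x + v 1 * pd 1 φ x = 0)
    (ha : 0 < a) (hγ : 1 < γ) (hμ : 0 < μ) (hν : 0 < ν) (hρ : 0 < ρhat) (hlam : 0 < lam)
    (H : DataHyps Ω n a γ μ lam ν ρhat M T ρ u B) (h1 : ∀ t ∈ Icc 0 T, ∀ x ∈ Ω, ρ t x ≤ 2 * ρhat)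
    {t : ℝ} (ht : t ∈ Icc 0 T) :
    Stat Ω φ μ ν (2 * ρhat) (a * (2 * ρhat) ^ γ) (2 * μ + lam) (fl a γ ρ u B t) := by
  obtain ⟨-, hT, sρ, su, sB, sol, r0, -, bc0, db0, -⟩ := H
  have bc : ∀ x, φ x = 0 → dot (u t x) (n x) = 0 ∧ curl2 (u t) x = 0 ∧
      dot (B t x) (n x) = 0 ∧ curl2 (B t) x = 0 := by
    intro x hx
    have hx' : x ∈ frontier Ω := by rw [hd.fr]; exact hx
    rcases eq_or_lt_of_le ht.1 with h | h
    · rw [← h]; exact bc0 x hx'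
    · have e1 := sol.slipU t ⟨h, ht.2⟩ x hx'
      have e2 := sol.slipB t ⟨h, ht.2⟩ x hx'
      exact ⟨e1.1, e1.2, e2.1, e2.2⟩
  have db : ∀ x ∈ Ω, div2 (B t) x = 0 := by
    intro x hx
    rcases eq_or_lt_of_le ht.1 with h | h
    · rw [← h]; exact db0 x hx
    · exact sol.divB t ⟨h, ht.2⟩ x hx
  refine ⟨hd, hμ, hν, by linarith, by linarith, by positivity, (su 0).sm t, (su 1).sm t, (sB 0).sm t, (sB 1).sm t,
    sρ.sm t, ((sρ.sm t).c1.rpow hγ.le).cmul a, r0 t ht, h1 t ht, ?_, ?_, ?_, ?_, ?_, ?_, ?_⟩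
  · intro x hx
    exact mul_nonneg ha.le (Real.rpow_nonneg (r0 t ht x hx) _)
  · intro x hx
    exact mul_le_mul_of_nonneg_left (Real.rpow_le_rpow (r0 t ht x hx) (h1 t ht x hx) (by linarith)) ha.le
  · exact fun x hx => hn x hx _ (bc x hx).1
  · exact fun x hx => hn x hx _ (bc x hx).2.2.1
  · exact fun x hx => (bc x hx).2.1
  · exact fun x hx => (bc x hx).2.2.2
  · intro x hx
    have := db x hx
    simp only [div2, Fin.sum_univ_two] at this
    exact this

lemma fl_snap (hd : Dom Ω φ) (hn : ∀ x, φ x = 0 → ∀ v : V2, dot v (n x) = 0 → v 0 * pd 0 φ x + v 1 * pd 1 φ x = 0)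
    (ha : 0 < a) (hγ : 1 < γ) (hμ : 0 < μ) (hν : 0 < ν) (hρ : 0 < ρhat) (hlam : 0 < lam)
    (H : DataHyps Ω n a γ μ lam ν ρhat M T ρ u B) (h1 : ∀ t ∈ Icc 0 T, ∀ x ∈ Ω, ρ t x ≤ 2 * ρhat)
    {t : ℝ} (ht : t ∈ Ioo 0 T) :
    Snap Ω φ γ μ ν (2 * ρhat) (a * (2 * ρhat) ^ γ) (2 * μ + lam) (fl a γ ρ u B t) := by
  have st := fl_stat hd hn ha hγ hμ hν hρ hlam H h1 (Ioo_subset_Icc_self ht)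
  have stT : ∀ t ∈ Ioo 0 T, Tan φ (fun x => u t x 0) (fun x => u t x 1) := fun t ht =>
    (fl_stat hd hn ha hγ hμ hν hρ hlam H h1 (Ioo_subset_Icc_self ht)).tu
  obtain ⟨-, hT, sρ, su, sB, sol, r0, -, bc0, db0, -⟩ := H
  have tI : t ∈ Ioc 0 T := ⟨ht.1, ht.2.le⟩
  have sr := sρ.sm t
  have s1 := (su 0).sm t
  have s2 := (su 1).sm t
  have t1 := (sB 0).sm t
  have t2 := (sB 1).sm t
  have M : ∀ x ∈ Ω, dt ρ t x + (u t x 0 * pd 0 (ρ t) x + u t x 1 * pd 1 (ρ t) x)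
      + ρ t x * (pd 0 (fun y => u t y 0) x + pd 1 (fun y => u t y 1) x) = 0 := by
    intro x hx
    have m := sol.mass t tI x hx
    simp only [div2, Fin.sum_univ_two] at m
    rw [pd_mul 0 (sr.d x) (s1.d x), pd_mul 1 (sr.d x) (s2.d x)] at m
    linear_combination m
  have cm : ∀ i x, dt (fun s y => ρ s y * u s y i) t x = dt ρ t x * u t x i + ρ t x * dt (fun s y => u s y i) t x := by
    intro i x
    exact ((sρ.hd t x).mul ((su i).hd t x)).deriv
  have cv : ∀ i j x, pd j (fun y => ρ t y * u t y i * u t y j) x =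
      ρ t x * u t x i * pd j (fun y => u t y j) x + (ρ t x * pd j (fun y => u t y i) x + pd j (ρ t) x * u t x i) * u t x j := by
    intro i j x
    rw [pd_mul j ((sr.mul ((su i).sm t)).d x) (((su j).sm t).d x), pd_mul j (sr.d x) (((su i).sm t).d x)]
  have nb : ∀ i x, pd i (fun y => nsq (B t y)) x = 2 * (B t x 0 * pd i (fun y => B t y 0) x + B t x 1 * pd i (fun y => B t y 1) x) := by
    intro i x
    have : (fun y => nsq (B t y)) = fun y => B t y 0 * B t y 0 + B t y 1 * B t y 1 := by
      ext y; simp [nsq, Fin.sum_univ_two]; ring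
    rw [this, pd_add i ((t1.mul t1).d x) ((t2.mul t2).d x), pd_mul i (t1.d x) (t1.d x), pd_mul i (t2.d x) (t2.d x)]
    ring
  have pD : ∀ i x, pd i (fun y => div2 (u t) y) x = pd i (pd 0 (fun y => u t y 0)) x + pd i (pd 1 (fun y => u t y 1)) x := by
    intro i x
    have : (fun y => div2 (u t) y) = fun y => pd 0 (fun y => u t y 0) y + pd 1 (fun y => u t y 1) y := by
      ext y; simp [div2, Fin.sum_univ_two]
    rw [this, pd_add i ((s1.pd 0).d x) ((s2.pd 1).d x)]
  have pF : ∀ i x, pd i ((fl a γ ρ u B t).F (2 * μ + lam)) x = (2 * μ + lam) * (pd i (pd 0 (fun y => u t y 0)) x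
      + pd i (pd 1 (fun y => u t y 1)) x) - pd i (fun y => a * ρ t y ^ γ) x := by
    intro i x
    have : (fl a γ ρ u B t).F (2 * μ + lam) = fun y => (2 * μ + lam) * (pd 0 (fun y => u t y 0) y + pd 1 (fun y => u t y 1) y)
       - (fun y => a * ρ t y ^ γ) y := rfl
    have hP : DifferentiableAt ℝ (fun y => a * ρ t y ^ γ) x := st.sP.d x
    rw [this, pd_sub i ((((s1.pd 0).add (s2.pd 1)).cmul _).d x) hP,
      pd_const_mul i _ (((s1.pd 0).add (s2.pd 1)).d x), pd_add i ((s1.pd 0).d x) ((s2.pd 1).d x)]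
  have pw : ∀ i x, pd i ((fl a γ ρ u B t).w) x = pd i (pd 0 (fun y => u t y 1)) x - pd i (pd 1 (fun y => u t y 0)) x := by
    intro i x
    have : (fl a γ ρ u B t).w = fun y => pd 0 (fun y => u t y 1) y - pd 1 (fun y => u t y 0) y := rfl
    rw [this, pd_sub i ((s2.pd 0).d x) ((s1.pd 1).d x)]
  have pj : ∀ i x, pd i ((fl a γ ρ u B t).j) x = pd i (pd 0 (fun y => B t y 1)) x - pd i (pd 1 (fun y => B t y 0)) x := by
    intro i x
    have : (fl a γ ρ u B t).j = fun y => pd 0 (fun y => B t y 1) y - pd 1 (fun y => B t y 0) y := rfl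
    rw [this, pd_sub i ((t2.pd 0).d x) ((t1.pd 1).d x)]
  have pq : ∀ i x, pd i ((fl a γ ρ u B t).q) x = u t x 1 * pd i (fun y => B t y 0) x + pd i (fun y => u t y 1) x * B t x 0
      - (u t x 0 * pd i (fun y => B t y 1) x + pd i (fun y => u t y 0) x * B t x 1) := by
    intro i x
    have : (fl a γ ρ u B t).q = fun y => u t y 1 * B t y 0 - u t y 0 * B t y 1 := rfl
    rw [this, pd_sub i ((s2.mul t1).d x) ((s1.mul t2).d x), pd_mul i (s2.d x) (t1.d x), pd_mul i (s1.d x) (t2.d x)]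
  have db : ∀ x ∈ Ω, pd 0 (fun y => B t y 0) x + pd 1 (fun y => B t y 1) x = 0 := st.db
  have ddb : ∀ i, ∀ x ∈ Ω, pd i (pd 0 (fun y => B t y 0)) x + pd i (pd 1 (fun y => B t y 1)) x = 0 := by
    intro i x hx
    rw [← pd_add i ((t1.pd 0).d x) ((t2.pd 1).d x), pd_congr_open i hd.isOpen hx db, pd_const]
  refine { toStat := st, hγ := hγ, sut1 := (su 0).dt.sm t, sut2 := (su 1).dt.sm t, sc1 := (sB 0).dt.sm t, sc2 := (sB 1).dt.sm t, crt := (sρ.dt.sm t).cont, cPt := ?_, tut := ?_, mass := M, mom1 := ?_, mom2 := ?_, mag1 := ?_, mag2 := ?_, pres := ?_ }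
  · have c1 := sr.cont
    have c2 := (sρ.dt.sm t).cont
    exact continuous_const.mul ((c2.mul continuous_const).mul (c1.rpow_const fun x => Or.inr (by linarith)))
  · intro x hx
    have h2 := (((su 0).hd t x).mul_const (pd 0 φ x)).add (((su 1).hd t x).mul_const (pd 1 φ x))
    have h3 : (fun s => u s x 0 * pd 0 φ x + u s x 1 * pd 1 φ x) =ᶠ[𝓝 t] fun _ => 0 :=
      Filter.eventuallyEq_of_mem (isOpen_Ioo.mem_nhds ht) fun s hs => stT s hs x hx
    have h4 := h2.congr_of_eventuallyEq h3.symm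
    exact h4.unique (hasDerivAt_const t (0:ℝ))
  · intro x hx
    have m := sol.momentum t tI x hx 0
    rw [cm, nb, pD] at m
    simp only [Fin.sum_univ_two, cv, lap, dot, grad] at m
    have k1 := pd_comm s2 0 1 x
    have hM := M x hx
    rw [pF, pw]
    simp only [Fld.v1, Fld.j, cl, mkF]
    linear_combination m - u t x 0 * hM - μ * k1
  · intro x hx
    have m := sol.momentum t tI x hx 1
    rw [cm, nb, pD] at m
    simp only [Fin.sum_univ_two, cv, lap, dot, grad] at m
    have k1 := pd_comm s1 0 1 x
    have hM := M x hx
    rw [pF, pw]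
    simp only [Fld.v2, Fld.j, cl, mkF]
    linear_combination m - u t x 1 * hM + μ * k1
  · intro x hx
    have m := sol.magnetic t tI x hx 0
    simp only [Fin.sum_univ_two, lap, dot, grad, div2] at m
    have k1 := pd_comm t2 0 1 x
    have d0 := db x hx
    have d1 := ddb 0 x hx
    rw [pj, pq]
    simp only [mkF]
    linear_combination m + (- u t x 0) * d0 + ν * d1 - ν * k1
  · intro x hx
    have m := sol.magnetic t tI x hx 1
    simp only [Fin.sum_univ_two, lap, dot, grad, div2] at m
    have k1 := pd_comm t1 0 1 x
    have d0 := db x hx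
    have d1 := ddb 1 x hx
    rw [pj, pq]
    simp only [mkF]
    linear_combination m + (- u t x 1) * d0 + ν * d1 + ν * k1
  · intro x hx
    have hM := M x hx
    have e0 : pd 0 (fun y => a * ρ t y ^ γ) x = a * (pd 0 (ρ t) x * γ * ρ t x ^ (γ - 1)) := by
      rw [pd_const_mul 0 _ ((sr.c1.rpow hγ.le).d x), pd_rpow 0 (sr.d x) hγ.le]
    have e1 : pd 1 (fun y => a * ρ t y ^ γ) x = a * (pd 1 (ρ t) x * γ * ρ t x ^ (γ - 1)) := by
      rw [pd_const_mul 1 _ ((sr.c1.rpow hγ.le).d x), pd_rpow 1 (sr.d x) hγ.le]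
    have e2 := rpow_eq_mul (r0 t (Ioo_subset_Icc_self ht) x hx) hγ
    simp only [mkF, Fld.D, dv] 
    rw [e0, e1, e2]
    linear_combination (a * γ * ρ t x ^ (γ - 1)) * hM

end
end

section
set_option maxHeartbeats 1000000 in
lemma gron {T c k : ℝ} {A W g E E' N N' : ℝ → ℝ} (hT : 0 < T) (hc : 0 < c) (hk : 0 ≤ k)
    (cW : Continuous W) (cg : Continuous g)
    (dE : ∀ t, HasDerivAt E (E' t) t) (dN : ∀ t, HasDerivAt N (N' t) t)
    (hN' : ∀ t ∈ Ioo 0 T, N' t = - A t) (hN : ∀ t ∈ Icc 0 T, 0 ≤ N t) (hA : ∀ t ∈ Icc 0 T, 0 ≤ A t)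
    (hW : ∀ t ∈ Ioo 0 T, 0 ≤ W t)
    (hE : ∀ t ∈ Icc 0 T, A t / 4 - c ≤ E t)
    (hE' : ∀ t ∈ Ioo 0 T, E' t ≤ - (1 / 4) * W t + k * Th (A t))
    (hg : ∀ t ∈ Ioo 0 T, g t ≤ c * (W t + Th (A t))) :
    ∀ t ∈ Icc 0 T, A t + (∫ s in (0:ℝ)..T, (W s + g s)) ≤
      (4 + 4 * c) * (1 + k) * (1 + N 0) * exp (2 * ((1 + log (4 * E 0 + 4 * c + 2)) * exp (4 * k * N 0))) := by
  set y : ℝ → ℝ := fun t => 4 * E t + 4 * c + 2 with hy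
  have yA : ∀ t ∈ Icc 0 T, A t + 2 ≤ y t := fun t ht => by
    have := hE t ht; simp only [hy]; linarith
  have y2 : ∀ t ∈ Icc 0 T, 2 ≤ y t := fun t ht => by linarith [yA t ht, hA t ht]
  have dy : ∀ t, HasDerivAt y (4 * E' t) t := fun t => by
    simpa only [add_zero] using (((dE t).const_mul 4).add_const (4 * c)).add_const 2
  set z : ℝ → ℝ := fun t => 1 + log (y t) with hz
  have z1 : ∀ t ∈ Icc 0 T, 1 ≤ z t := fun t ht => by
    have := log_nonneg (show 1 ≤ y t by linarith [y2 t ht]); simp only [hz]; linarith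
  have dz : ∀ t ∈ Icc 0 T, HasDerivAt z (4 * E' t / y t) t := fun t ht =>
    ((dy t).log (by linarith [y2 t ht])).const_add 1
  have thb : ∀ t ∈ Icc 0 T, Th (A t) ≤ A t * (y t * z t) := fun t ht => by
    have a := hA t ht
    have b := yA t ht
    have l0 : 0 ≤ log (1 + A t) := log_nonneg (by linarith)
    have l1 : log (1 + A t) ≤ log (y t) := log_le_log (by linarith) (by linarith)
    unfold Th
    rw [mul_assoc]
    apply mul_le_mul_of_nonneg_left _ a
    apply mul_le_mul <;> first | (simp only [hz]; linarith) | linarith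
  set Q : ℝ → ℝ := fun t => z t * exp (4 * k * N t) with hQ
  have dQ : ∀ t ∈ Icc 0 T, HasDerivAt Q (4 * E' t / y t * exp (4 * k * N t) + z t * (exp (4 * k * N t) * (4 * k * N' t))) t :=
    fun t ht => (dz t ht).mul (((dN t).const_mul (4 * k)).exp)
  have aQ : AntitoneOn Q (Icc 0 T) := by
    apply antitoneOn_of_deriv_nonpos (convex_Icc 0 T)
    · exact fun t ht => (dQ t ht).continuousAt.continuousWithinAt
    · exact fun t ht => (dQ t (interior_subset ht)).differentiableAt.differentiableWithinAt
    · intro t ht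
      have ht' : t ∈ Icc 0 T := interior_subset ht
      rw [interior_Icc] at ht
      rw [(dQ t ht').deriv, hN' t ht]
      have yp : 0 < y t := by linarith [y2 t ht']
      have b1 : 4 * E' t ≤ 4 * k * A t * z t * y t := by
        have e1 := hE' t ht
        have e2 := hW t ht
        have e3 := mul_le_mul_of_nonneg_left (thb t ht') hk
        linarith
      have b2 : 4 * E' t / y t ≤ 4 * k * A t * z t := by
        rw [div_le_iff₀ yp]; exact b1
      have ep := exp_pos (4 * k * N t)
      have := mul_le_mul_of_nonneg_right b2 ep.le
      linarith
  have h0 : (0:ℝ) ∈ Icc 0 T := ⟨le_rfl, hT.le⟩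
  have hTT : T ∈ Icc 0 T := ⟨hT.le, le_rfl⟩
  set zm := z 0 * exp (4 * k * N 0) with hzm
  have zb : ∀ t ∈ Icc 0 T, z t ≤ zm := by
    intro t ht
    have h1 : Q t ≤ Q 0 := aQ h0 ht ht.1
    have h2 : 1 ≤ exp (4 * k * N t) := one_le_exp (by have := hN t ht; positivity)
    have h3 := z1 t ht
    have h4 : z t * 1 ≤ z t * exp (4 * k * N t) := by gcongr
    have h5 : Q t = z t * exp (4 * k * N t) := rfl
    have h6 : Q 0 = zm := rfl
    linarith
  have zm1 : 1 ≤ zm := (z1 0 h0).trans (zb 0 h0)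
  have yb : ∀ t ∈ Icc 0 T, y t ≤ exp zm := by
    intro t ht
    have h1 := zb t ht
    have h2 : z t = 1 + log (y t) := rfl
    rw [← exp_log (show 0 < y t by linarith [y2 t ht])]
    exact exp_le_exp.2 (by linarith)
  set Z := exp zm * zm with hZ
  have Z0 : 0 ≤ Z := by positivity
  have thb' : ∀ t ∈ Icc 0 T, Th (A t) ≤ A t * Z := fun t ht => by
    refine (thb t ht).trans (mul_le_mul_of_nonneg_left ?_ (hA t ht))
    exact mul_le_mul (yb t ht) (zb t ht) (by linarith [z1 t ht]) (exp_pos _).le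
  have i1 : (∫ s in (0:ℝ)..T, (W s + g s)) ≤ (-(1 + c) * y T - (4 * k * (1 + c) + c) * Z * N T)
      - (-(1 + c) * y 0 - (4 * k * (1 + c) + c) * Z * N 0) := by
    have dd : ∀ t, HasDerivAt (fun t => -(1 + c) * y t - (4 * k * (1 + c) + c) * Z * N t)
      (-(1 + c) * (4 * E' t) - (4 * k * (1 + c) + c) * Z * N' t) t := fun t =>
      ((dy t).const_mul _).sub ((dN t).const_mul _)
    apply intervalIntegral.integral_le_sub_of_hasDeriv_right_of_le hT.le
      (g := fun t => -(1 + c) * y t - (4 * k * (1 + c) + c) * Z * N t)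
      (fun t _ => (dd t).continuousAt.continuousWithinAt) (fun t _ => (dd t).hasDerivWithinAt)
    · exact (cW.add cg).continuousOn.integrableOn_Icc
    · intro t ht
      have ht' := Ioo_subset_Icc_self ht
      rw [hN' t ht]
      have e1 := hE' t ht
      have e2 := hg t ht
      have e3 := thb' t ht'
      have e4 := hA t ht'
      have e5 : k * Th (A t) ≤ k * (A t * Z) := by gcongr
      have e6 : c * Th (A t) ≤ c * (A t * Z) := by gcongr
      have e7 : (1 + c) * (4 * E' t) ≤ (1 + c) * (- W t + 4 * (k * (A t * Z))) := by
        gcongr; linarith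
      linarith
  intro t ht
  have a1 := yA t ht
  have a2 := yb t ht
  have a3 := yb 0 h0
  have a4 := y2 T hTT
  have a5 := hN T hTT
  have a6 := hN 0 h0
  have ex : zm ≤ exp zm := by linarith [add_one_le_exp zm]
  have e1 : 1 ≤ exp zm := one_le_exp (by linarith)
  have ee : exp (2 * zm) = exp zm * exp zm := by rw [← exp_add]; congr 1; ring
  have c1 : exp zm ≤ exp (2 * zm) := by rw [ee]; nlinarith
  have c2 : Z ≤ exp (2 * zm) := by rw [ee]; simp only [hZ]; gcongr
  have f1 : 0 ≤ (1 + c) * y T := by have : 0 ≤ y T := by linarith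
                                    positivity
  have f2 : 0 ≤ (4 * k * (1 + c) + c) * Z * N T := by positivity
  have f3 : (1 + c) * y 0 ≤ (1 + c) * exp (2 * zm) := by gcongr; linarith
  have f4 : (4 * k * (1 + c) + c) * Z * N 0 ≤ (4 * k * (1 + c) + c) * exp (2 * zm) * N 0 := by gcongr
  have f5 : ((2 + c) + (4 * k * (1 + c) + c) * N 0) * exp (2 * zm) ≤ ((4 + 4 * c) * (1 + k) * (1 + N 0)) * exp (2 * zm) := by
    apply mul_le_mul_of_nonneg_right _ (exp_pos _).le
    have : 0 ≤ k * N 0 := by positivity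
    have : 0 ≤ c * N 0 := by positivity
    have : 0 ≤ c * k := by positivity
    nlinarith
  have : (4 + 4 * c) * (1 + k) * (1 + N 0) * exp (2 * ((1 + log (4 * E 0 + 4 * c + 2)) * exp (4 * k * N 0)))
    = ((4 + 4 * c) * (1 + k) * (1 + N 0)) * exp (2 * zm) := rfl
  rw [this]
  linarith
end

section
variable {Ω : Set V2} {φ : V2 → ℝ}

/-- density of the physical energy -/
def Fld.nE (s : Fld) (γ : ℝ) : V2 → ℝ := fun x => (1 / 2) * (s.r x * s.U2 x) + (1 / 2) * s.B2 x + (1 / (γ - 1)) * s.P x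
/-- its time derivative -/
def Fld.nEt (s : Fld) (γ : ℝ) : V2 → ℝ := fun x => (1 / 2) * (s.rt x * s.U2 x) + s.r x * (s.u1 x * s.ut1 x + s.u2 x * s.ut2 x)
      + (s.b1 x * s.c1 x + s.b2 x * s.c2 x) + (1 / (γ - 1)) * s.Pt x

section
variable {a γ μ ν L Λ : ℝ} {ρ u1 u2 b1 b2 : ℝ → V2 → ℝ}

lemma mkP_hd (hγ : 1 < γ) (hρ : Smooth2 ρ) (t : ℝ) (x : V2) :
    HasDerivAt (fun s => (mkF a γ ρ u1 u2 b1 b2 s).P x) ((mkF a γ ρ u1 u2 b1 b2 t).Pt x) t :=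
  ((hρ.hd t x).rpow_const (Or.inr hγ.le)).const_mul a

lemma mkP_cc (hγ : 1 < γ) (hρ : Smooth2 ρ) : CC (fun t => (mkF a γ ρ u1 u2 b1 b2 t).P) :=
  continuous_const.mul (hρ.cc.rpow_const fun _ => Or.inr (by linarith))

lemma mkPt_cc (hγ : 1 < γ) (hρ : Smooth2 ρ) : CC (fun t => (mkF a γ ρ u1 u2 b1 b2 t).Pt) :=
  continuous_const.mul ((hρ.dt.cc.mul continuous_const).mul (hρ.cc.rpow_const fun _ => Or.inr (by linarith)))

lemma mk_nE_cc (hγ : 1 < γ) (hρ : Smooth2 ρ) (h1 : Smooth2 u1) (h2 : Smooth2 u2) (h3 : Smooth2 b1) (h4 : Smooth2 b2) :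
    CC (fun t => (mkF a γ ρ u1 u2 b1 b2 t).nE γ) := by
  have cP := mkP_cc (a := a) (u1 := u1) (u2 := u2) (b1 := b1) (b2 := b2) hγ hρ
  exact ((continuous_const.mul (hρ.cc.mul ((h1.cc.pow 2).add (h2.cc.pow 2)))).add
    (continuous_const.mul ((h3.cc.pow 2).add (h4.cc.pow 2)))).add (continuous_const.mul cP)

lemma mk_nEt_cc (hγ : 1 < γ) (hρ : Smooth2 ρ) (h1 : Smooth2 u1) (h2 : Smooth2 u2) (h3 : Smooth2 b1) (h4 : Smooth2 b2) :
    CC (fun t => (mkF a γ ρ u1 u2 b1 b2 t).nEt γ) := by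
  have cP := mkPt_cc (a := a) (u1 := u1) (u2 := u2) (b1 := b1) (b2 := b2) hγ hρ
  exact (((continuous_const.mul (hρ.dt.cc.mul ((h1.cc.pow 2).add (h2.cc.pow 2)))).add
    (hρ.cc.mul ((h1.cc.mul h1.dt.cc).add (h2.cc.mul h2.dt.cc)))).add
    ((h3.cc.mul h3.dt.cc).add (h4.cc.mul h4.dt.cc))).add (continuous_const.mul cP)

lemma mk_nE_hd (hγ : 1 < γ) (hρ : Smooth2 ρ) (h1 : Smooth2 u1) (h2 : Smooth2 u2) (h3 : Smooth2 b1) (h4 : Smooth2 b2)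
    (t : ℝ) (x : V2) :
    HasDerivAt (fun s => (mkF a γ ρ u1 u2 b1 b2 s).nE γ x) ((mkF a γ ρ u1 u2 b1 b2 t).nEt γ x) t := by
  have dP := mkP_hd (a := a) (u1 := u1) (u2 := u2) (b1 := b1) (b2 := b2) hγ hρ t x
  have := ((((hρ.hd t x).mul (((h1.hd t x).pow 2).add ((h2.hd t x).pow 2))).const_mul (1/2)).add
    ((((h3.hd t x).pow 2).add ((h4.hd t x).pow 2)).const_mul (1/2))).add (dP.const_mul (1 / (γ - 1)))
  refine this.congr_deriv ?_
  simp only [Fld.nEt, Fld.U2, mkF, Pi.add_apply, Pi.pow_apply]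
  push_cast; ring

lemma mk_D_cc (h1 : Smooth2 u1) (h2 : Smooth2 u2) : CC (fun t => dv (u1 t) (u2 t)) := (h1.pd 0).cc.add (h2.pd 1).cc
lemma mk_w_cc (h1 : Smooth2 u1) (h2 : Smooth2 u2) : CC (fun t => cl (u1 t) (u2 t)) := (h2.pd 0).cc.sub (h1.pd 1).cc
lemma mk_w_sm (h1 : Smooth2 u1) (h2 : Smooth2 u2) : Smooth2 (fun t => cl (u1 t) (u2 t)) := ContDiff.sub (h2.pd 0) (h1.pd 1)
lemma mk_D_hd (h1 : Smooth2 u1) (h2 : Smooth2 u2) (t : ℝ) (x : V2) :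
    HasDerivAt (fun s => dv (u1 s) (u2 s) x) (dv (dt u1 t) (dt u2 t) x) t := (h1.pdhd 0 t x).add (h2.pdhd 1 t x)
lemma mk_w_hd (h1 : Smooth2 u1) (h2 : Smooth2 u2) (t : ℝ) (x : V2) :
    HasDerivAt (fun s => cl (u1 s) (u2 s) x) (cl (dt u1 t) (dt u2 t) x) t := (h2.pdhd 0 t x).sub (h1.pdhd 1 t x)

lemma mk_eE_cc (hγ : 1 < γ) (hρ : Smooth2 ρ) (h1 : Smooth2 u1) (h2 : Smooth2 u2) (h3 : Smooth2 b1) (h4 : Smooth2 b2) :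
    CC (fun t => (mkF a γ ρ u1 u2 b1 b2 t).eE γ μ ν L Λ) := by
  have cP := mkP_cc (a := a) (u1 := u1) (u2 := u2) (b1 := b1) (b2 := b2) hγ hρ
  have cD := mk_D_cc h1 h2
  have cw := mk_w_cc h1 h2
  have cj := mk_w_cc h3 h4
  have cq : CC (fun t => (mkF a γ ρ u1 u2 b1 b2 t).q) := (h2.cc.mul h3.cc).sub (h1.cc.mul h4.cc)
  exact ((((continuous_const.mul ((continuous_const.mul (cD.pow 2)).add (continuous_const.mul (cw.pow 2)))).sub
    (cP.mul cD)).sub (cj.mul cq)).add (continuous_const.mul (cP.pow 2))).add (continuous_const.mul (cj.pow 2))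

lemma mk_dE_cc (hγ : 1 < γ) (hρ : Smooth2 ρ) (h1 : Smooth2 u1) (h2 : Smooth2 u2) (h3 : Smooth2 b1) (h4 : Smooth2 b2) :
    CC (fun t => (mkF a γ ρ u1 u2 b1 b2 t).dE γ μ ν L Λ) := by
  have cP := mkP_cc (a := a) (u1 := u1) (u2 := u2) (b1 := b1) (b2 := b2) hγ hρ
  have cPt := mkPt_cc (a := a) (u1 := u1) (u2 := u2) (b1 := b1) (b2 := b2) hγ hρ
  have cD := mk_D_cc h1 h2
  have cw := mk_w_cc h1 h2
  have cj := mk_w_cc h3 h4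
  have cDt := mk_D_cc h1.dt h2.dt
  have cwt := mk_w_cc h1.dt h2.dt
  have cjt := mk_w_cc h3.dt h4.dt
  have cq : CC (fun t => (mkF a γ ρ u1 u2 b1 b2 t).q) := (h2.cc.mul h3.cc).sub (h1.cc.mul h4.cc)
  have cqt : CC (fun t => (mkF a γ ρ u1 u2 b1 b2 t).qt) :=
    ((h2.dt.cc.mul h3.cc).add (h2.cc.mul h3.dt.cc)).sub ((h1.dt.cc.mul h4.cc).add (h1.cc.mul h4.dt.cc))
  exact (((((continuous_const.mul (cD.mul cDt)).add (continuous_const.mul (cw.mul cwt))).sub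
    ((cPt.mul cD).add (cP.mul cDt))).sub ((cjt.mul cq).add (cj.mul cqt))).add (continuous_const.mul (cP.mul cPt))).add
    (continuous_const.mul (cj.mul cjt))

lemma mk_eE_hd (hγ : 1 < γ) (hρ : Smooth2 ρ) (h1 : Smooth2 u1) (h2 : Smooth2 u2) (h3 : Smooth2 b1) (h4 : Smooth2 b2)
    (t : ℝ) (x : V2) :
    HasDerivAt (fun s => (mkF a γ ρ u1 u2 b1 b2 s).eE γ μ ν L Λ x) ((mkF a γ ρ u1 u2 b1 b2 t).dE γ μ ν L Λ x) t := by
  have dP := mkP_hd (a := a) (u1 := u1) (u2 := u2) (b1 := b1) (b2 := b2) hγ hρ t x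
  have dD := mk_D_hd h1 h2 t x
  have dw := mk_w_hd h1 h2 t x
  have dj := mk_w_hd h3 h4 t x
  have dq : HasDerivAt (fun s => (mkF a γ ρ u1 u2 b1 b2 s).q x) ((mkF a γ ρ u1 u2 b1 b2 t).qt x) t :=
    ((h2.hd t x).mul (h3.hd t x)).sub ((h1.hd t x).mul (h4.hd t x))
  have := ((((((((dD.pow 2).const_mul L).add ((dw.pow 2).const_mul μ)).const_mul (1/2)).sub (dP.mul dD)).sub (dj.mul dq)).add
    ((dP.pow 2).const_mul ((1 / (L * (2 * γ - 1))) / 2))).add ((dj.pow 2).const_mul (Λ * (ν / 2))))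
  refine this.congr_deriv ?_
  simp only [Fld.dE, Fld.D, Fld.w, Fld.j, Fld.Dt, Fld.wt, Fld.jt]
  have e1 : (mkF a γ ρ u1 u2 b1 b2 t).u1 = u1 t := rfl
  have e2 : (mkF a γ ρ u1 u2 b1 b2 t).u2 = u2 t := rfl
  have e3 : (mkF a γ ρ u1 u2 b1 b2 t).b1 = b1 t := rfl
  have e4 : (mkF a γ ρ u1 u2 b1 b2 t).b2 = b2 t := rfl
  have e5 : (mkF a γ ρ u1 u2 b1 b2 t).ut1 = dt u1 t := rfl
  have e6 : (mkF a γ ρ u1 u2 b1 b2 t).ut2 = dt u2 t := rfl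
  have e7 : (mkF a γ ρ u1 u2 b1 b2 t).c1 = dt b1 t := rfl
  have e8 : (mkF a γ ρ u1 u2 b1 b2 t).c2 = dt b2 t := rfl
  rw [e1, e2, e3, e4, e5, e6, e7, e8]
  push_cast; ring

lemma mk_X_cc (hρ : Smooth2 ρ) (h1 : Smooth2 u1) (h2 : Smooth2 u2) :
    CC (fun t x => (mkF a γ ρ u1 u2 b1 b2 t).r x * ((mkF a γ ρ u1 u2 b1 b2 t).v1 x ^ 2 + (mkF a γ ρ u1 u2 b1 b2 t).v2 x ^ 2)) := by
  have c1 : CC (fun t => (mkF a γ ρ u1 u2 b1 b2 t).v1) :=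
    h1.dt.cc.add ((h1.cc.mul (h1.pd 0).cc).add (h2.cc.mul (h1.pd 1).cc))
  have c2 : CC (fun t => (mkF a γ ρ u1 u2 b1 b2 t).v2) :=
    h2.dt.cc.add ((h1.cc.mul (h2.pd 0).cc).add (h2.cc.mul (h2.pd 1).cc))
  exact hρ.cc.mul ((c1.pow 2).add (c2.pow 2))

lemma mk_Y_cc (h3 : Smooth2 b1) (h4 : Smooth2 b2) :
    CC (fun t x => (mkF a γ ρ u1 u2 b1 b2 t).c1 x ^ 2 + (mkF a γ ρ u1 u2 b1 b2 t).c2 x ^ 2) :=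
  (h3.dt.cc.pow 2).add (h4.dt.cc.pow 2)

lemma mk_gj_cc (h3 : Smooth2 b1) (h4 : Smooth2 b2) :
    CC (fun t => gs (mkF a γ ρ u1 u2 b1 b2 t).j) := by
  have := mk_w_sm h3 h4
  exact ((this.pd 0).cc.pow 2).add ((this.pd 1).cc.pow 2)
end

set_option maxHeartbeats 1000000 in
lemma Dom.main {n : V2 → V2} (hd : Dom Ω φ) (hn : ∀ x, φ x = 0 → ∀ v : V2, dot v (n x) = 0 → v 0 * pd 0 φ x + v 1 * pd 1 φ x = 0)
    {a γ μ ν ρhat : ℝ} (ha : 0 < a) (hγ : 1 < γ) (hμ : 0 < μ) (hν : 0 < ν) (hρ : 0 < ρhat) :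
    ∃ c > 0, ∀ (lam M T : ℝ) (ρ : ℝ → V2 → ℝ) (u B : ℝ → V2 → V2), 0 < lam →
    DataHyps Ω n a γ μ lam ν ρhat M T ρ u B → (∀ t ∈ Icc 0 T, ∀ x ∈ Ω, ρ t x ≤ 2 * ρhat) →
    0 ≤ II Ω ((fl a γ ρ u B 0).nE γ) ∧ 
    ∀ Λ, Λ = 8 + c * (2 * II Ω ((fl a γ ρ u B 0).nE γ)) →
    ∀ t ∈ Icc 0 T, (fl a γ ρ u B t).A Ω μ ν (2 * μ + lam) + (∫ s in (0:ℝ)..T, ((fl a γ ρ u B s).X Ω + (fl a γ ρ u B s).Y Ω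
      + II Ω (gs (fl a γ ρ u B s).j))) ≤
      (4 + 4 * c) * (1 + c * Λ ^ 2) * (1 + II Ω ((fl a γ ρ u B 0).nE γ)) *
        exp (2 * ((1 + log (4 * (c * Λ * (1 + (fl a γ ρ u B 0).A Ω μ ν (2 * μ + lam))) + 4 * c + 2)) *
          exp (4 * (c * Λ ^ 2) * II Ω ((fl a γ ρ u B 0).nE γ)))) := by
  have hRm : 0 < 2 * ρhat := by linarith
  have hPm : 0 < a * (2 * ρhat) ^ γ := by positivity
  obtain ⟨c5, c50, H5⟩ := hd.S5 (Pm := a * (2 * ρhat) ^ γ) hμ hν hRm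
  obtain ⟨c6, c60, H6⟩ := hd.S6 hγ hμ hν hRm hPm
  obtain ⟨c7, c70, H7⟩ := hd.S7 (Rm := 2 * ρhat) hγ hμ hν hPm
  refine ⟨c5 + c6 + c7, by positivity, ?_⟩
  intro lam M T ρ u B hlam HD hb
  set c := c5 + c6 + c7 with hc
  have c0 : 0 < c := by positivity
  have st := fun t (ht : t ∈ Icc 0 T) => fl_stat hd hn ha hγ hμ hν hρ hlam HD hb ht
  have sn := fun t (ht : t ∈ Ioo 0 T) => fl_snap hd hn ha hγ hμ hν hρ hlam HD hb ht
  obtain ⟨-, hT, sρ, su, sB, -⟩ := HD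
  have h0 : (0:ℝ) ∈ Icc 0 T := ⟨le_rfl, hT.le⟩
  have s1 := su 0
  have s2 := su 1
  have s3 := sB 0
  have s4 := sB 1
  set N : ℝ → ℝ := fun t => II Ω ((fl a γ ρ u B t).nE γ) with hN
  have dN : ∀ t, HasDerivAt N (II Ω ((fl a γ ρ u B t).nEt γ)) t :=
    hd.hasDeriv (mk_nE_cc hγ sρ s1 s2 s3 s4) (mk_nEt_cc hγ sρ s1 s2 s3 s4) (mk_nE_hd hγ sρ s1 s2 s3 s4)
  have N' : ∀ t ∈ Ioo 0 T, II Ω ((fl a γ ρ u B t).nEt γ) = - (fl a γ ρ u B t).A Ω μ ν (2 * μ + lam) :=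
    fun t ht => (sn t ht).energy
  have γ1 : 0 < 1 / (γ - 1) := by apply one_div_pos.2; linarith
  have bN : ∀ t ∈ Icc 0 T, II Ω (fl a γ ρ u B t).B2 ≤ 2 * N t := by
    intro t ht
    have S := st t ht
    rw [hN]; simp only
    rw [← hd.lin1]
    refine hd.mono S.cB2 (continuous_const.mul ((mk_nE_cc hγ sρ s1 s2 s3 s4).at t)) fun x hx => ?_
    have q1 := S.r0 x hx
    have q2 := S.P0 x hx
    have q3 : 0 ≤ (fl a γ ρ u B t).U2 x := by unfold Fld.U2; positivity
    have q4 := mul_nonneg q1 q3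
    have q5 := mul_nonneg γ1.le q2
    unfold Fld.nE
    linarith
  have N0 : ∀ t ∈ Icc 0 T, 0 ≤ N t := by
    intro t ht
    have := bN t ht
    have h2 : 0 ≤ II Ω (fl a γ ρ u B t).B2 := hd.nn fun x _ => by unfold Fld.B2; positivity
    linarith
  have aN : AntitoneOn N (Icc 0 T) := by
    apply antitoneOn_of_deriv_nonpos (convex_Icc 0 T)
    · exact fun t _ => (dN t).continuousAt.continuousWithinAt
    · exact fun t _ => (dN t).differentiableAt.differentiableWithinAt
    · intro t ht
      rw [interior_Icc] at ht
      rw [(dN t).deriv, N' t ht]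
      have := (st t (Ioo_subset_Icc_self ht)).A0
      linarith
  refine ⟨N0 0 h0, ?_⟩
  intro Λ hΛ
  have hK0 := N0 0 h0
  have hΛ' : Λ = 8 + c * (2 * N 0) := hΛ
  have Λ8 : 8 ≤ Λ := by rw [hΛ']; have : 0 ≤ c * (2 * N 0) := by positivity
                        linarith
  have Λ7 : 8 + c7 * (2 * N 0) ≤ Λ := by
    rw [hΛ']; have : c7 * (2 * N 0) ≤ c * (2 * N 0) := by gcongr; rw [hc]; linarith
    linarith
  have E7 : ∀ t ∈ Icc 0 T, (fl a γ ρ u B t).A Ω μ ν (2 * μ + lam) / 4 - c ≤ II Ω ((fl a γ ρ u B t).eE γ μ ν (2 * μ + lam) Λ) ∧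
      II Ω ((fl a γ ρ u B t).eE γ μ ν (2 * μ + lam) Λ) ≤ c * Λ * (1 + (fl a γ ρ u B t).A Ω μ ν (2 * μ + lam)) := by
    intro t ht
    have hA := (st t ht).A0
    have e := H7 _ _ (st t ht) (2 * N 0) ((bN t ht).trans (by have := aN h0 ht ht.1; linarith)) Λ Λ7
    refine ⟨by have := e.1; rw [hc]; linarith, e.2.trans ?_⟩
    gcongr
    rw [hc]; linarith
  have k0 : 0 ≤ c * Λ ^ 2 := by positivity
  have G := gron (A := fun t => (fl a γ ρ u B t).A Ω μ ν (2 * μ + lam)) (W := fun t => (fl a γ ρ u B t).X Ω + (fl a γ ρ u B t).Y Ω)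
    (g := fun t => II Ω (gs (fl a γ ρ u B t).j)) (E := fun t => II Ω ((fl a γ ρ u B t).eE γ μ ν (2 * μ + lam) Λ))
    hT c0 k0 ((hd.contT (mk_X_cc sρ s1 s2)).add (hd.contT (mk_Y_cc s3 s4))) (hd.contT (mk_gj_cc s3 s4))
    (hd.hasDeriv (mk_eE_cc hγ sρ s1 s2 s3 s4) (mk_dE_cc hγ sρ s1 s2 s3 s4) (mk_eE_hd hγ sρ s1 s2 s3 s4))
    dN N' N0 (fun t ht => (st t ht).A0) (fun t ht => add_nonneg (sn t ht).X0 (sn t ht).Y0) (fun t ht => (E7 t ht).1)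
    (fun t ht => by
      have hA := (st t (Ioo_subset_Icc_self ht)).A0
      have hTh := Th_nonneg hA
      refine (H6 _ _ (sn t ht) Λ Λ8).trans ?_
      gcongr
      rw [hc]; linarith)
    (fun t ht => by
      have hA := (st t (Ioo_subset_Icc_self ht)).A0
      have hTh := Th_nonneg hA
      have hW := add_nonneg (sn t ht).X0 (sn t ht).Y0
      refine ((H5 _ _ _ (sn t ht)).2).trans ?_
      gcongr
      rw [hc]; linarith)
  intro t ht
  refine (G t ht).trans ?_
  have l1 := (E7 0 h0).1
  have l2 := (E7 0 h0).2
  have hA := (st 0 h0).A0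
  gcongr
  · linarith
end

section
variable {Ω : Set V2} {φ : V2 → ℝ}

lemma Gpot_nonneg {a γ b r : ℝ} (ha : 0 < a) (hγ : 1 < γ) (hb : 0 ≤ b) (hr : 0 ≤ r) : 0 ≤ Gpot a γ b r := by
  unfold Gpot
  apply mul_nonneg hr
  rcases le_total b r with h | h
  · apply intervalIntegral.integral_nonneg h
    intro ξ hξ
    have : b ^ γ ≤ ξ ^ γ := Real.rpow_le_rpow hb hξ.1 (by linarith)
    have : a * b ^ γ ≤ a * ξ ^ γ := by gcongr
    apply div_nonneg (by linarith) (sq_nonneg _)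
  · rw [intervalIntegral.integral_symm, ← intervalIntegral.integral_neg]
    apply intervalIntegral.integral_nonneg h
    intro ξ hξ
    have : ξ ^ γ ≤ b ^ γ := Real.rpow_le_rpow (hr.trans hξ.1) hξ.2 (by linarith)
    have : a * ξ ^ γ ≤ a * b ^ γ := by gcongr
    rw [← neg_div]
    apply div_nonneg (by linarith) (sq_nonneg _)

/-- explicit potential -/
def Hpot (a γ b r : ℝ) : ℝ := a / (γ - 1) * (r ^ γ - r * b ^ (γ - 1)) + a * b ^ γ - a * b ^ γ * r / b

lemma Gpot_eq {a γ b r : ℝ} (hγ : 1 < γ) (hb : 0 < b) (hr : 0 < r) : Gpot a γ b r = Hpot a γ b r := by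
  unfold Gpot
  have pos : ∀ ξ ∈ uIcc b r, 0 < ξ := fun ξ hξ => (lt_min hb hr).trans_le hξ.1
  have g1 : γ - 1 ≠ 0 := by linarith
  rw [intervalIntegral.integral_eq_sub_of_hasDerivAt (f := fun ξ => a / (γ - 1) * ξ ^ (γ - 1) + a * b ^ γ * ξ⁻¹)]
  · unfold Hpot
    rw [rpow_eq_mul hr.le hγ]
    field_simp
    ring
  · intro ξ hξ
    have p := pos ξ hξ
    have d1 := ((hasDerivAt_id ξ).rpow_const (p := γ - 1) (Or.inl p.ne')).const_mul (a / (γ - 1))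
    have d2 := (hasDerivAt_inv p.ne').const_mul (a * b ^ γ)
    refine (d1.add d2).congr_deriv ?_
    have e : ξ ^ γ = ξ ^ (γ - 1 - 1) * ξ ^ 2 := by
      rw [← Real.rpow_natCast ξ 2, ← Real.rpow_add p]; congr 1; push_cast; ring
    simp only [id]
    rw [e]
    field_simp
    ring
  · apply ContinuousOn.intervalIntegrable
    apply ContinuousOn.div
    · apply ContinuousOn.sub _ continuousOn_const
      exact continuousOn_const.mul (continuousOn_id.rpow_const fun x _ => Or.inr (by linarith))
    · exact (continuous_pow 2).continuousOn
    · intro ξ hξ; have := pos ξ hξ; positivity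

lemma Dom.avg_nonneg (h : Dom Ω φ) {r : V2 → ℝ} (h0 : ∀ x ∈ Ω, 0 ≤ r x) : 0 ≤ avg Ω r :=
  _root_.div_nonneg (setIntegral_nonneg h.meas h0) ENNReal.toReal_nonneg

lemma Dom.Gint (h : Dom Ω φ) {a γ : ℝ} (hγ : 1 < γ) {r : V2 → ℝ} (cr : Continuous r)
    (h0 : ∀ x ∈ Ω, 0 ≤ r x) : IntegrableOn (fun x => Gpot a γ (avg Ω r) (r x)) Ω volume := by
  rcases eq_or_lt_of_le (h.avg_nonneg h0) with hb | hb
  · have hv : (volume Ω).toReal ≠ 0 := by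
      rw [h.volE, ENNReal.toReal_ofReal h.vol_pos.le]; exact h.vol_pos.ne'
    have hi : (∫ x in Ω, r x) = 0 := by
      have := hb.symm
      unfold avg at this
      rcases div_eq_zero_iff.1 this with h1 | h1
      · exact h1
      · exact absurd h1 hv
    have hz : r =ᵐ[volume.restrict Ω] 0 := by
      rwa [setIntegral_eq_zero_iff_of_nonneg_ae (ae_restrict_of_forall_mem h.meas h0) (h.int cr)] at hi
    have : (fun x => Gpot a γ (avg Ω r) (r x)) =ᵐ[volume.restrict Ω] fun _ => 0 := by
      filter_upwards [hz] with x hx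
      rw [hx]; simp [Gpot]
    exact (integrable_congr this).2 (integrable_zero _ _ _)
  · have cH : Continuous (fun x => Hpot a γ (avg Ω r) (r x)) := by
      unfold Hpot
      have : Continuous fun x => r x ^ γ := cr.rpow_const fun _ => Or.inr (by linarith)
      fun_prop
    have hm : MeasurableSet {x | 0 < r x} := (isOpen_lt continuous_const cr).measurableSet
    have hI : IntegrableOn ({x | 0 < r x}.indicator fun x => Hpot a γ (avg Ω r) (r x)) Ω volume :=
      (h.int cH).indicator hm
    refine hI.congr_fun ?_ h.meas
    intro x hx
    by_cases hp : 0 < r x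
    · rw [indicator_of_mem (show x ∈ {x | 0 < r x} from hp)]
      exact (Gpot_eq hγ hb hp).symm
    · rw [indicator_of_notMem (show x ∉ {x | 0 < r x} from hp)]
      have : r x = 0 := le_antisymm (not_lt.1 hp) (h0 x hx)
      simp [Gpot, this]

lemma LpS_two (Ω : Set V2) (f : V2 → ℝ) : LpS 2 Ω f ^ 2 = ∫ x in Ω, f x ^ 2 := by
  unfold LpS
  have e : (fun x => |f x| ^ (2:ℝ)) = fun x => f x ^ 2 := by
    ext x; rw [Real.rpow_two, sq_abs]
  rw [e]
  have h0 : 0 ≤ ∫ x in Ω, f x ^ 2 := integral_nonneg fun x => sq_nonneg _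
  rw [← Real.rpow_natCast, ← Real.rpow_mul h0]
  norm_num

set_option maxHeartbeats 1000000 in
lemma constants {c c1 : ℝ} (hc : 0 < c) (hc1 : 0 ≤ c1) : ∃ D > 0, ∀ K M A N : ℝ, 0 ≤ K → 0 ≤ A → K + A ≤ M → 0 ≤ N → N ≤ K + c1 →
    ∀ Λ, Λ = 8 + c * (2 * N) → 
    (4 + 4 * c) * (1 + c * Λ ^ 2) * (1 + N) *
        exp (2 * ((1 + log (4 * (c * Λ * (1 + A)) + 4 * c + 2)) * exp (4 * (c * Λ ^ 2) * N))) ≤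
      (2 + M) ^ exp (2 * D * (1 + K) ^ 3) := by
  set m := 1 + c1 with hm
  have m1 : 1 ≤ m := by linarith
  set d := 8 + 2 * c * m with hd
  have d0 : 8 ≤ d := by have : 0 < 2 * c * m := by positivity
                        linarith
  set α := (4 + 4 * c) * (1 + c * d ^ 2) * (1 + m) with hα
  have α1 : 1 ≤ α := by
    have q1 : 1 ≤ 4 + 4 * c := by linarith
    have q2 : 1 ≤ 1 + c * d ^ 2 := by have : 0 ≤ c * d ^ 2 := by positivity
                                      linarith
    have q3 : 1 ≤ 1 + m := by linarith
    exact one_le_mul_of_one_le_of_one_le (one_le_mul_of_one_le_of_one_le q1 q2) q3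
  set β := 4 * c * d + 4 * c + 2 with hβ
  have β1 : 1 ≤ β := by have : 0 < 4 * c * d := by positivity
                        linarith
  have lα := log_nonneg α1
  have lβ := log_nonneg β1
  set β' := 2 * (1 + log β) + 2 with hβ'
  set Q := 2 * log α + 3 + 2 * β' with hQ
  have Q0 : 0 < Q := by linarith
  set C := 4 * (c * d ^ 2) * m with hC
  have C0 : 0 < C := by positivity
  refine ⟨(Q + C) / 2, by positivity, ?_⟩
  intro K M A N hK hA hM hN hNK Λ hΛ
  set p := 1 + K with hp
  have p1 : 1 ≤ p := by linarith
  have b2 : 2 ≤ 2 + M := by linarith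
  set b := 2 + M with hb
  have pb : p ≤ b := by linarith
  have Ab : 1 + A ≤ b := by linarith
  clear_value b
  have Nm : N ≤ m * p := by
    have : 0 ≤ c1 * K := by positivity
    rw [hm, hp]; nlinarith
  have N1 : 1 + N ≤ (1 + m) * p := by nlinarith
  have Λd : Λ ≤ d * p := by
    rw [hΛ, hd]
    have : c * N ≤ c * (m * p) := by gcongr
    nlinarith
  clear_value p m d
  have Λ0 : 0 ≤ Λ := by rw [hΛ]; positivity
  have Λ2 : Λ ^ 2 ≤ d ^ 2 * p ^ 2 := by rw [← mul_pow]; gcongr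
  have lb : 1 / 2 ≤ log b := by
    have := Real.log_two_gt_d9
    have h2 := log_le_log (by norm_num) b2
    linarith
  have pre : (4 + 4 * c) * (1 + c * Λ ^ 2) * (1 + N) ≤ α * b ^ 3 := by
    have i1 : 1 + c * Λ ^ 2 ≤ (1 + c * d ^ 2) * p ^ 2 := by
      have : c * Λ ^ 2 ≤ c * (d ^ 2 * p ^ 2) := by gcongr
      have : 1 ≤ p ^ 2 := one_le_pow₀ p1
      linarith
    calc (4 + 4 * c) * (1 + c * Λ ^ 2) * (1 + N) ≤ (4 + 4 * c) * ((1 + c * d ^ 2) * p ^ 2) * ((1 + m) * p) := by gcongr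
      _ = α * p ^ 3 := by rw [hα]; ring
      _ ≤ α * b ^ 3 := by gcongr
  have yb : 4 * (c * Λ * (1 + A)) + 4 * c + 2 ≤ β * b ^ 2 := by
    have i1 : c * Λ * (1 + A) ≤ c * (d * p) * b := by gcongr
    have i2 : c * (d * p) * b ≤ c * (d * b) * b := by gcongr
    have i3 : 1 ≤ b ^ 2 := one_le_pow₀ (by linarith)
    have i4 : (4 * c + 2) * 1 ≤ (4 * c + 2) * b ^ 2 := by gcongr
    rw [hβ]; nlinarith
  have y0 : 0 < 4 * (c * Λ * (1 + A)) + 4 * c + 2 := by positivity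
  have lgb : 1 + log (4 * (c * Λ * (1 + A)) + 4 * c + 2) ≤ β' * log b := by
    have := log_le_log y0 yb
    rw [log_mul (by linarith) (by positivity), log_pow] at this
    push_cast at this
    rw [hβ']
    have i : (1 + log β) * 1 ≤ (1 + log β) * (2 * log b) := by gcongr; linarith
    linarith
  have ex : exp (4 * (c * Λ ^ 2) * N) ≤ exp (C * p ^ 3) := by
    apply exp_le_exp.2
    calc 4 * (c * Λ ^ 2) * N ≤ 4 * (c * (d ^ 2 * p ^ 2)) * (m * p) := by gcongr
      _ = C * p ^ 3 := by rw [hC]; ring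
  set s := p ^ 3 with hs
  have s1 : 1 ≤ s := one_le_pow₀ p1
  clear_value s
  have b0 : 0 < b := by linarith
  have preE : α * b ^ 3 ≤ exp (log b * (2 * log α + 3)) := by
    rw [show log b * (2 * log α + 3) = 2 * log b * log α + 3 * log b by ring, exp_add]
    have i1 : b ^ 3 = exp (3 * log b) := by
      rw [← Real.exp_log b0, ← Real.exp_nat_mul, Real.log_exp]; norm_num
    rw [← i1]
    gcongr
    calc α = exp (1 * log α) := by rw [one_mul, exp_log (by linarith)]
      _ ≤ _ := by apply exp_le_exp.2; gcongr; linarith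
  have β'0 : 0 ≤ β' := by linarith
  have E1 : 1 ≤ exp (C * s) := one_le_exp (by positivity)
  calc _ ≤ (α * b ^ 3) * exp (2 * ((β' * log b) * exp (C * s))) := by gcongr
    _ ≤ exp (log b * (2 * log α + 3)) * exp (2 * ((β' * log b) * exp (C * s))) := by gcongr
    _ = exp (log b * (2 * log α + 3 + 2 * β' * exp (C * s))) := by rw [← exp_add]; congr 1; ring
    _ ≤ exp (log b * exp (2 * ((Q + C) / 2) * s)) := by
      apply exp_le_exp.2
      apply mul_le_mul_of_nonneg_left _ (by linarith)
      have j1 : 2 * log α + 3 + 2 * β' * exp (C * s) ≤ Q * exp (C * s) := by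
        have : (2 * log α + 3) * 1 ≤ (2 * log α + 3) * exp (C * s) := by gcongr
        rw [hQ]; linarith
      have j2 : Q ≤ exp (Q * s) := by
        have := add_one_le_exp (Q * s)
        nlinarith
      have j3 : exp (2 * ((Q + C) / 2) * s) = exp (Q * s) * exp (C * s) := by rw [← exp_add]; congr 1; ring
      rw [j3]
      exact j1.trans (by gcongr)
    _ = b ^ exp (2 * ((Q + C) / 2) * s) := by rw [Real.rpow_def_of_pos b0]
end

lemma Dom.C0_bounds {Ω : Set V2} {φ : V2 → ℝ} {n : V2 → V2} (hd : Dom Ω φ)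
    (hn : ∀ x, φ x = 0 → ∀ v : V2, dot v (n x) = 0 → v 0 * pd 0 φ x + v 1 * pd 1 φ x = 0)
    {a γ μ ν ρhat lam M T : ℝ} {ρ : ℝ → V2 → ℝ} {u B : ℝ → V2 → V2}
    (ha : 0 < a) (hγ : 1 < γ) (hμ : 0 < μ) (hν : 0 < ν) (hρ : 0 < ρhat) (hlam : 0 < lam)
    (H : DataHyps Ω n a γ μ lam ν ρhat M T ρ u B) (h1 : ∀ t ∈ Icc 0 T, ∀ x ∈ Ω, ρ t x ≤ 2 * ρhat) :
    0 ≤ C0 Ω a γ (ρ 0) (u 0) (B 0) ∧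
    C0 Ω a γ (ρ 0) (u 0) (B 0) + (fl a γ ρ u B 0).A Ω μ ν (2 * μ + lam) ≤ M ∧
    II Ω ((fl a γ ρ u B 0).nE γ) ≤ C0 Ω a γ (ρ 0) (u 0) (B 0) + (1 / (γ - 1)) * (a * (2 * ρhat) ^ γ) * vol Ω := by
  have hT := H.2.1
  have h0 : (0:ℝ) ∈ Icc 0 T := ⟨le_rfl, hT.le⟩
  have st := fl_stat hd hn ha hγ hμ hν hρ hlam H h1 h0
  obtain ⟨-, -, sρ, su, sB, -, -, -, -, -, HM⟩ := H
  set f : V2 → ℝ := fun x => ρ 0 x * nsq (u 0 x) / 2 + nsq (B 0 x) / 2 with hf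
  have ef : f = fun x => (1 / 2) * ((fl a γ ρ u B 0).r x * (fl a γ ρ u B 0).U2 x) + (1 / 2) * (fl a γ ρ u B 0).B2 x := by
    ext x; simp only [hf, nsq, Fin.sum_univ_two, Fld.U2, Fld.B2, mkF]; ring
  have cf : Continuous f := by
    rw [ef]
    exact (continuous_const.mul (st.sr.cont.mul st.cU2)).add (continuous_const.mul st.cB2)
  have f0 : ∀ x ∈ Ω, 0 ≤ f x := by
    intro x hx
    have q := st.r0 x hx
    rw [ef]; simp only [Fld.U2, Fld.B2]; positivity
  have r0 : ∀ x ∈ Ω, 0 ≤ ρ 0 x := st.r0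
  have cr : Continuous (ρ 0) := st.sr.cont
  have hG := hd.Gint (a := a) hγ cr r0
  have eC : C0 Ω a γ (ρ 0) (u 0) (B 0) = II Ω f + ∫ x in Ω, Gpot a γ (avg Ω (ρ 0)) (ρ 0 x) := by
    unfold C0 II
    exact integral_add (hd.int cf) hG
  have G0 : 0 ≤ ∫ x in Ω, Gpot a γ (avg Ω (ρ 0)) (ρ 0 x) :=
    setIntegral_nonneg hd.meas fun x hx => Gpot_nonneg ha hγ (hd.avg_nonneg r0) (r0 x hx)
  have F0 : 0 ≤ II Ω f := hd.nn f0
  refine ⟨by rw [eC]; positivity, ?_, ?_⟩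
  · rw [LpS_two, LpS_two, LpS_two] at HM
    have e1 : (∫ x in Ω, div2 (u 0) x ^ 2) = (fl a γ ρ u B 0).d2 Ω := by
      have : div2 (u 0) = (fl a γ ρ u B 0).D := by
        ext x; simp only [div2, Fin.sum_univ_two]; rfl
      rw [this]; rfl
    have e2 : (∫ x in Ω, curl2 (u 0) x ^ 2) = (fl a γ ρ u B 0).w2 Ω := rfl
    have e3 : (∫ x in Ω, curl2 (B 0) x ^ 2) = (fl a γ ρ u B 0).j2 Ω := rfl
    rw [e1, e2, e3] at HM
    unfold Fld.A
    linarith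
  · have γ1 : 0 < 1 / (γ - 1) := by apply one_div_pos.2; linarith
    have c1 : Continuous (fun _ : V2 => (1:ℝ)) := continuous_const
    have e : (fl a γ ρ u B 0).nE γ = fun x => 1 * f x + (1 / (γ - 1)) * (fl a γ ρ u B 0).P x := by
      rw [ef]; ext x; simp only [Fld.nE]; ring
    rw [e, hd.lin2 cf st.sP.cont]
    have : II Ω (fl a γ ρ u B 0).P ≤ (a * (2 * ρhat) ^ γ) * vol Ω := by
      unfold vol
      rw [← hd.lin1]
      exact hd.mono st.sP.cont (continuous_const.mul c1) fun x hx => by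
        have := st.P1 x hx
        linarith
    have := mul_le_mul_of_nonneg_left this γ1.le
    rw [eC]; linarith

theorem stmt_15
    (Ω : Set V2) (n : V2 → V2) (hΩ : SmoothDomain Ω n) (hconv : Convex ℝ Ω)
    (a γ μ ν ρhat : ℝ) (ha : 0 < a) (hγ : 1 < γ) (hμ : 0 < μ) (hν : 0 < ν)
    (hρhat : 0 < ρhat) :
    ∃ D₂ > (0:ℝ), ∀ (lam M T : ℝ) (ρ : ℝ → V2 → ℝ) (u B : ℝ → V2 → V2),
      DataHyps Ω n a γ μ lam ν ρhat M T ρ u B →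
      APriori Ω a γ μ lam ρhat T ρ →
      (∃ D, D₂ ≤ D ∧
        Real.exp ((2 + M) ^ Real.exp (D * (1 + C0 Ω a γ (ρ 0) (u 0) (B 0)) ^ 3)) ≤ lam) →
      ∀ t ∈ Icc 0 T,
        (∫ x in Ω, ((2 * μ + lam) * (div2 (u t) x) ^ 2
            + μ * (curl2 (u t) x) ^ 2 + ν * (curl2 (B t) x) ^ 2))
          + (∫ s in (0:ℝ)..T,
              ((∫ x in Ω, ρ s x * nsq (matD u s x))
                + (∫ x in Ω, nsq (grad (curl2 (B s)) x))
                + (∫ x in Ω, nsq (dtV B s x))))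
        ≤ (2 + M) ^ Real.exp (2 * D₂ * (1 + C0 Ω a γ (ρ 0) (u 0) (B 0)) ^ 3) := by
  obtain ⟨φ, hd, hn⟩ := Dom.ofSmooth hΩ hconv
  obtain ⟨c, c0, Hm⟩ := hd.main hn ha hγ hμ hν hρhat
  have γ1 : 0 < 1 / (γ - 1) := by apply one_div_pos.2; linarith
  have hv := hd.vol_pos
  obtain ⟨D, D0, HD⟩ := constants c0 (c1 := (1 / (γ - 1)) * (a * (2 * ρhat) ^ γ) * vol Ω) (by positivity)
  refine ⟨D, D0, ?_⟩
  rintro lam M T ρ u B H ⟨hb, -⟩ ⟨D', -, hD'⟩ t ht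
  have hlam : 0 < lam := (exp_pos _).trans_le hD'
  obtain ⟨N0, hm⟩ := Hm lam M T ρ u B hlam H hb
  obtain ⟨k0, k1, k2⟩ := hd.C0_bounds hn ha hγ hμ hν hρhat hlam H hb
  have h0 : (0:ℝ) ∈ Icc 0 T := ⟨le_rfl, ht.1.trans ht.2⟩
  have st0 := fl_stat hd hn ha hγ hμ hν hρhat hlam H hb h0
  have st := fl_stat hd hn ha hγ hμ hν hρhat hlam H hb ht
  refine le_trans (le_of_eq ?_) ((hm _ rfl t ht).trans (HD _ M _ _ k0 st0.A0 k1 N0 k2 _ rfl))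
  congr 1
  · have eD : div2 (u t) = (fl a γ ρ u B t).D := by
      ext x; simp only [div2, Fin.sum_univ_two]; rfl
    have ew : curl2 (u t) = (fl a γ ρ u B t).w := rfl
    have ej : curl2 (B t) = (fl a γ ρ u B t).j := rfl
    rw [eD, ew, ej]
    exact hd.lin3 (st.sD.pow 2).cont (st.sw.pow 2).cont (st.sj.pow 2).cont _ _ _
  · apply intervalIntegral.integral_congr
    intro s _
    have e1 : (∫ x in Ω, ρ s x * nsq (matD u s x)) = (fl a γ ρ u B s).X Ω := by
      have : (fun x => ρ s x * nsq (matD u s x)) = fun x => (fl a γ ρ u B s).r x *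
          ((fl a γ ρ u B s).v1 x ^ 2 + (fl a γ ρ u B s).v2 x ^ 2) := by
        ext x; simp only [nsq, Fin.sum_univ_two, matD, dot, grad]; rfl
      rw [this]; rfl
    have e2 : (∫ x in Ω, nsq (grad (curl2 (B s)) x)) = II Ω (gs (fl a γ ρ u B s).j) := by
      have : (fun x => nsq (grad (curl2 (B s)) x)) = gs (fl a γ ρ u B s).j := by
        ext x; simp only [nsq, Fin.sum_univ_two, grad]; rfl
      rw [this]; rfl
    have e3 : (∫ x in Ω, nsq (dtV B s x)) = (fl a γ ρ u B s).Y Ω := by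
      have : (fun x => nsq (dtV B s x)) = fun x => (fl a γ ρ u B s).c1 x ^ 2 + (fl a γ ρ u B s).c2 x ^ 2 := by
        ext x; simp only [nsq, Fin.sum_univ_two, dtV]; rfl
      rw [this]; rfl
    simp only [e1, e2, e3]
    ring

end MHD
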